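/- arXiv:2109.06152 — 11 statements merged into one kernel-verified Lean document; each statement's English description precedes it below -/
import Mathlib

section
/- There exist absolute constants C > 0 and c > 0 with the following property. Let F be a finite abelian group of order 2n, X a subgroup of F of index 2 with coset Y = F \ X, and D ⊆ Y a generating set of F with D = −D and |D| = d, and suppose (1) d ≥ C · (log d)^8 · (log n), (2) d ≤ n^{1/3}, and (3) |2D| ≥ d · (log d)^3. Then for all integers a, g with t = g − a, the number of small 2-linked sets A ⊆ X with |[A]| = a and |N(A)| = g is at most 2^{g − c·t}. -/
open Pointwise Real

/-- The neighborhood closure `[A] = {u ∈ X : N(u) ⊆ N(A)}` for the bipartite Cayley graph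
with parts `X`, `Y` and generator set `D ⊆ Y`; here `N(S) = S + D`. -/
def closureSet {F : Type*} [AddCommGroup F] (D X A : Set F) : Set F :=
  {u ∈ X | {u} + D ⊆ A + D}

/-- The square graph of the Cayley graph with generator set `D`:
`u ~ v` iff `u ≠ v` and `N(u) ∩ N(v) ≠ ∅`. -/
def squareGraph {F : Type*} [AddCommGroup F] (D : Set F) : SimpleGraph F :=
  SimpleGraph.fromRel (fun u v => (({u} + D) ∩ ({v} + D)).Nonempty)

/-- `A` is 2-linked if it is connected in the square graph. -/
def TwoLinked {F : Type*} [AddCommGroup F] (D A : Set F) : Prop :=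
  ((squareGraph D).induce A).Connected


namespace CG
open Finset

section graph
variable {V : Type*} [Fintype V] [DecidableEq V]

/-- A `d`-regular bipartite graph with one part `X`, given by its neighbourhoods. -/
structure Gr (nb : V → Finset V) (d : ℕ) (X : Finset V) : Prop where
  pos : 0 < d
  sym : ∀ u v, v ∈ nb u → u ∈ nb v
  deg : ∀ u, (nb u).card = d
  bip : ∀ u v, v ∈ nb u → (v ∈ X ↔ u ∉ X)

/-- `B` is closed with neighbourhood `G`. -/
structure Cl (nb : V → Finset V) (X B G : Finset V) (t : ℕ) : Prop where
  sub : B ⊆ X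
  nbh : G = B.biUnion nb
  closed : ∀ u ∈ X, nb u ⊆ G → u ∈ B
  card : G.card = B.card + t

/-- `(F,S)` is an approximating pair of `(G,B)`. -/
structure Ap (nb : V → Finset V) (d : ℕ) (X B G F S : Finset V) : Prop where
  subB : B ⊆ S
  subX : S ⊆ X
  subG : F ⊆ G
  hS : ∀ u ∈ S, 512 * (nb u \ F).card < d
  hF : ∀ v ∈ Xᶜ \ F, 512 * (nb v ∩ S).card < d

variable {nb : V → Finset V} {d : ℕ} {X : Finset V}

lemma dc (hsym : ∀ u v, v ∈ nb u → u ∈ nb v) (P Q : Finset V) :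
    ∑ u ∈ P, (nb u ∩ Q).card = ∑ v ∈ Q, (nb v ∩ P).card := by
  have h := Finset.sum_card_bipartiteAbove_eq_sum_card_bipartiteBelow (s := P) (t := Q)
    (fun u v => v ∈ nb u)
  have e1 : ∀ u, Finset.bipartiteAbove (fun u v => v ∈ nb u) Q u = nb u ∩ Q := by
    intro u; ext v; simp [Finset.bipartiteAbove, and_comm]
  have e2 : ∀ v, Finset.bipartiteBelow (fun u v => v ∈ nb u) P v = nb v ∩ P := by
    intro v; ext u; simp only [Finset.bipartiteBelow, mem_filter, mem_inter]
    constructor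
    · rintro ⟨h1, h2⟩; exact ⟨hsym _ _ h2, h1⟩
    · rintro ⟨h1, h2⟩; exact ⟨h2, hsym _ _ h1⟩
  simpa only [e1, e2] using h

lemma Cl.nb_sub {B G : Finset V} {t : ℕ} (h : Cl nb X B G t) {u : V} (hu : u ∈ B) :
    nb u ⊆ G := by
  rw [h.nbh]; exact Finset.subset_biUnion_of_mem nb hu

lemma Cl.disj {B G : Finset V} {t : ℕ} (gr : Gr nb d X) (h : Cl nb X B G t) {v : V}
    (hv : v ∈ G) : v ∉ X := by
  rw [h.nbh, mem_biUnion] at hv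
  obtain ⟨u, hu, huv⟩ := hv
  have := gr.bip u v huv
  have := h.sub hu
  tauto

lemma cut {B G : Finset V} {t : ℕ} (gr : Gr nb d X) (h : Cl nb X B G t) :
    ∑ v ∈ G, (nb v \ B).card = t * d := by
  have h1 : ∑ v ∈ G, (nb v \ B).card + ∑ v ∈ G, (nb v ∩ B).card = G.card * d := by
    rw [← Finset.sum_add_distrib]
    rw [Finset.sum_congr rfl (g := fun _ => d)]
    · simp
    · intro v _
      rw [Finset.card_sdiff_add_card_inter, gr.deg]
  have h2 : ∑ v ∈ G, (nb v ∩ B).card = B.card * d := by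
    rw [dc gr.sym, Finset.sum_congr rfl (g := fun _ => d)]
    · simp
    · intro u hu
      rw [Finset.inter_eq_left.2 (h.nb_sub hu), gr.deg]
  rw [h2, h.card, add_mul] at h1
  omega

lemma cutG {B G P : Finset V} {t : ℕ} (gr : Gr nb d X) (h : Cl nb X B G t) (hP : P ⊆ G)
    (hd : ∀ v ∈ P, d ≤ 2 * (nb v \ B).card) : P.card ≤ 2 * t := by
  have h1 : P.card * d ≤ 2 * ∑ v ∈ P, (nb v \ B).card := by
    rw [Finset.mul_sum, ← smul_eq_mul]
    exact Finset.card_nsmul_le_sum _ _ _ hd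
  have h2 : ∑ v ∈ P, (nb v \ B).card ≤ t * d := by
    rw [← cut gr h]; exact Finset.sum_le_sum_of_subset hP
  have h3 : P.card * d ≤ (2 * t) * d := by nlinarith
  exact Nat.le_of_mul_le_mul_right h3 gr.pos

lemma cutX {B G Q : Finset V} {t : ℕ} (gr : Gr nb d X) (h : Cl nb X B G t)
    (hQ : Disjoint Q B) : ∑ u ∈ Q, (nb u ∩ G).card ≤ t * d := by
  rw [dc gr.sym, ← cut gr h]
  refine Finset.sum_le_sum fun v _ => Finset.card_le_card ?_
  intro u hu
  rw [mem_inter] at hu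
  rw [mem_sdiff]
  exact ⟨hu.1, Finset.disjoint_left.1 hQ hu.2⟩

lemma greedy (nb : V → Finset V) (d κ : ℕ) (hd : 0 < d) (P T : Finset V) :
    ∃ U ⊆ P, U.card * d ≤ κ * T.card ∧
      ∀ u ∈ P, κ * ((nb u ∩ T) \ U.biUnion nb).card < d := by
  let 𝒰 := P.powerset.filter (fun U => U.card * d ≤ κ * (T ∩ U.biUnion nb).card)
  have hne : 𝒰.Nonempty := ⟨∅, by simp [𝒰]⟩
  obtain ⟨U, hU, hmax⟩ := Finset.exists_max_image 𝒰 Finset.card hne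
  have hU' : U ⊆ P ∧ U.card * d ≤ κ * (T ∩ U.biUnion nb).card := by simpa [𝒰] using hU
  refine ⟨U, hU'.1, hU'.2.trans (Nat.mul_le_mul_left _ (card_le_card inter_subset_left)), ?_⟩
  intro u hu
  by_contra hcon
  push Not at hcon
  have huU : u ∉ U := by
    intro huU
    have : (nb u ∩ T) \ U.biUnion nb = ∅ := by
      rw [Finset.sdiff_eq_empty_iff_subset]
      exact inter_subset_left.trans (Finset.subset_biUnion_of_mem nb huU)
    rw [this] at hcon
    simp at hcon; omega
  have hins : insert u U ∈ 𝒰 := by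
    simp only [𝒰, mem_filter, mem_powerset]
    refine ⟨insert_subset hu hU'.1, ?_⟩
    have : (T ∩ U.biUnion nb).card + ((nb u ∩ T) \ U.biUnion nb).card
        ≤ (T ∩ (insert u U).biUnion nb).card := by
      rw [← Finset.card_union_of_disjoint]
      · apply card_le_card
        intro v hv
        simp only [mem_union, mem_inter, mem_sdiff, mem_biUnion, mem_insert] at hv ⊢
        grind
      · rw [Finset.disjoint_left]; intro v hv hv2
        simp only [mem_inter, mem_sdiff] at hv hv2
        exact hv2.2 hv.2
    rw [card_insert_of_notMem huU]
    nlinarith [hU'.2]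
  have := hmax _ hins
  rw [card_insert_of_notMem huU] at this
  omega

def F1 (nb : V → Finset V) (F0 U1 : Finset V) : Finset V := F0 ∪ U1.biUnion nb
def S1 (nb : V → Finset V) (d : ℕ) (X F0 U1 : Finset V) : Finset V :=
  X.filter (fun u => 512 * (nb u \ F1 nb F0 U1).card < d)
def S2 (nb : V → Finset V) (d : ℕ) (X F0 U1 W : Finset V) : Finset V :=
  S1 nb d X F0 U1 \ W.biUnion nb
def F2 (nb : V → Finset V) (d : ℕ) (X F0 U1 W : Finset V) : Finset V :=
  Xᶜ.filter (fun v => d ≤ 512 * (nb v ∩ S2 nb d X F0 U1 W).card)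
def F3 (nb : V → Finset V) (d : ℕ) (X F0 U1 W U2 : Finset V) : Finset V :=
  F2 nb d X F0 U1 W ∪ U2.biUnion nb
def S3 (nb : V → Finset V) (d : ℕ) (X F0 U1 W U2 : Finset V) : Finset V :=
  (S2 nb d X F0 U1 W).filter (fun u => 512 * (nb u \ F3 nb d X F0 U1 W U2).card < d)

lemma repair {B G F0 : Finset V} {t : ℕ} (gr : Gr nb d X) (h : Cl nb X B G t)
    (hF0 : (F0 \ G).card ≤ 28 * t) (hG0 : (G \ F0).card ≤ 28 * t) :
    ∃ U1 W U2 : Finset V, U1.card * d ≤ 30000 * t ∧ W.card * d ≤ 30000 * t ∧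
      U2.card * d ≤ 30000 * t ∧
      Ap nb d X B G (F3 nb d X F0 U1 W U2) (S3 nb d X F0 U1 W U2) := by
  have hd := gr.pos
  -- first step
  obtain ⟨U1, hU1, cU1, gU1⟩ := greedy nb d 512 hd B (G \ F0)
  have hBS1 : B ⊆ S1 nb d X F0 U1 := by
    intro u hu
    simp only [S1, mem_filter]
    refine ⟨h.sub hu, ?_⟩
    refine lt_of_le_of_lt (Nat.mul_le_mul_left _ (card_le_card ?_)) (gU1 u hu)
    intro v hv
    simp only [F1, mem_sdiff, mem_union, not_or, mem_inter] at hv ⊢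
    exact ⟨⟨hv.1, h.nb_sub hu hv.1, hv.2.1⟩, hv.2.2⟩
  have hU1G : U1.biUnion nb ⊆ G := by
    intro v hv; rw [mem_biUnion] at hv
    obtain ⟨u, hu, huv⟩ := hv
    exact h.nb_sub (hU1 hu) huv
  have cS1 : (S1 nb d X F0 U1 \ B).card ≤ 58 * t := by
    set Q := S1 nb d X F0 U1 \ B
    have e1 : ∑ u ∈ Q, (nb u ∩ G).card ≤ t * d := cutX gr h disjoint_sdiff_self_left
    have e2 : ∑ u ∈ Q, (nb u ∩ (F0 \ G)).card ≤ 28 * t * d := by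
      rw [dc gr.sym]
      refine (Finset.sum_le_card_nsmul _ _ d ?_).trans ?_
      · intro v _; rw [← gr.deg v]; exact card_le_card inter_subset_left
      · rw [smul_eq_mul]; exact Nat.mul_le_mul_right _ hF0
    have e3 : Q.card * d ≤ 2 * ∑ u ∈ Q, ((nb u ∩ G).card + (nb u ∩ (F0 \ G)).card) := by
      rw [Finset.mul_sum, ← smul_eq_mul]
      apply Finset.card_nsmul_le_sum
      intro u hu
      have hu1 : u ∈ S1 nb d X F0 U1 := (mem_sdiff.1 hu).1
      simp only [S1, mem_filter] at hu1
      have c1 := Finset.card_sdiff_add_card_inter (nb u) (F1 nb F0 U1)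
      rw [gr.deg] at c1
      have c2 : (nb u ∩ F1 nb F0 U1).card ≤ (nb u ∩ G).card + (nb u ∩ (F0 \ G)).card := by
        refine (card_le_card ?_).trans (card_union_le _ _)
        intro v hv
        simp only [F1, mem_inter, mem_union, mem_sdiff] at hv ⊢
        by_cases hvG : v ∈ G
        · exact Or.inl ⟨hv.1, hvG⟩
        · refine Or.inr ⟨hv.1, ?_, hvG⟩
          rcases hv.2 with h' | h'
          · exact h'
          · exact absurd (hU1G h') hvG
      omega
    rw [Finset.sum_add_distrib] at e3
    have e4 : Q.card * d ≤ (58 * t) * d := by nlinarith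
    exact Nat.le_of_mul_le_mul_right e4 hd
  -- second step
  obtain ⟨W, hW, cW, gW⟩ := greedy nb d 512 hd (Xᶜ \ G) (S1 nb d X F0 U1 \ B)
  have hnB : ∀ v, v ∉ G → ∀ u ∈ nb v, u ∉ B := by
    intro v hv u hu hB
    exact hv (h.nb_sub hB (gr.sym _ _ hu))
  have hBS2 : B ⊆ S2 nb d X F0 U1 W := by
    intro u hu
    simp only [S2, mem_sdiff, mem_biUnion, not_exists, not_and]
    refine ⟨hBS1 hu, ?_⟩
    intro v hv huv
    exact hnB v (mem_sdiff.1 (hW hv)).2 u huv hu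
  have hF2G : F2 nb d X F0 U1 W ⊆ G := by
    intro v hv
    simp only [F2, mem_filter] at hv
    by_contra hvG
    have := gW v (mem_sdiff.2 ⟨hv.1, hvG⟩)
    have hle : (nb v ∩ S2 nb d X F0 U1 W).card ≤
        ((nb v ∩ (S1 nb d X F0 U1 \ B)) \ W.biUnion nb).card := by
      apply card_le_card
      intro u hu
      simp only [S2, mem_inter, mem_sdiff] at hu ⊢
      exact ⟨⟨hu.1, hu.2.1, hnB v hvG u hu.1⟩, hu.2.2⟩
    omega
  have cG2 : (G \ F2 nb d X F0 U1 W).card ≤ 2 * t := by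
    refine cutG gr h sdiff_subset ?_
    intro v hv
    rw [mem_sdiff] at hv
    have hvX := h.disj gr hv.1
    have h1 : 512 * (nb v ∩ S2 nb d X F0 U1 W).card < d := by
      by_contra hc
      apply hv.2
      simp only [F2, mem_filter, mem_compl]
      exact ⟨hvX, by omega⟩
    have h2 : (nb v ∩ B).card ≤ (nb v ∩ S2 nb d X F0 U1 W).card :=
      card_le_card (inter_subset_inter_left hBS2)
    have c1 := Finset.card_sdiff_add_card_inter (nb v) B
    rw [gr.deg] at c1
    omega
  -- third step
  obtain ⟨U2, hU2, cU2, gU2⟩ := greedy nb d 512 hd B (G \ F2 nb d X F0 U1 W)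
  refine ⟨U1, W, U2, ?_, ?_, ?_, ?_⟩
  · nlinarith
  · nlinarith
  · nlinarith
  constructor
  · intro u hu
    simp only [S3, mem_filter]
    refine ⟨hBS2 hu, ?_⟩
    refine lt_of_le_of_lt (Nat.mul_le_mul_left _ (card_le_card ?_)) (gU2 u hu)
    intro v hv
    simp only [F3, mem_sdiff, mem_union, not_or, mem_inter] at hv ⊢
    exact ⟨⟨hv.1, h.nb_sub hu hv.1, hv.2.1⟩, hv.2.2⟩
  · intro u hu
    simp only [S3, S2, S1, mem_filter, mem_sdiff] at hu
    exact hu.1.1.1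
  · intro v hv
    simp only [F3, mem_union] at hv
    rcases hv with hv | hv
    · exact hF2G hv
    · rw [mem_biUnion] at hv
      obtain ⟨u, hu, huv⟩ := hv
      exact h.nb_sub (hU2 hu) huv
  · intro u hu
    simp only [S3, mem_filter] at hu
    exact hu.2
  · intro v hv
    simp only [F3, mem_sdiff, mem_union, not_or] at hv
    have h1 : 512 * (nb v ∩ S2 nb d X F0 U1 W).card < d := by
      by_contra hc
      apply hv.2.1
      simp only [F2, mem_filter]
      exact ⟨hv.1, by omega⟩
    refine lt_of_le_of_lt (Nat.mul_le_mul_left _ (card_le_card ?_)) h1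
    exact inter_subset_inter_left (filter_subset _ _)

lemma ap_size {B G F S : Finset V} {t : ℕ} (gr : Gr nb d X) (h : Cl nb X B G t)
    (ap : Ap nb d X B G F S) : 128 * S.card ≤ 128 * F.card + t := by
  have hd := gr.pos
  have hGF : (G \ F).card ≤ 2 * t := by
    refine cutG gr h sdiff_subset ?_
    intro v hv
    rw [mem_sdiff] at hv
    have h1 := ap.hF v (by rw [mem_sdiff, mem_compl]; exact ⟨h.disj gr hv.1, hv.2⟩)
    have h2 : (nb v ∩ B).card ≤ (nb v ∩ S).card :=
      card_le_card (inter_subset_inter_left ap.subB)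
    have c1 := Finset.card_sdiff_add_card_inter (nb v) B
    rw [gr.deg] at c1
    omega
  have hSB : (S \ B).card ≤ 2 * t := by
    have e1 : ∑ u ∈ S \ B, (nb u ∩ G).card ≤ t * d := cutX gr h disjoint_sdiff_self_left
    have e3 : (S \ B).card * d ≤ 2 * ∑ u ∈ S \ B, (nb u ∩ G).card := by
      rw [Finset.mul_sum, ← smul_eq_mul]
      apply Finset.card_nsmul_le_sum
      intro u hu
      have h1 := ap.hS u (mem_sdiff.1 hu).1
      have c1 := Finset.card_sdiff_add_card_inter (nb u) F
      rw [gr.deg] at c1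
      have h2 : (nb u ∩ F).card ≤ (nb u ∩ G).card :=
        card_le_card (inter_subset_inter_left ap.subG)
      omega
    have e4 : (S \ B).card * d ≤ (2 * t) * d := by nlinarith
    exact Nat.le_of_mul_le_mul_right e4 hd
  have t1 : ∑ u ∈ S, (nb u ∩ F).card ≤ F.card * d := by
    rw [dc gr.sym, ← smul_eq_mul]
    refine Finset.sum_le_card_nsmul _ _ d ?_
    intro v _; rw [← gr.deg v]; exact card_le_card inter_subset_left
  have t2 : 512 * ∑ u ∈ S, (nb u ∩ (G \ F)).card ≤ (G \ F).card * d := by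
    rw [dc gr.sym, Finset.mul_sum, ← smul_eq_mul]
    refine Finset.sum_le_card_nsmul _ _ d ?_
    intro v hv
    rw [mem_sdiff] at hv
    exact (ap.hF v (by rw [mem_sdiff, mem_compl]; exact ⟨h.disj gr hv.1, hv.2⟩)).le
  have t3 : 512 * ∑ u ∈ S, (nb u \ G).card ≤ (S \ B).card * d := by
    have : ∑ u ∈ S, (nb u \ G).card = ∑ u ∈ S \ B, (nb u \ G).card := by
      symm
      apply Finset.sum_subset sdiff_subset
      intro u hu hu2
      have : u ∈ B := by
        by_contra hc; exact hu2 (mem_sdiff.2 ⟨hu, hc⟩)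
      rw [Finset.card_eq_zero, Finset.sdiff_eq_empty_iff_subset]
      exact h.nb_sub this
    rw [this, Finset.mul_sum, ← smul_eq_mul]
    refine Finset.sum_le_card_nsmul _ _ d ?_
    intro u hu
    refine le_trans (Nat.mul_le_mul_left _ (card_le_card ?_)) (ap.hS u (mem_sdiff.1 hu).1).le
    exact sdiff_subset_sdiff (Subset.refl _) ap.subG
  have t4 : S.card * d ≤ ∑ u ∈ S, ((nb u ∩ F).card + (nb u ∩ (G \ F)).card + (nb u \ G).card) := by
    rw [← smul_eq_mul]
    apply Finset.card_nsmul_le_sum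
    intro u _
    rw [← gr.deg u]
    calc (nb u).card ≤ ((nb u ∩ F) ∪ (nb u ∩ (G \ F)) ∪ (nb u \ G)).card := by
          apply card_le_card
          intro v hv
          simp only [mem_union, mem_inter, mem_sdiff]
          tauto
      _ ≤ _ := (card_union_le _ _).trans (Nat.add_le_add_right (card_union_le _ _) _)
  rw [Finset.sum_add_distrib, Finset.sum_add_distrib] at t4
  have : (128 * S.card) * d ≤ (128 * F.card + t) * d := by nlinarith
  exact Nat.le_of_mul_le_mul_right this hd

end graph
end CG


namespace CG
open Finset

lemma small_subsets {V : Type*} [DecidableEq V] (P : Finset V) (k : ℕ) (x : ℝ) (hx : 0 < x)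
    (hx1 : x ≤ 1) :
    ((P.powerset.filter (fun T => T.card ≤ k)).card : ℝ) * x ^ k ≤ (1 + x) ^ P.card := by
  have h := Finset.sum_pow_mul_eq_add_pow x 1 P
  simp only [one_pow, mul_one] at h
  rw [add_comm 1 x, ← h]
  calc ((P.powerset.filter (fun T => T.card ≤ k)).card : ℝ) * x ^ k
      = ∑ T ∈ P.powerset.filter (fun T => T.card ≤ k), x ^ k := by simp
    _ ≤ ∑ T ∈ P.powerset.filter (fun T => T.card ≤ k), x ^ T.card := by
        apply Finset.sum_le_sum
        intro T hT
        rw [mem_filter] at hT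
        exact pow_le_pow_of_le_one hx.le hx1 hT.2
    _ ≤ _ := by
        apply Finset.sum_le_sum_of_subset_of_nonneg (filter_subset _ _)
        intros; positivity

lemma small_count {V : Type*} [DecidableEq V] (P : Finset V) (N m : ℕ) (hN : 0 < N)
    (hP : P.card ≤ N) :
    ((P.powerset.filter (fun T => T.card ≤ m)).card : ℝ) ≤ 3 * (N : ℝ) ^ m := by
  have hN' : (0 : ℝ) < N := by exact_mod_cast hN
  have hN1 : (1 : ℝ) ≤ N := by exact_mod_cast hN
  have h := small_subsets P m (1 / N) (by positivity) (by rw [div_le_one hN']; exact hN1)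
  have h2 : (1 + 1 / (N : ℝ)) ^ P.card ≤ 3 := by
    calc (1 + 1 / (N : ℝ)) ^ P.card ≤ (1 + 1 / (N : ℝ)) ^ N := by
          apply pow_le_pow_right₀ _ hP
          have : 0 < 1 / (N : ℝ) := by positivity
          linarith
      _ ≤ (Real.exp (1 / N)) ^ N := by
          apply pow_le_pow_left₀ (by positivity)
          rw [add_comm]; exact Real.add_one_le_exp _
      _ = Real.exp 1 := by
          rw [← Real.exp_nat_mul]; congr 1; field_simp
      _ ≤ 3 := by have := Real.exp_one_lt_d9; linarith
  have h3 := h.trans h2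
  rw [one_div, inv_pow, ← div_eq_mul_inv, div_le_iff₀ (by positivity)] at h3
  exact h3

lemma small_inter {V : Type*} [DecidableEq V] (P S : Finset V) (hPS : P ⊆ S) (k : ℕ) :
    (S.powerset.filter (fun A => (A ∩ P).card ≤ k)).card ≤
      (P.powerset.filter (fun T => T.card ≤ k)).card * 2 ^ (S.card - P.card) := by
  rw [← card_sdiff_of_subset hPS, ← card_powerset, ← card_product]
  apply Finset.card_le_card_of_injOn (fun A => (A ∩ P, A \ P))
  · intro A hA
    simp only [coe_filter, mem_powerset, Set.mem_ofPred_eq] at hA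
    simp only [coe_product, Set.mem_prod, mem_coe, mem_filter, mem_powerset]
    exact ⟨⟨inter_subset_right, hA.2⟩, sdiff_subset_sdiff hA.1 (Subset.refl _)⟩
  · intro A _ A' _ h
    simp only [Prod.mk.injEq] at h
    rw [← sdiff_union_inter A P, ← sdiff_union_inter A' P, h.1, h.2]

lemma matching {V : Type*} [DecidableEq V] (nb : V → Finset V) (S W : Finset V) :
    ∃ P ⊆ S, ∃ f : V → V, Set.InjOn f P ∧ (∀ u ∈ P, f u ∈ nb u ∧ f u ∈ W) ∧
      ∀ u ∈ S, u ∉ P → ∀ v ∈ nb u, v ∈ W → v ∈ P.image f := by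
  classical
  let ℳ := S.powerset.filter
    (fun P : Finset V => ∃ f : V → V, Set.InjOn f P ∧ (∀ u ∈ P, f u ∈ nb u ∧ f u ∈ W))
  have hne : ℳ.Nonempty := ⟨∅, by simp only [ℳ, mem_filter, mem_powerset]; exact ⟨empty_subset _, id, by simp, by simp⟩⟩
  obtain ⟨P, hP, hmax⟩ := Finset.exists_max_image ℳ Finset.card hne
  simp only [ℳ, mem_filter, mem_powerset] at hP
  obtain ⟨hPS, f, hf, hfw⟩ := hP
  refine ⟨P, hPS, f, hf, hfw, ?_⟩
  intro u huS huP v hvu hvW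
  by_contra hv
  have hins : insert u P ∈ ℳ := by
    simp only [ℳ, mem_filter, mem_powerset]
    refine ⟨insert_subset huS hPS, Function.update f u v, ?_, ?_⟩
    · have hne : ∀ w ∈ P, w ≠ u := fun w hw e => huP (e ▸ hw)
      have hnv : ∀ w ∈ P, f w ≠ v := fun w hw e => hv (mem_image.2 ⟨w, hw, e⟩)
      intro w hw w' hw' he
      simp only [coe_insert, Set.mem_insert_iff, mem_coe] at hw hw'
      rcases hw with rfl | hw <;> rcases hw' with rfl | hw'
      · rfl
      · rw [Function.update_self, Function.update_of_ne (hne _ hw')] at he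
        exact absurd he.symm (hnv _ hw')
      · rw [Function.update_self, Function.update_of_ne (hne _ hw)] at he
        exact absurd he (hnv _ hw)
      · rw [Function.update_of_ne (hne _ hw), Function.update_of_ne (hne _ hw')] at he
        exact hf hw hw' he
    · intro w hw
      rcases mem_insert.1 hw with rfl | hw
      · simp [hvu, hvW]
      · rw [Function.update_of_ne (show w ≠ u from fun e => huP (e ▸ hw))]
        exact hfw w hw
  have := hmax _ hins
  rw [card_insert_of_notMem huP] at this
  omega

lemma num1 (k ν : ℕ) (h : 12 * k ≤ ν) : (8 : ℝ) ^ k * (9 / 8) ^ ν ≤ 2 ^ ((ν : ℝ) / 2) := by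
  have h1 : (8 : ℝ) ^ k ≤ 2 ^ ((ν : ℝ) / 4) := by
    have : (8 : ℝ) ^ k = 2 ^ ((3 * k : ℕ) : ℝ) := by
      rw [Real.rpow_natCast, pow_mul]; norm_num
    rw [this]
    apply Real.rpow_le_rpow_of_exponent_le (by norm_num)
    have : (12 * k : ℝ) ≤ ν := by exact_mod_cast h
    push_cast; linarith
  have h2 : (9 / 8 : ℝ) ≤ 2 ^ ((1 : ℝ) / 4) := by
    have h4 : ((9 / 8 : ℝ) ^ (4 : ℕ)) ^ ((1 : ℝ) / 4) ≤ 2 ^ ((1 : ℝ) / 4) :=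
      Real.rpow_le_rpow (by positivity) (by norm_num) (by norm_num)
    rwa [← Real.rpow_natCast, ← Real.rpow_mul (by norm_num),
      show ((4 : ℕ) : ℝ) * (1 / 4) = 1 by norm_num, Real.rpow_one] at h4
  have h3 : (9 / 8 : ℝ) ^ ν ≤ 2 ^ ((ν : ℝ) / 4) := by
    calc (9 / 8 : ℝ) ^ ν ≤ ((2 : ℝ) ^ ((1 : ℝ) / 4)) ^ ν := pow_le_pow_left₀ (by norm_num) h2 _
      _ = 2 ^ ((ν : ℝ) / 4) := by
        rw [← Real.rpow_natCast, ← Real.rpow_mul (by norm_num)]; congr 1; ring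
  calc (8 : ℝ) ^ k * (9 / 8) ^ ν ≤ 2 ^ ((ν : ℝ) / 4) * 2 ^ ((ν : ℝ) / 4) := by gcongr
    _ = 2 ^ ((ν : ℝ) / 2) := by rw [← Real.rpow_add (by norm_num)]; congr 1; ring

variable {V : Type*} [Fintype V] [DecidableEq V] {nb : V → Finset V} {d : ℕ} {X : Finset V}

lemma two_pow_le (s : ℕ) (r : ℝ) (h : (s : ℝ) ≤ r) : (2 : ℝ) ^ s ≤ 2 ^ r := by
  rw [← Real.rpow_natCast]
  exact Real.rpow_le_rpow_of_exponent_le (by norm_num) h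

lemma reconstruct (gr : Gr nb d X) (F S : Finset V) (a t : ℕ) (𝒜 : Finset (Finset V))
    (cl : Finset V → Finset V)
    (h : ∀ A ∈ 𝒜, A ⊆ cl A ∧ (cl A).card = a ∧ Cl nb X (cl A) (A.biUnion nb) t ∧
      Ap nb d X (cl A) (A.biUnion nb) F S) :
    (𝒜.card : ℝ) ≤ 2 ^ ((a : ℝ) + t - t / 100) := by
  rcases 𝒜.eq_empty_or_nonempty with rfl | ⟨A0, hA0⟩
  · simp; positivity
  obtain ⟨-, ha0, hc0, hap0⟩ := h A0 hA0
  have hS := ap_size gr hc0 hap0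
  have hF : F.card ≤ a + t := by
    have := card_le_card hap0.subG
    have := hc0.card
    omega
  have hSr : (128 : ℝ) * S.card ≤ 128 * F.card + t := by exact_mod_cast hS
  have hFr : (F.card : ℝ) ≤ a + t := by exact_mod_cast hF
  have htr : (0 : ℝ) ≤ t := Nat.cast_nonneg _
  by_cases c1 : 48 * F.card + t ≤ 48 * (a + t)
  · have c1r : (48 : ℝ) * F.card + t ≤ 48 * (a + t) := by exact_mod_cast c1
    have h1 : 𝒜.card ≤ 2 ^ S.card := by
      rw [← card_powerset]
      apply card_le_card
      intro A hA
      obtain ⟨h1, -, -, h4⟩ := h A hA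
      exact mem_powerset.2 (h1.trans h4.subB)
    calc (𝒜.card : ℝ) ≤ 2 ^ S.card := by exact_mod_cast h1
      _ ≤ _ := two_pow_le _ _ (by linarith)
  push Not at c1
  obtain ⟨P, hPS, f, hf, hfw, hmax⟩ := matching nb S Fᶜ
  by_cases c2 : t ≤ 4 * P.card
  · set k := a + t - F.card with hk
    have h1 : 𝒜.card ≤ (S.powerset.filter (fun A => (A ∩ P).card ≤ k)).card := by
      apply card_le_card
      intro A hA
      obtain ⟨h1, h2, h3, h4⟩ := h A hA
      simp only [mem_filter, mem_powerset]
      refine ⟨h1.trans h4.subB, ?_⟩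
      have e1 : (A ∩ P).card ≤ (A.biUnion nb \ F).card := by
        apply Finset.card_le_card_of_injOn f
        · intro u hu
          simp only [coe_inter, Set.mem_inter_iff, mem_coe] at hu
          have := hfw u hu.2
          simp only [coe_sdiff, Set.mem_sdiff, mem_coe, mem_biUnion]
          exact ⟨⟨u, hu.1, this.1⟩, mem_compl.1 this.2⟩
        · exact hf.mono (by simp)
      rw [card_sdiff_of_subset h4.subG, h3.card, h2] at e1
      exact e1
    have h2 := h1.trans (small_inter P S hPS k)
    have h3 := small_subsets P k (1 / 8) (by norm_num) (by norm_num)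
    have h3' : ((P.powerset.filter (fun T => T.card ≤ k)).card : ℝ) ≤ 8 ^ k * (9 / 8) ^ P.card := by
      rw [one_div, inv_pow, ← div_eq_mul_inv, div_le_iff₀ (by positivity)] at h3
      rw [mul_comm, show (9 / 8 : ℝ) = 1 + 8⁻¹ by norm_num]; exact h3
    have h4 := h3'.trans (num1 k P.card (by omega))
    have hle := card_le_card hPS
    have c2r : (t : ℝ) ≤ 4 * P.card := by exact_mod_cast c2
    calc (𝒜.card : ℝ) ≤ ((P.powerset.filter (fun T => T.card ≤ k)).card : ℝ)
            * 2 ^ (S.card - P.card) := by exact_mod_cast h2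
      _ ≤ 2 ^ ((P.card : ℝ) / 2) * 2 ^ ((S.card : ℝ) - P.card) := by
          gcongr
          apply two_pow_le
          rw [Nat.cast_sub hle]
      _ = 2 ^ ((S.card : ℝ) - P.card / 2) := by
          rw [← Real.rpow_add (by norm_num)]; congr 1; ring
      _ ≤ _ := by
          apply Real.rpow_le_rpow_of_exponent_le (by norm_num)
          linarith
  · push Not at c2
    have c2r : (4 : ℝ) * P.card ≤ t := by exact_mod_cast c2.le
    set Q := P.image f with hQ
    have hQc : Q.card ≤ P.card := card_image_le
    have hfib : 𝒜.card ≤ 2 ^ a *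
        (𝒜.image (fun A => (P ∩ cl A, Q ∩ A.biUnion nb))).card := by
      apply Finset.card_le_mul_card_image
      rintro ⟨P', Q'⟩ hmem
      rw [mem_image] at hmem
      obtain ⟨A1, hA1, -⟩ := hmem
      rcases (𝒜.filter (fun A => (P ∩ cl A, Q ∩ A.biUnion nb) = (P', Q'))).eq_empty_or_nonempty
        with he | ⟨A2, hA2⟩
      · rw [he]; simp
      · rw [mem_filter] at hA2
        obtain ⟨hA2, he2⟩ := hA2
        rw [← (h A2 hA2).2.1, ← card_powerset]
        apply card_le_card
        intro A hA
        rw [mem_filter, ← he2] at hA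
        obtain ⟨hA, he⟩ := hA
        simp only [Prod.mk.injEq] at he
        have key : ∀ A ∈ 𝒜, ∀ A' ∈ 𝒜, P ∩ cl A = P ∩ cl A' →
            Q ∩ A.biUnion nb = Q ∩ A'.biUnion nb → A.biUnion nb ⊆ A'.biUnion nb := by
          intro A hA A' hA' e1 e2 v hv
          obtain ⟨h1, h2, h3, h4⟩ := h A hA
          obtain ⟨h1', h2', h3', h4'⟩ := h A' hA'
          by_cases hvF : v ∈ F
          · exact h4'.subG hvF
          by_cases hvQ : v ∈ Q
          · have : v ∈ Q ∩ A'.biUnion nb := by rw [← e2]; exact mem_inter.2 ⟨hvQ, hv⟩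
            exact (mem_inter.1 this).2
          · obtain ⟨u, hu, huv⟩ := mem_biUnion.1 hv
            have huP : u ∈ P := by
              by_contra hc
              exact hvQ (hmax u (h4.subB (h1 hu)) hc v huv (mem_compl.2 hvF))
            have : u ∈ P ∩ cl A' := by rw [← e1]; exact mem_inter.2 ⟨huP, h1 hu⟩
            exact h3'.nb_sub (mem_inter.1 this).2 huv
        have hGe := key A hA A2 hA2 he.1 he.2
        rw [mem_powerset]
        intro u hu
        obtain ⟨h1, h2, h3, h4⟩ := h A hA
        apply (h A2 hA2).2.2.1.closed u (h3.sub (h1 hu))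
        exact (Finset.subset_biUnion_of_mem nb hu).trans hGe
    have himg : (𝒜.image (fun A => (P ∩ cl A, Q ∩ A.biUnion nb))).card ≤ 2 ^ P.card * 2 ^ P.card := by
      calc _ ≤ (P.powerset ×ˢ Q.powerset).card := by
            apply card_le_card
            intro x hx
            obtain ⟨A, -, rfl⟩ := mem_image.1 hx
            simp
        _ = 2 ^ P.card * 2 ^ Q.card := by rw [card_product, card_powerset, card_powerset]
        _ ≤ _ := Nat.mul_le_mul_left _ (Nat.pow_le_pow_right (by norm_num) hQc)
    have htot : 𝒜.card ≤ 2 ^ (a + (P.card + P.card)) := by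
      rw [pow_add, pow_add]
      exact hfib.trans (Nat.mul_le_mul_left _ himg)
    calc (𝒜.card : ℝ) ≤ 2 ^ (a + (P.card + P.card)) := by exact_mod_cast htot
      _ ≤ _ := by
        apply two_pow_le
        push_cast; linarith

end CG


namespace CG
open Finset

section group
variable {F : Type*} [AddCommGroup F] [Fintype F] [DecidableEq F]

def gnb (D : Finset F) (u : F) : Finset F := D.image (fun x => u + x)

lemma mem_gnb {D : Finset F} {u v : F} : v ∈ gnb D u ↔ v - u ∈ D := by
  simp only [gnb, mem_image]
  constructor
  · rintro ⟨x, hx, rfl⟩; simpa using hx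
  · intro h; exact ⟨_, h, by abel⟩

/-- the Cayley graph -/
def cay (D : Finset F) : SimpleGraph F := SimpleGraph.fromRel (fun u v => v - u ∈ D)

lemma cay_adj {D : Finset F} (hsym : ∀ x ∈ D, -x ∈ D) (h0 : (0 : F) ∉ D) {u v : F} :
    (cay D).Adj u v ↔ v - u ∈ D := by
  simp only [cay, SimpleGraph.fromRel_adj]
  constructor
  · rintro ⟨_, h | h⟩
    · exact h
    · have := hsym _ h; rwa [neg_sub] at this
  · intro h
    refine ⟨?_, Or.inl h⟩
    rintro rfl
    rw [sub_self] at h; exact h0 h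

lemma cay_conn {D : Finset F} (hsym : ∀ x ∈ D, -x ∈ D) (h0 : (0 : F) ∉ D)
    (hgen : AddSubgroup.closure (D : Set F) = ⊤) : (cay D).Connected := by
  have key : ∀ x ∈ AddSubgroup.closure (D : Set F), ∀ y, (cay D).Reachable y (y + x) := by
    intro x hx
    induction hx using AddSubgroup.closure_induction with
    | mem x hx =>
      intro y
      apply SimpleGraph.Adj.reachable
      rw [cay_adj hsym h0]; simpa using hx
    | zero => intro y; rw [add_zero]
    | add a b _ _ ha hb =>
      intro y
      rw [← add_assoc]
      exact (ha y).trans (hb (y + a))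
    | neg a _ ha =>
      intro y
      have := ha (y + -a)
      rw [neg_add_cancel_right] at this
      exact this.symm
  have : Nonempty F := ⟨0⟩
  refine SimpleGraph.Connected.mk ?_
  intro u v
  have := key (v - u) (by rw [hgen]; trivial) u
  rwa [add_sub_cancel] at this

lemma packing {D : Finset F} :
    ∃ Z : Finset F, Z.card * D.card ≤ Fintype.card F ∧
      ∀ x, ∃ z ∈ Z, x = z ∨ ∃ v, v ∈ gnb D x ∧ v ∈ gnb D z := by
  classical
  let ℳ := (univ : Finset (Finset F)).filter
    (fun Z : Finset F => ∀ z ∈ Z, ∀ z' ∈ Z, z ≠ z' → Disjoint (gnb D z) (gnb D z'))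
  have hne : ℳ.Nonempty := ⟨∅, by simp [ℳ]⟩
  obtain ⟨Z, hZ, hmax⟩ := Finset.exists_max_image ℳ Finset.card hne
  simp only [ℳ, mem_filter, mem_univ, true_and] at hZ
  refine ⟨Z, ?_, ?_⟩
  · have h1 : (Z.biUnion (gnb D)).card = ∑ z ∈ Z, (gnb D z).card := by
      apply Finset.card_biUnion
      intro z hz z' hz' h; exact hZ z hz z' hz' h
    have h2 : ∀ z, (gnb D z).card = D.card := by
      intro z; exact card_image_of_injective _ (add_right_injective z)
    simp only [h2, sum_const, smul_eq_mul] at h1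
    rw [← h1]; exact card_le_univ _
  · intro x
    by_contra hx
    push Not at hx
    have hxZ : x ∉ Z := fun h => (hx x h).1 rfl
    have hd : ∀ z ∈ Z, Disjoint (gnb D x) (gnb D z) := by
      intro z hz; rw [Finset.disjoint_left]; intro v hv; exact (hx z hz).2 v hv
    have hins : insert x Z ∈ ℳ := by
      simp only [ℳ, mem_filter, mem_univ, true_and]
      intro z hz z' hz' hn
      rcases mem_insert.1 hz with e | hz1 <;> rcases mem_insert.1 hz' with e' | hz1'
      · exact absurd (e.trans e'.symm) hn
      · rw [e]; exact hd _ hz1'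
      · rw [e']; exact (hd _ hz1).symm
      · exact hZ z hz1 z' hz1' hn
    have := hmax _ hins
    rw [card_insert_of_notMem hxZ] at this
    omega

lemma skeleton {D : Finset F} (hsym : ∀ x ∈ D, -x ∈ D) (h0 : (0 : F) ∉ D)
    (hgen : AddSubgroup.closure (D : Set F) = ⊤) :
    ∃ (Z : Finset F) (r : F) (p : F → F) (rk : F → ℕ) (zf : F → F),
      Z.card * D.card ≤ Fintype.card F ∧ r ∈ Z ∧
      (∀ x, zf x ∈ Z ∧ (cay D).dist x (zf x) ≤ 2) ∧
      ∀ z ∈ Z, z ≠ r → p z ∈ Z ∧ (cay D).dist z (p z) ≤ 5 ∧ rk (p z) < rk z := by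
  classical
  have hc := cay_conn hsym h0 hgen
  obtain ⟨Z, hZc, hZ⟩ := packing (D := D)
  have hzf : ∀ x, ∃ z, z ∈ Z ∧ (cay D).dist x z ≤ 2 ∧ (x ∈ Z → z = x) := by
    intro x
    by_cases hx : x ∈ Z
    · exact ⟨x, hx, by simp, fun _ => rfl⟩
    obtain ⟨z, hz, h⟩ := hZ x
    refine ⟨z, hz, ?_, fun h => absurd h hx⟩
    rcases h with rfl | ⟨v, hv, hv'⟩
    · simp
    · have a1 : (cay D).Adj x v := (cay_adj hsym h0).2 (mem_gnb.1 hv)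
      have a2 : (cay D).Adj v z := ((cay_adj hsym h0).2 (mem_gnb.1 hv')).symm
      have := hc.dist_triangle (u := x) (v := v) (w := z)
      rw [SimpleGraph.dist_eq_one_iff_adj.2 a1, SimpleGraph.dist_eq_one_iff_adj.2 a2] at this
      exact this
  choose zf hzf1 hzf2 hzf3 using hzf
  let H : SimpleGraph F :=
    SimpleGraph.fromRel (fun z z' => z ∈ Z ∧ z' ∈ Z ∧ (cay D).dist z z' ≤ 5)
  have hH : ∀ z z', H.Adj z z' → z ∈ Z ∧ z' ∈ Z ∧ (cay D).dist z z' ≤ 5 := by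
    intro z z' h
    simp only [H, SimpleGraph.fromRel_adj] at h
    rcases h with ⟨_, h | h⟩
    · exact h
    · rw [SimpleGraph.dist_comm]; exact ⟨h.2.1, h.1, h.2.2⟩
  have hstep : ∀ x y, (cay D).Adj x y → H.Reachable (zf x) (zf y) := by
    intro x y hxy
    by_cases he : zf x = zf y
    · rw [he]
    apply SimpleGraph.Adj.reachable
    simp only [H, SimpleGraph.fromRel_adj]
    refine ⟨he, Or.inl ⟨hzf1 x, hzf1 y, ?_⟩⟩
    have t1 := hc.dist_triangle (u := zf x) (v := x) (w := zf y)
    have t2 := hc.dist_triangle (u := x) (v := y) (w := zf y)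
    have t3 := hzf2 x
    have t4 := hzf2 y
    rw [SimpleGraph.dist_comm] at t3
    rw [SimpleGraph.dist_eq_one_iff_adj.2 hxy] at t2
    omega
  have hreach : ∀ x y, H.Reachable (zf x) (zf y) := by
    intro x y
    obtain ⟨w⟩ := hc.preconnected x y
    induction w with
    | nil => exact SimpleGraph.Reachable.refl _
    | cons h _ ih => exact (hstep _ _ h).trans ih
  let r := zf 0
  have hp : ∀ z, ∃ z', z ∈ Z → z ≠ r → H.Adj z z' ∧ H.dist z' r < H.dist z r := by
    intro z
    by_cases hz : z ∈ Z ∧ z ≠ r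
    · have hr : H.Reachable z r := by
        have := hreach z 0
        rwa [hzf3 z hz.1] at this
      obtain ⟨w, hw⟩ := hr.exists_walk_length_eq_dist
      cases w with
      | nil => exact absurd rfl hz.2
      | @cons _ v _ h w' =>
        refine ⟨v, fun _ _ => ⟨h, ?_⟩⟩
        rw [SimpleGraph.Walk.length_cons] at hw
        have := SimpleGraph.dist_le w'
        omega
    · exact ⟨z, fun h1 h2 => absurd ⟨h1, h2⟩ hz⟩
  choose p hp using hp
  refine ⟨Z, r, p, fun z => H.dist z r, zf, hZc, hzf1 0, fun x => ⟨hzf1 x, hzf2 x⟩, ?_⟩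
  intro z hz hzr
  obtain ⟨h1, h2⟩ := hp z hz hzr
  obtain ⟨-, h3, h4⟩ := hH _ _ h1
  exact ⟨h3, h4, h2⟩

/-- number of translates on which the labels of `x` and `y` differ -/
def dl (M : Finset F) (x y : F) : ℕ :=
  (univ.filter (fun h : F => ¬ (x + h ∈ M ↔ y + h ∈ M))).card

lemma dl_triangle (M : Finset F) (x y z : F) : dl M x z ≤ dl M x y + dl M y z := by
  unfold dl
  refine (card_le_card ?_).trans (card_union_le _ _)
  intro h
  simp only [mem_filter, mem_univ, true_and, mem_union]
  tauto

lemma dl_adj {D X B G : Finset F} {t : ℕ} (hsym : ∀ x ∈ D, -x ∈ D)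
    (h : Cl (gnb D) X B G t) {x y : F} (hxy : y - x ∈ D) : dl (B ∪ G) x y ≤ 2 * t := by
  set e := y - x with he
  have hy : y = x + e := by rw [he]; abel
  have hadd : ∀ f ∈ D, ∀ b ∈ B, b + f ∈ G := by
    intro f hf b hb
    apply h.nb_sub hb
    rw [mem_gnb]; simpa using hf
  have hcard : ∀ f ∈ D, (G \ B.image (fun b => b + f)).card = t := by
    intro f hf
    rw [card_sdiff_of_subset, card_image_of_injective _ (add_left_injective f), h.card]
    · omega
    · intro v hv
      obtain ⟨b, hb, rfl⟩ := mem_image.1 hv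
      exact hadd f hf b hb
  have hne := hsym e hxy
  unfold dl
  calc _ ≤ ((G \ B.image (fun b => b + e)).image (fun w => w - y) ∪
        (G \ B.image (fun b => b + -e)).image (fun w => w - x)).card := by
        apply card_le_card
        intro k hk
        simp only [mem_filter, mem_univ, true_and] at hk
        simp only [mem_union, mem_image, mem_sdiff, not_exists, not_and] at hk ⊢
        by_cases hx : x + k ∈ B ∨ x + k ∈ G
        · right
          have hy' : ¬ (y + k ∈ B ∨ y + k ∈ G) := by tauto
          push Not at hy'
          refine ⟨x + k, ⟨?_, ?_⟩, by abel⟩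
          · rcases hx with hx | hx
            · exfalso; apply hy'.2
              have := hadd e hxy _ hx
              rwa [show x + k + e = y + k by rw [hy]; abel] at this
            · exact hx
          · intro b hb hbe
            apply hy'.1
            have : y + k = b := by rw [hy, show x + e + k = (x + k) + e by abel, ← hbe]; abel
            rwa [this]
        · left
          have hy' : (y + k ∈ B ∨ y + k ∈ G) := by tauto
          push Not at hx
          refine ⟨y + k, ⟨?_, ?_⟩, by abel⟩
          · rcases hy' with hy' | hy'
            · exfalso; apply hx.2
              have := hadd _ hne _ hy'
              rwa [show y + k + -e = x + k by rw [hy]; abel] at this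
            · exact hy'
          · intro b hb hbe
            apply hx.1
            have : x + k = b := by
              have : x + k = (y + k) - e := by rw [hy]; abel
              rw [this, ← hbe]; abel
            rwa [this]
    _ ≤ t + t := by
        refine (card_union_le _ _).trans (Nat.add_le_add ?_ ?_)
        · exact card_image_le.trans (hcard e hxy).le
        · exact card_image_le.trans (hcard _ hne).le
    _ = 2 * t := by ring

lemma dl_dist {D X B G : Finset F} {t : ℕ} (hsym : ∀ x ∈ D, -x ∈ D) (h0 : (0 : F) ∉ D)
    (hgen : AddSubgroup.closure (D : Set F) = ⊤)
    (h : Cl (gnb D) X B G t) (x y : F) : dl (B ∪ G) x y ≤ 2 * t * (cay D).dist x y := by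
  obtain ⟨w, hw⟩ := (cay_conn hsym h0 hgen).exists_walk_length_eq_dist x y
  rw [← hw]
  clear hw
  induction w with
  | nil => simp [dl]
  | cons hadj w ih =>
    rw [SimpleGraph.Walk.length_cons, mul_add, mul_one, add_comm]
    exact (dl_triangle _ _ _ _).trans
      (Nat.add_le_add (dl_adj hsym h ((cay_adj hsym h0).1 hadj)) ih)

/-- the decoded coarse approximation -/
def M0 (zf : F → F) (M : Finset F) (h : F) : Finset F :=
  univ.filter (fun x => zf (x - h) + h ∈ M)

/-- the disagreement set -/
def dis (Z : Finset F) (r : F) (p : F → F) (M : Finset F) (h : F) : Finset F :=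
  Z.filter (fun z => z ≠ r ∧ ¬ (z + h ∈ M ↔ p z + h ∈ M))

lemma label_eq {Z : Finset F} {r : F} {p : F → F} {rk : F → ℕ}
    (hp : ∀ z ∈ Z, z ≠ r → p z ∈ Z ∧ rk (p z) < rk z) {M M' : Finset F} {h : F}
    (hr : r + h ∈ M ↔ r + h ∈ M') (hdis : dis Z r p M h = dis Z r p M' h) :
    ∀ z ∈ Z, (z + h ∈ M ↔ z + h ∈ M') := by
  have key : ∀ k, ∀ z ∈ Z, rk z = k → (z + h ∈ M ↔ z + h ∈ M') := by
    intro k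
    induction k using Nat.strong_induction_on with
    | _ k ih =>
      intro z hz hk
      by_cases hzr : z = r
      · rw [hzr]; exact hr
      obtain ⟨h1, h2⟩ := hp z hz hzr
      have h3 := ih (rk (p z)) (hk ▸ h2) (p z) h1 rfl
      have h4 : z ∈ dis Z r p M h ↔ z ∈ dis Z r p M' h := by rw [hdis]
      simp only [dis, mem_filter, hz, true_and] at h4
      tauto
  intro z hz
  exact key _ z hz rfl

lemma M0_eq {Z : Finset F} {r : F} {p : F → F} {rk : F → ℕ} {zf : F → F}
    (hzf : ∀ x, zf x ∈ Z)
    (hp : ∀ z ∈ Z, z ≠ r → p z ∈ Z ∧ rk (p z) < rk z) {M M' : Finset F} {h : F}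
    (hr : r + h ∈ M ↔ r + h ∈ M') (hdis : dis Z r p M h = dis Z r p M' h) :
    M0 zf M h = M0 zf M' h := by
  ext x
  simp only [M0, mem_filter, mem_univ, true_and]
  exact label_eq hp hr hdis _ (hzf _)

def Phi (Z : Finset F) (r : F) (p zf : F → F) (d : ℕ) (M : Finset F) (h : F) : ℕ :=
  (symmDiff (M0 zf M h) M).card + d * (dis Z r p M h).card

lemma sum_Phi {D X B G Z : Finset F} {t n : ℕ} (hsym : ∀ x ∈ D, -x ∈ D) (h0 : (0 : F) ∉ D)
    (hgen : AddSubgroup.closure (D : Set F) = ⊤) (hn : Fintype.card F = 2 * n)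
    (h : Cl (gnb D) X B G t) {r : F} {p zf : F → F}
    (hZ : Z.card * D.card ≤ Fintype.card F)
    (hzf : ∀ x, (cay D).dist x (zf x) ≤ 2)
    (hp : ∀ z ∈ Z, z ≠ r → (cay D).dist z (p z) ≤ 5) :
    ∑ k : F, Phi Z r p zf D.card (B ∪ G) k ≤ 28 * n * t := by
  set M := B ∪ G
  unfold Phi
  rw [Finset.sum_add_distrib, ← Finset.mul_sum]
  have e1 : ∑ k : F, (symmDiff (M0 zf M k) M).card ≤ 8 * n * t := by
    have s1 : ∀ k : F, (symmDiff (M0 zf M k) M).card =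
        (univ.filter (fun w : F => ¬ (w + k ∈ M ↔ zf w + k ∈ M))).card := by
      intro k
      symm
      apply Finset.card_bij (fun w _ => w + k)
      · intro w hw
        simp only [mem_filter, mem_univ, true_and] at hw
        simp only [mem_symmDiff, M0, mem_filter, mem_univ, true_and, add_sub_cancel_right]
        tauto
      · intro w _ w' _ he; exact add_right_cancel he
      · intro x hx
        refine ⟨x - k, ?_, by abel⟩
        simp only [mem_symmDiff, M0, mem_filter, mem_univ, true_and] at hx
        simp only [mem_filter, mem_univ, true_and, sub_add_cancel]
        tauto
    simp only [s1]
    have := Finset.sum_card_bipartiteAbove_eq_sum_card_bipartiteBelow (s := (univ : Finset F))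
      (t := (univ : Finset F)) (fun k w => ¬ (w + k ∈ M ↔ zf w + k ∈ M))
    simp only [Finset.bipartiteAbove, Finset.bipartiteBelow] at this
    rw [this]
    calc _ ≤ ∑ w : F, 4 * t := by
          apply Finset.sum_le_sum
          intro w _
          have h1 := dl_dist hsym h0 hgen h w (zf w)
          have h2 := hzf w
          unfold dl at h1
          refine h1.trans ?_
          nlinarith
      _ = 8 * n * t := by
          rw [sum_const, card_univ, hn, smul_eq_mul]; ring
  have e2 : ∑ k : F, (dis Z r p M k).card ≤ Z.card * (10 * t) := by
    have := Finset.sum_card_bipartiteAbove_eq_sum_card_bipartiteBelow (s := (univ : Finset F))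
      (t := Z) (fun k z => z ≠ r ∧ ¬ (z + k ∈ M ↔ p z + k ∈ M))
    simp only [Finset.bipartiteAbove, Finset.bipartiteBelow] at this
    unfold dis
    rw [this, ← smul_eq_mul]
    apply Finset.sum_le_card_nsmul
    intro z hz
    by_cases hzr : z = r
    · simp [hzr]
    have h1 := dl_dist hsym h0 hgen h z (p z)
    have h2 := hp z hz hzr
    unfold dl at h1
    refine le_trans (card_le_card ?_) (h1.trans (by nlinarith))
    intro k hk
    simp only [mem_filter, mem_univ, true_and] at hk ⊢
    exact hk.2
  rw [hn] at hZ
  nlinarith [Nat.mul_le_mul_left D.card e2, Nat.mul_le_mul_right (10 * t) hZ]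

/-- At least half of the translates are good. -/
lemma good_half {D X B G Z : Finset F} {t n : ℕ} (hsym : ∀ x ∈ D, -x ∈ D) (h0 : (0 : F) ∉ D)
    (hgen : AddSubgroup.closure (D : Set F) = ⊤) (hn : Fintype.card F = 2 * n)
    (h : Cl (gnb D) X B G t) {r : F} {p zf : F → F}
    (hZ : Z.card * D.card ≤ Fintype.card F)
    (hzf : ∀ x, (cay D).dist x (zf x) ≤ 2)
    (hp : ∀ z ∈ Z, z ≠ r → (cay D).dist z (p z) ≤ 5) :
    n ≤ (univ.filter (fun k => Phi Z r p zf D.card (B ∪ G) k ≤ 28 * t)).card := by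
  have hs := sum_Phi hsym h0 hgen hn h hZ hzf hp
  have hsplit := Finset.card_filter_add_card_filter_not (s := (univ : Finset F))
    (fun k => Phi Z r p zf D.card (B ∪ G) k ≤ 28 * t)
  rw [card_univ, hn] at hsplit
  set bad := univ.filter (fun k => ¬ Phi Z r p zf D.card (B ∪ G) k ≤ 28 * t)
  have h1 : bad.card * (28 * t + 1) ≤ 28 * n * t := by
    refine le_trans ?_ hs
    refine le_trans ?_ (Finset.sum_le_sum_of_subset (subset_univ bad))
    rw [← smul_eq_mul]
    apply Finset.card_nsmul_le_sum
    intro k hk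
    simp only [bad, mem_filter, mem_univ, true_and] at hk
    omega
  have h2 : bad.card ≤ n := by
    by_contra hc
    push Not at hc
    nlinarith
  omega

end group
end CG


namespace CG
open Finset

lemma final_num (n d m t : ℕ) (hn : 2 ≤ n) (hd : 10 ^ 8 ≤ d)
    (hlog : (10 : ℝ) ^ 8 * logb 2 n ≤ d) (hm : m * d ≤ 30000 * t) (ht : d ≤ 28 * t) :
    (324 : ℝ) * ((2 * n : ℕ) : ℝ) ^ (4 * m) ≤ 2 ^ ((t : ℝ) / 200) := by
  have hnr : (2 : ℝ) ≤ n := by exact_mod_cast hn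
  have hl1 : 1 ≤ logb 2 (n : ℝ) := by
    rw [Real.le_logb_iff_rpow_le (by norm_num) (by linarith)]; simpa using hnr
  have hN : (((2 * n : ℕ) : ℝ)) ≤ 2 ^ (2 * logb 2 (n : ℝ)) := by
    have h1 : (2 : ℝ) ^ (logb 2 (n : ℝ)) = n :=
      Real.rpow_logb (by norm_num) (by norm_num) (by linarith)
    rw [two_mul (logb 2 (n : ℝ)), Real.rpow_add (by norm_num), h1]
    push_cast
    nlinarith
  have hN4 : (((2 * n : ℕ) : ℝ)) ^ (4 * m) ≤ 2 ^ (8 * (m * logb 2 (n : ℝ))) := by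
    calc (((2 * n : ℕ) : ℝ)) ^ (4 * m) ≤ ((2 : ℝ) ^ (2 * logb 2 (n : ℝ))) ^ (4 * m) :=
          pow_le_pow_left₀ (by positivity) hN _
      _ = _ := by
          rw [← Real.rpow_natCast, ← Real.rpow_mul (by norm_num)]
          congr 1; push_cast; ring
  have hmr : (m : ℝ) * d ≤ 30000 * t := by exact_mod_cast hm
  have htr : (d : ℝ) ≤ 28 * t := by exact_mod_cast ht
  have hdr : (10 : ℝ) ^ 8 ≤ d := by exact_mod_cast hd
  have h5 : (m : ℝ) * (10 ^ 8 * logb 2 (n : ℝ)) ≤ m * d :=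
    mul_le_mul_of_nonneg_left hlog (Nat.cast_nonneg _)
  have h6 : (m : ℝ) * logb 2 (n : ℝ) ≤ 30000 * t / 10 ^ 8 := by
    rw [le_div_iff₀ (by norm_num)]; linarith
  calc (324 : ℝ) * ((2 * n : ℕ) : ℝ) ^ (4 * m)
      ≤ 2 ^ (9 : ℝ) * 2 ^ (8 * (m * logb 2 (n : ℝ))) := by
        gcongr
        rw [show (9 : ℝ) = ((9 : ℕ) : ℝ) by norm_num, Real.rpow_natCast]; norm_num
    _ = 2 ^ (9 + 8 * (m * logb 2 (n : ℝ))) := by rw [← Real.rpow_add (by norm_num)]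
    _ ≤ _ := by
        apply Real.rpow_le_rpow_of_exponent_le (by norm_num)
        norm_num at h6 hdr ⊢
        linarith

section group
variable {F : Type*} [AddCommGroup F] [Fintype F] [DecidableEq F]

lemma main (D X : Finset F) (n : ℕ) (hn : Fintype.card F = 2 * n)
    (gr : Gr (gnb D) D.card X) (hsym : ∀ x ∈ D, -x ∈ D) (h0 : (0 : F) ∉ D)
    (hgen : AddSubgroup.closure (D : Set F) = ⊤)
    (hlog : (10 : ℝ) ^ 8 * logb 2 n ≤ D.card) (hdn : 2 * D.card ≤ n) (hd8 : 10 ^ 8 ≤ D.card)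
    (𝒜 : Finset (Finset F)) (cl : Finset F → Finset F) (a t : ℕ) (han : 2 * a ≤ n)
    (h : ∀ A ∈ 𝒜, A.Nonempty ∧ A ⊆ cl A ∧ (cl A).card = a ∧
      Cl (gnb D) X (cl A) (A.biUnion (gnb D)) t) :
    (𝒜.card : ℝ) ≤ 2 ^ ((a : ℝ) + t - t / 200) := by
  classical
  rcases 𝒜.eq_empty_or_nonempty with rfl | ⟨A0, hA0⟩
  · simp; positivity
  obtain ⟨Z, r, p, rk, zf, hZ, hrZ, hzf, hp⟩ := skeleton hsym h0 hgen
  have hgood : ∀ A ∈ 𝒜, n ≤ (univ.filter (fun k =>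
      Phi Z r p zf D.card (cl A ∪ A.biUnion (gnb D)) k ≤ 28 * t)).card := by
    intro A hA
    exact good_half hsym h0 hgen hn (h A hA).2.2.2 hZ (fun x => (hzf x).2)
      (fun z hz hzr => (hp z hz hzr).2.1)
  have hp' : ∀ z ∈ Z, z ≠ r → p z ∈ Z ∧ rk (p z) < rk z :=
    fun z hz hzr => ⟨(hp z hz hzr).1, (hp z hz hzr).2.2⟩
  -- lower bound on `t`
  have ht : D.card ≤ 28 * t := by
    by_contra hcon
    push Not at hcon
    obtain ⟨hne, hsub, hca, hcl⟩ := h A0 hA0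
    have hg := hgood A0 hA0
    have : (univ.filter (fun k =>
      Phi Z r p zf D.card (cl A0 ∪ A0.biUnion (gnb D)) k ≤ 28 * t)).Nonempty := by
      rw [← Finset.card_pos]; omega
    obtain ⟨k, hk⟩ := this
    replace hk := (mem_filter.1 hk).2
    unfold Phi at hk
    set M := cl A0 ∪ A0.biUnion (gnb D) with hM
    have hMc : M.card = a + (a + t) := by
      rw [hM, card_union_of_disjoint, hcl.card, hca]
      rw [Finset.disjoint_left]
      intro v hv hv2
      exact hcl.disj gr hv2 (hcl.sub hv)
    have hdis : dis Z r p M k = ∅ := by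
      rw [← Finset.card_eq_zero]
      by_contra hc
      have : 1 ≤ (dis Z r p M k).card := Nat.one_le_iff_ne_zero.2 hc
      have := Nat.mul_le_mul_left D.card this
      omega
    have hga : D.card ≤ a + t := by
      obtain ⟨u, hu⟩ := hne
      have := card_le_card (hcl.nb_sub (hsub hu))
      rw [gr.deg, hcl.card, hca] at this
      exact this
    by_cases hr : r + k ∈ M
    · have : M0 zf M k = M0 zf univ k := by
        apply M0_eq (fun x => (hzf x).1) hp' (by simp [hr])
        rw [hdis]; symm; simp [dis]
      have hu : M0 zf (univ : Finset F) k = univ := by simp [M0]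
      rw [this, hu] at hk
      have h1 : (univ : Finset F).card ≤ (symmDiff univ M).card + M.card := by
        refine (card_le_card ?_).trans (card_union_le _ _)
        intro x _
        simp only [mem_union, mem_symmDiff, mem_univ, true_and]
        tauto
      rw [card_univ, hn, hMc] at h1
      omega
    · have : M0 zf M k = M0 zf ∅ k := by
        apply M0_eq (fun x => (hzf x).1) hp' (by simp [hr])
        rw [hdis]; symm; simp [dis]
      have hu : M0 zf (∅ : Finset F) k = ∅ := by simp [M0]
      rw [this, hu] at hk
      have h1 : M.card ≤ (symmDiff ∅ M).card := by
        apply card_le_card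
        intro x hx
        simp [mem_symmDiff, hx]
      rw [hMc] at h1
      omega
  -- choose a good translate
  have hk : ∃ k : F, 𝒜.card ≤ 2 * (𝒜.filter (fun A =>
      Phi Z r p zf D.card (cl A ∪ A.biUnion (gnb D)) k ≤ 28 * t)).card := by
    by_contra hcon
    push Not at hcon
    have h1 : ∑ k : F, 2 * (𝒜.filter (fun A =>
      Phi Z r p zf D.card (cl A ∪ A.biUnion (gnb D)) k ≤ 28 * t)).card < ∑ k : F, 𝒜.card :=
      Finset.sum_lt_sum_of_nonempty ⟨0, mem_univ _⟩ (fun k _ => hcon k)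
    have h2 := Finset.sum_card_bipartiteAbove_eq_sum_card_bipartiteBelow (s := (univ : Finset F))
      (t := 𝒜) (fun k A => Phi Z r p zf D.card (cl A ∪ A.biUnion (gnb D)) k ≤ 28 * t)
    simp only [Finset.bipartiteAbove, Finset.bipartiteBelow] at h2
    rw [← Finset.mul_sum, h2, sum_const, card_univ, hn, smul_eq_mul] at h1
    have h3 := Finset.card_nsmul_le_sum 𝒜 _ n hgood
    rw [smul_eq_mul] at h3
    nlinarith
  obtain ⟨k, hk⟩ := hk
  set Mf : Finset F → Finset F := fun A => cl A ∪ A.biUnion (gnb D) with hMf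
  set 𝒢 := 𝒜.filter (fun A => Phi Z r p zf D.card (Mf A) k ≤ 28 * t) with h𝒢
  have hrep : ∀ A, ∃ U1 W U2 : Finset F, A ∈ 𝒢 →
      (U1.card * D.card ≤ 30000 * t ∧ W.card * D.card ≤ 30000 * t ∧
      U2.card * D.card ≤ 30000 * t ∧
      Ap (gnb D) D.card X (cl A) (A.biUnion (gnb D))
        (F3 (gnb D) D.card X (M0 zf (Mf A) k ∩ Xᶜ) U1 W U2)
        (S3 (gnb D) D.card X (M0 zf (Mf A) k ∩ Xᶜ) U1 W U2)) := by
    intro A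
    by_cases hA : A ∈ 𝒢
    · rw [h𝒢, mem_filter] at hA
      obtain ⟨hA, hPhi⟩ := hA
      obtain ⟨hne, hsub, hca, hcl⟩ := h A hA
      have hsd : (symmDiff (M0 zf (Mf A) k) (Mf A)).card ≤ 28 * t := by
        unfold Phi at hPhi; omega
      have hF0 : ((M0 zf (Mf A) k ∩ Xᶜ) \ A.biUnion (gnb D)).card ≤ 28 * t := by
        refine (card_le_card ?_).trans hsd
        intro x hx
        simp only [mem_sdiff, mem_inter, mem_compl] at hx
        rw [mem_symmDiff]
        refine Or.inl ⟨hx.1.1, ?_⟩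
        simp only [hMf, mem_union, not_or]
        exact ⟨fun hc => hx.1.2 (hcl.sub hc), hx.2⟩
      have hG0 : (A.biUnion (gnb D) \ (M0 zf (Mf A) k ∩ Xᶜ)).card ≤ 28 * t := by
        refine (card_le_card ?_).trans hsd
        intro x hx
        rw [mem_sdiff] at hx
        rw [mem_symmDiff]
        refine Or.inr ⟨?_, ?_⟩
        · simp only [hMf, mem_union]; exact Or.inr hx.1
        · intro hc
          exact hx.2 (mem_inter.2 ⟨hc, mem_compl.2 (hcl.disj gr hx.1)⟩)
      obtain ⟨U1, W, U2, hh⟩ := repair gr hcl hF0 hG0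
      exact ⟨U1, W, U2, fun _ => hh⟩
    · exact ⟨∅, ∅, ∅, fun hc => absurd hc hA⟩
  choose U1 W U2 hU using hrep
  set m := 30000 * t / D.card with hm
  have hmd : m * D.card ≤ 30000 * t := Nat.div_mul_le_self _ _
  have hle : ∀ s : ℕ, s * D.card ≤ 30000 * t → s ≤ m := by
    intro s hs
    rw [hm, Nat.le_div_iff_mul_le gr.pos]; exact hs
  let sm : Finset F → Finset (Finset F) := fun P => P.powerset.filter (fun T => T.card ≤ m)
  let code : Finset F → Bool × Finset F × Finset F × Finset F × Finset F := fun A =>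
    (decide (r + k ∈ Mf A), dis Z r p (Mf A) k, U1 A, W A, U2 A)
  have hfib : 𝒢.card ≤ ⌊(2 : ℝ) ^ ((a : ℝ) + t - t / 100)⌋₊ * (𝒢.image code).card := by
    apply Finset.card_le_mul_card_image
    intro c hc
    obtain ⟨A1, hA1, rfl⟩ := mem_image.1 hc
    apply Nat.le_floor
    apply reconstruct gr (F3 (gnb D) D.card X (M0 zf (Mf A1) k ∩ Xᶜ) (U1 A1) (W A1) (U2 A1))
      (S3 (gnb D) D.card X (M0 zf (Mf A1) k ∩ Xᶜ) (U1 A1) (W A1) (U2 A1)) a t _ cl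
    intro A hA
    rw [mem_filter] at hA
    obtain ⟨hA, hcode⟩ := hA
    have hA' : A ∈ 𝒜 := (mem_filter.1 hA).1
    obtain ⟨hne, hsub, hca, hcl⟩ := h A hA'
    refine ⟨hsub, hca, hcl, ?_⟩
    simp only [code, Prod.mk.injEq, decide_eq_decide] at hcode
    obtain ⟨e1, e2, e3, e4, e5⟩ := hcode
    have := (hU A hA).2.2.2
    rwa [M0_eq (fun x => (hzf x).1) hp' e1 e2, e3, e4, e5] at this
  have himg : (𝒢.image code).card ≤ 2 * ((sm Z).card * ((sm univ).card *
      ((sm univ).card * (sm univ).card))) := by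
    calc _ ≤ ((univ : Finset Bool) ×ˢ (sm Z ×ˢ (sm univ ×ˢ (sm univ ×ˢ sm univ)))).card := by
          apply card_le_card
          intro c hc
          obtain ⟨A, hA, rfl⟩ := mem_image.1 hc
          obtain ⟨h1, h2, h3, -⟩ := hU A hA
          have hPhi := (mem_filter.1 hA).2
          unfold Phi at hPhi
          simp only [code, mem_product, mem_univ, true_and, sm, mem_filter, mem_powerset,
            subset_univ]
          refine ⟨⟨filter_subset _ _, hle _ ?_⟩, hle _ h1, hle _ h2, hle _ h3⟩
          rw [mul_comm]; omega
      _ = _ := by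
          simp only [card_product, card_univ, Fintype.card_bool]
  have hsm : ∀ P : Finset F, ((sm P).card : ℝ) ≤ 3 * ((2 * n : ℕ) : ℝ) ^ m := by
    intro P
    apply small_count P (2 * n) m (by omega)
    rw [← hn]; exact card_le_univ _
  set K := (2 : ℝ) ^ ((a : ℝ) + t - t / 100) with hK
  have hKpos : 0 ≤ K := by positivity
  have hfl : (⌊K⌋₊ : ℝ) ≤ K := Nat.floor_le hKpos
  have hnum := final_num n D.card m t (by omega) hd8 hlog hmd ht
  have hb : ((𝒢.image code).card : ℝ) ≤ 162 * ((2 * n : ℕ) : ℝ) ^ (4 * m) := by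
    set q := ((2 * n : ℕ) : ℝ) ^ m with hq
    have hq0 : 0 ≤ q := by positivity
    calc ((𝒢.image code).card : ℝ) ≤ 2 * ((sm Z).card * ((sm univ).card *
          ((sm univ).card * (sm univ).card))) := by exact_mod_cast himg
      _ ≤ 2 * ((3 * q) * ((3 * q) * ((3 * q) * (3 * q)))) := by
          have h1 := hsm Z
          have h2 := hsm univ
          gcongr
      _ = 162 * q ^ 4 := by ring
      _ = _ := by rw [hq, ← pow_mul, mul_comm m 4]
  calc (𝒜.card : ℝ) ≤ 2 * 𝒢.card := by exact_mod_cast hk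
    _ ≤ 2 * (⌊K⌋₊ * (𝒢.image code).card) := by
        have : (𝒢.card : ℝ) ≤ ⌊K⌋₊ * (𝒢.image code).card := by exact_mod_cast hfib
        linarith
    _ ≤ 2 * (K * (162 * ((2 * n : ℕ) : ℝ) ^ (4 * m))) := by gcongr
    _ = K * (324 * ((2 * n : ℕ) : ℝ) ^ (4 * m)) := by ring
    _ ≤ K * 2 ^ ((t : ℝ) / 200) := by gcongr
    _ = _ := by
        rw [hK, ← Real.rpow_add (by norm_num)]; congr 1; ring

end group
end CG
namespace CG
open Finset

lemma one_gen {F : Type*} [AddCommGroup F] [Fintype F] (D : Set F) (hsym : ∀ x ∈ D, -x ∈ D)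
    (hgen : AddSubgroup.closure D = ⊤) (h1 : D.ncard ≤ 1) : Fintype.card F ≤ 2 := by
  classical
  have hD : ∃ x : F, D ⊆ {x} ∧ 2 • x = 0 := by
    rcases D.eq_empty_or_nonempty with rfl | ⟨x, hx⟩
    · exact ⟨0, by simp, by simp⟩
    · have h2 : ∀ {a b : F}, a ∈ D → b ∈ D → a = b := (Set.ncard_le_one_iff (Set.toFinite D)).1 h1
      refine ⟨x, fun y hy => h2 hy hx, ?_⟩
      have h3 : -x = x := h2 (hsym x hx) hx
      rw [two_nsmul]
      nth_rewrite 1 [← h3]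
      simp
  obtain ⟨x, hx, hx2⟩ := hD
  have htop : AddSubgroup.zmultiples x = ⊤ := by
    rw [AddSubgroup.zmultiples_eq_closure, eq_top_iff, ← hgen]
    exact AddSubgroup.closure_mono hx
  have hle : addOrderOf x ≤ 2 := addOrderOf_le_of_nsmul_eq_zero (by norm_num) hx2
  rw [← Nat.card_zmultiples, htop] at hle
  simpa [Nat.card_eq_fintype_card] using hle

lemma numerics (n d : ℕ) (hd : 2 ≤ d)
    (h1 : (10 : ℝ) ^ 8 * (logb 2 d) ^ (8 : ℕ) * logb 2 n ≤ (d : ℝ))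
    (h2 : (d : ℝ) ≤ (n : ℝ) ^ ((1 : ℝ) / 3)) :
    (10 : ℝ) ^ 8 * logb 2 n ≤ d ∧ 2 * d ≤ n ∧ 10 ^ 8 ≤ d := by
  have hdr : (2 : ℝ) ≤ d := by exact_mod_cast hd
  have hn3 : (d : ℝ) ^ 3 ≤ n := by
    calc (d : ℝ) ^ 3 ≤ ((n : ℝ) ^ ((1 : ℝ) / 3)) ^ 3 := pow_le_pow_left₀ (by linarith) h2 3
      _ = n := by
        rw [← Real.rpow_natCast, ← Real.rpow_mul (Nat.cast_nonneg n)]; norm_num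
  have hnd : (2 : ℝ) * d ≤ n := by
    have : (2 : ℝ) * d ≤ d ^ 3 := by nlinarith [mul_nonneg (by linarith : (0 : ℝ) ≤ d) (by linarith : (0 : ℝ) ≤ d - 2), mul_nonneg (mul_nonneg (by linarith : (0 : ℝ) ≤ d) (by linarith : (0 : ℝ) ≤ d)) (by linarith : (0 : ℝ) ≤ d - 2)]
    linarith
  have hl : ∀ m : ℝ, 2 ≤ m → 1 ≤ logb 2 m := by
    intro m hm
    rw [Real.le_logb_iff_rpow_le (by norm_num) (by linarith)]; simpa using hm
  have hld := one_le_pow₀ (n := 8) (hl d hdr)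
  have hln := hl n (by linarith)
  have h3 : (10 : ℝ) ^ 8 * logb 2 n ≤ d := by
    refine le_trans ?_ h1
    rw [mul_assoc]
    apply mul_le_mul_of_nonneg_left _ (by norm_num)
    nlinarith
  refine ⟨h3, by exact_mod_cast hnd, ?_⟩
  have : (10 : ℝ) ^ 8 ≤ d := by linarith
  exact_mod_cast this

section group
variable {F : Type*} [AddCommGroup F] [Fintype F] [DecidableEq F]

lemma coe_nbh (D A : Finset F) : ((A.biUnion (gnb D) : Finset F) : Set F) = (A : Set F) + D := by
  ext v
  simp only [coe_biUnion, Set.mem_iUnion, mem_coe, mem_gnb, Set.mem_add, exists_prop]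
  constructor
  · rintro ⟨u, hu, hv⟩; exact ⟨u, hu, v - u, hv, by abel⟩
  · rintro ⟨u, hu, x, hx, rfl⟩; exact ⟨u, hu, by simpa using hx⟩

lemma coe_gnb (D : Finset F) (u : F) : ((gnb D u : Finset F) : Set F) = {u} + (D : Set F) := by
  ext v
  simp only [mem_coe, mem_gnb, Set.singleton_add, Set.mem_image]
  constructor
  · intro hv; exact ⟨v - u, hv, by abel⟩
  · rintro ⟨x, hx, rfl⟩; simpa using hx

def clf (D X A : Finset F) : Finset F := X.filter (fun u => gnb D u ⊆ A.biUnion (gnb D))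

lemma coe_clf (D X A : Finset F) :
    ((clf D X A : Finset F) : Set F) = closureSet (D : Set F) X A := by
  ext v
  simp only [clf, closureSet, mem_coe, mem_filter, Set.mem_setOf_eq, ← coe_gnb, ← coe_nbh,
    coe_subset]

lemma sub_clf {D X A : Finset F} (h : A ⊆ X) : A ⊆ clf D X A := by
  intro u hu
  exact mem_filter.2 ⟨h hu, subset_biUnion_of_mem _ hu⟩

lemma biUnion_clf {D X A : Finset F} (h : A ⊆ X) :
    A.biUnion (gnb D) = (clf D X A).biUnion (gnb D) := by
  apply subset_antisymm
  · exact biUnion_subset_biUnion_of_subset_left _ (sub_clf h)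
  · exact biUnion_subset.2 fun u hu => (mem_filter.1 hu).2

lemma clf_card_le {D X A : Finset F} (h : D.Nonempty) :
    (clf D X A).card ≤ (A.biUnion (gnb D)).card := by
  obtain ⟨x, hx⟩ := h
  apply card_le_card_of_injOn (fun u => u + x)
  · intro u hu
    exact (mem_filter.1 hu).2 (mem_gnb.2 (by simpa using hx))
  · intro u _ v _ huv
    simpa using huv

lemma final (n : ℕ) (hF : Fintype.card F = 2 * n) (X : AddSubgroup F) (hX : X.index = 2)
    (D : Set F) (hDX : D ⊆ (↑X : Set F)ᶜ) (hsym : ∀ x ∈ D, -x ∈ D)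
    (hgen : AddSubgroup.closure D = ⊤) (d : ℕ) (hd : D.ncard = d)
    (h1 : (10 : ℝ) ^ 8 * (logb 2 d) ^ (8 : ℕ) * logb 2 n ≤ (d : ℝ))
    (h2 : (d : ℝ) ≤ (n : ℝ) ^ ((1 : ℝ) / 3)) (a g : ℕ) :
    (Nat.card {A : Set F // A ⊆ (↑X : Set F) ∧ TwoLinked D A ∧
        2 * (closureSet D (↑X) A).ncard ≤ n ∧
        (closureSet D (↑X) A).ncard = a ∧ (A + D).ncard = g} : ℝ) ≤
      2 ^ ((g : ℝ) - 1 / 200 * ((g : ℝ) - (a : ℝ))) := by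
  classical
  set S := {A : Set F // A ⊆ (↑X : Set F) ∧ TwoLinked D A ∧
        2 * (closureSet D (↑X) A).ncard ≤ n ∧
        (closureSet D (↑X) A).ncard = a ∧ (A + D).ncard = g} with hS
  rcases isEmpty_or_nonempty S with hE | ⟨⟨A0, hA0⟩⟩
  · rw [Nat.card_of_isEmpty]; simp; positivity
  set Df : Finset F := D.toFinset with hDf
  set Xf : Finset F := (X : Set F).toFinset with hXf
  have hDc : (Df : Set F) = D := by simp [hDf]
  have hXc : (Xf : Set F) = (X : Set F) := by simp [hXf]
  have hmX : ∀ u, u ∈ Xf ↔ u ∈ X := by intro u; simp [hXf]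
  have hmD : ∀ u, u ∈ Df ↔ u ∈ D := by intro u; simp [hDf]
  have key : ∀ A : Set F, A ⊆ (X : Set F) → TwoLinked D A →
      A.toFinset.Nonempty ∧ A.toFinset ⊆ Xf ∧
      (clf Df Xf A.toFinset).card = (closureSet D X A).ncard ∧
      (A.toFinset.biUnion (gnb Df)).card = (A + D).ncard := by
    intro A hAX hL
    refine ⟨?_, ?_, ?_, ?_⟩
    · obtain ⟨x⟩ := hL.nonempty
      exact ⟨x.1, by simp⟩
    · intro u hu
      exact (hmX u).2 (hAX (by simpa using hu))
    · rw [← Set.ncard_coe_finset, coe_clf, hDc, hXc, Set.coe_toFinset]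
    · rw [← Set.ncard_coe_finset, coe_nbh, hDc, Set.coe_toFinset]
  have hDcard : Df.card = d := by rw [← Set.ncard_coe_finset, hDc, hd]
  obtain ⟨hA1, hA2, hA3, hA4, hA5⟩ := hA0
  obtain ⟨k1, k2, k3, k4⟩ := key A0 hA1 hA2
  have hapos : 0 < a := by
    rw [← hA4, ← k3]
    exact card_pos.2 (k1.mono (sub_clf k2))
  have han : 2 * a ≤ n := by rw [← hA4]; exact hA3
  have hd2 : 2 ≤ d := by
    by_contra hcon
    have := one_gen D hsym hgen (by omega)
    omega
  obtain ⟨n1, n2, n3⟩ := numerics n d hd2 h1 h2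
  have hag : a ≤ g := by
    rw [← hA4, ← k3, ← hA5, ← k4]
    exact clf_card_le (card_pos.1 (by omega))
  obtain ⟨t, rfl⟩ := Nat.exists_eq_add_of_le hag
  have h0 : (0 : F) ∉ Df := by
    intro h; exact hDX ((hmD 0).1 h) X.zero_mem
  have gr : Gr (gnb Df) Df.card Xf := by
    refine ⟨by omega, ?_, ?_, ?_⟩
    · intro u v h
      simp only [mem_gnb, hmD] at h ⊢
      simpa using hsym _ h
    · intro u
      exact card_image_of_injective _ (add_right_injective u)
    · intro u v hv
      have hv := mem_gnb.1 hv
      have h3 : v - u ∉ X := hDX ((hmD _).1 hv)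
      have h4 := AddSubgroup.add_mem_iff_of_index_two hX (a := v - u) (b := u)
      rw [sub_add_cancel] at h4
      simp only [hmX]
      tauto
  have hm := main Df Xf n hF gr (by simpa only [hmD] using hsym) h0 (by rw [hDc]; exact hgen)
    (by rw [hDcard]; exact n1) (by omega) (by omega)
    (univ.filter (fun B : Finset F => (B : Set F) ⊆ (↑X : Set F) ∧ TwoLinked D (B : Set F) ∧
        2 * (closureSet D (↑X) (B : Set F)).ncard ≤ n ∧
        (closureSet D (↑X) (B : Set F)).ncard = a ∧ ((B : Set F) + D).ncard = a + t))
    (clf Df Xf) a t han (by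
      intro B hB
      obtain ⟨b1, b2, b3, b4, b5⟩ := (mem_filter.1 hB).2
      obtain ⟨c1, c2, c3, c4⟩ := key _ b1 b2
      rw [toFinset_coe] at c1 c2 c3 c4
      refine ⟨c1, sub_clf c2, by rw [c3, b4], ?_⟩
      refine ⟨filter_subset _ _, biUnion_clf c2, ?_, ?_⟩
      · intro u hu hs
        exact mem_filter.2 ⟨hu, hs⟩
      · rw [c3, c4, b4, b5])
  have hcard : Nat.card S ≤ (univ.filter (fun B : Finset F => (B : Set F) ⊆ (↑X : Set F) ∧
        TwoLinked D (B : Set F) ∧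
        2 * (closureSet D (↑X) (B : Set F)).ncard ≤ n ∧
        (closureSet D (↑X) (B : Set F)).ncard = a ∧ ((B : Set F) + D).ncard = a + t)).card := by
    rw [← Fintype.card_coe, ← Nat.card_eq_fintype_card]
    refine Nat.card_le_card_of_injective (fun A : S => ⟨A.1.toFinset, ?_⟩) ?_
    · rw [mem_filter, Set.coe_toFinset]; exact ⟨mem_univ _, A.2⟩
    · intro A B hAB
      have := congrArg Subtype.val hAB
      exact Subtype.ext (Set.toFinset_inj.1 this)
  calc (Nat.card S : ℝ) ≤ _ := by exact_mod_cast hcard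
    _ ≤ _ := hm
    _ = _ := by congr 1; push_cast; ring

end group
end CG

theorem stmt2 :
    ∃ C c : ℝ, 0 < C ∧ 0 < c ∧
      ∀ (n : ℕ) (F : Type) [AddCommGroup F] [Fintype F],
        Fintype.card F = 2 * n →
        ∀ X : AddSubgroup F, X.index = 2 →
          ∀ D : Set F, D ⊆ (↑X : Set F)ᶜ → (∀ x ∈ D, -x ∈ D) →
            AddSubgroup.closure D = ⊤ →
            ∀ d : ℕ, D.ncard = d →
              C * (logb 2 d) ^ (8 : ℕ) * logb 2 n ≤ (d : ℝ) →
              (d : ℝ) ≤ (n : ℝ) ^ ((1 : ℝ) / 3) →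
              (d : ℝ) * (logb 2 d) ^ (3 : ℕ) ≤ ((D + D).ncard : ℝ) →
              ∀ a g : ℕ,
                (Nat.card {A : Set F // A ⊆ (↑X : Set F) ∧ TwoLinked D A ∧
                    2 * (closureSet D (↑X) A).ncard ≤ n ∧
                    (closureSet D (↑X) A).ncard = a ∧ (A + D).ncard = g} : ℝ) ≤
                  2 ^ ((g : ℝ) - c * ((g : ℝ) - (a : ℝ))) := by
  refine ⟨10 ^ 8, 1 / 200, by norm_num, by norm_num, ?_⟩
  intro n F _ _ hF X hX D hDX hsym hgen d hd h1 h2 _ a g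
  classical
  exact CG.final n hF X hX D hDX hsym hgen d hd h1 h2 a g
end

section
/- (Plünnecke–Ruzsa–Petridis inequality) Let F be an abelian group and let M, D ⊆ F be finite nonempty subsets, and let α = |M + D| / |M| (a real number). Then for every nonnegative integer j there exists a nonempty subset M' ⊆ M such that |M' + jD| ≤ α^j · |M'|, i.e., |M' + jD| · |M|^j ≤ |M + D|^j · |M'|. -/
open Pointwise

/-- The `j`-fold iterated sumset `jD = D + ⋯ + D`, with `0D = {0}`. -/
def iterSumset {F : Type*} [AddCommGroup F] (D : Set F) : ℕ → Set F
  | 0 => {0}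
  | n + 1 => iterSumset D n + D

/-- Plünnecke–Ruzsa–Petridis inequality. -/
theorem stmt3 {F : Type*} [AddCommGroup F] (M D : Set F)
    (hMfin : M.Finite) (hDfin : D.Finite) (hMne : M.Nonempty) (hDne : D.Nonempty)
    (j : ℕ) :
    ∃ M' : Set F, M' ⊆ M ∧ M'.Nonempty ∧
      (M' + iterSumset D j).ncard * M.ncard ^ j ≤ (M + D).ncard ^ j * M'.ncard := by
  classical
  lift M to Finset F using hMfin
  lift D to Finset F using hDfin
  have hM : M.Nonempty := by simpa using hMne
  obtain ⟨C, hC, hCmin⟩ := Finset.exists_min_image (M.powerset.erase ∅)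
    (fun C ↦ ((C + D).card : ℚ) / C.card) ⟨M, by simp [hM.ne_empty]⟩
  simp only [Finset.mem_erase, Finset.mem_powerset] at hC hCmin
  obtain ⟨hC0, hCM⟩ := hC
  have hCn : C.Nonempty := Finset.nonempty_iff_ne_empty.2 hC0
  have key : ∀ A, A ⊆ M → (C + D).card * A.card ≤ (A + D).card * C.card := by
    intro A hA
    by_cases h : A = ∅
    · simp [h]
    have h1 := hCmin A ⟨h, hA⟩
    have hAp : (0 : ℚ) < A.card := by
      exact_mod_cast (Finset.nonempty_iff_ne_empty.2 h).card_pos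
    have hCp : (0 : ℚ) < C.card := by exact_mod_cast hCn.card_pos
    rw [div_le_div_iff₀ hCp hAp] at h1
    exact_mod_cast h1
  have hpet := fun E : Finset F ↦ Finset.pluennecke_petridis_inequality_add (A := C) (B := D) E
    (fun A hA ↦ key A (hA.trans hCM))
  have main : ∀ n, ∃ E : Finset F, (E : Set F) = iterSumset (D : Set F) n ∧
      (C + E).card * M.card ^ n ≤ (M + D).card ^ n * C.card := by
    intro n
    induction n with
    | zero => exact ⟨{0}, by simp [iterSumset], by simp⟩
    | succ n ih =>
      obtain ⟨E, hE, h⟩ := ih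
      refine ⟨E + D, by simp [iterSumset, hE], ?_⟩
      have h1 := hpet E
      rw [add_comm E C, add_assoc] at h1
      have h2 := key M subset_rfl
      refine Nat.le_of_mul_le_mul_right ?_ hCn.card_pos
      calc (C + (E + D)).card * M.card ^ (n + 1) * C.card
          = ((C + (E + D)).card * C.card) * M.card ^ (n + 1) := by ring
        _ ≤ ((C + D).card * (C + E).card) * M.card ^ (n + 1) := by gcongr
        _ = ((C + D).card * M.card) * ((C + E).card * M.card ^ n) := by ring
        _ ≤ ((M + D).card * C.card) * ((M + D).card ^ n * C.card) := by gcongr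
        _ = _ := by ring
  obtain ⟨E, hE, h⟩ := main j
  refine ⟨C, by exact_mod_cast hCM, by simpa using hCn, ?_⟩
  rw [← hE, ← Finset.coe_add, ← Finset.coe_add]
  simpa only [Set.ncard_coe_finset] using h
end

section
/- (Olson) Let F be an abelian group and let M, N ⊆ F be finite nonempty subsets with 0 ∈ N. Then either M + 2N = M + N, or |M + N| ≥ |M| + |N|/2. -/
open Pointwise

/-- `X` is a nonempty finite subset of the subgroup generated by `B`,
and `X + B` misses some element of that subgroup. -/
def OlsonP {F : Type*} [AddCommGroup F] [DecidableEq F] (B X : Finset F) : Prop :=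
  X.Nonempty ∧ (∀ x ∈ X, x ∈ AddSubgroup.closure (B : Set F)) ∧
    ∃ z ∈ AddSubgroup.closure (B : Set F), z ∉ X + B

/-- Translates of an atom are equal or disjoint. -/
theorem olson_atom {F : Type*} [AddCommGroup F] [DecidableEq F] (B X : Finset F) (κ : ℕ)
    (hX : OlsonP B X) (hcard : (X + B).card = X.card + κ)
    (h1 : ∀ Y, OlsonP B Y → Y.card + κ ≤ (Y + B).card)
    (h2 : ∀ Y, OlsonP B Y → (Y + B).card ≤ Y.card + κ → X.card ≤ Y.card)
    (x y g : F) (hx : x ∈ X) (hy : y ∈ X) (hg : g + x = y) : g +ᵥ X = X := by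
  by_contra hne
  obtain ⟨hXne, hXG, z, hzG, hz⟩ := hX
  have hBG : ∀ b ∈ B, b ∈ AddSubgroup.closure (B : Set F) := fun b hb =>
    AddSubgroup.subset_closure (by simpa using hb)
  have hgG : g ∈ AddSubgroup.closure (B : Set F) := by
    have : g = y - x := by rw [← hg]; abel
    rw [this]
    exact AddSubgroup.sub_mem _ (hXG y hy) (hXG x hx)
  have hYcard : (g +ᵥ X).card = X.card := Finset.card_vadd_finset g X
  have hYB : (g +ᵥ X) + B = g +ᵥ (X + B) := vadd_add_assoc g X B
  have hYBcard : ((g +ᵥ X) + B).card = X.card + κ := by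
    rw [hYB, Finset.card_vadd_finset, hcard]
  have hYG : ∀ w ∈ g +ᵥ X, w ∈ AddSubgroup.closure (B : Set F) := by
    intro w hw
    obtain ⟨v, hv, rfl⟩ := Finset.mem_vadd_finset.1 hw
    exact AddSubgroup.add_mem _ hgG (hXG v hv)
  have hyY : y ∈ g +ᵥ X := Finset.mem_vadd_finset.2 ⟨x, hx, hg⟩
  have hIlt : (X ∩ (g +ᵥ X)).card < X.card := by
    apply Finset.card_lt_card
    refine Finset.ssubset_iff_subset_ne.2 ⟨Finset.inter_subset_left, fun h => hne ?_⟩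
    have hsub : X ⊆ g +ᵥ X := Finset.inter_eq_left.1 h
    exact (Finset.eq_of_subset_of_card_le hsub hYcard.le).symm
  have hIP : OlsonP B (X ∩ (g +ᵥ X)) := by
    refine ⟨⟨y, Finset.mem_inter.2 ⟨hy, hyY⟩⟩, fun w hw => hXG w (Finset.mem_inter.1 hw).1,
      z, hzG, fun h => hz ?_⟩
    exact Finset.add_subset_add_right Finset.inter_subset_left h
  have hIB : (X ∩ (g +ᵥ X)).card + κ < (X ∩ (g +ᵥ X) + B).card := by
    by_contra hcon
    have := h2 _ hIP (not_lt.1 hcon)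
    omega
  have hIsub : (X ∩ (g +ᵥ X)) + B ⊆ (X + B) ∩ ((g +ᵥ X) + B) := Finset.inter_add_subset
  have hUeq : (X ∪ (g +ᵥ X)) + B = (X + B) ∪ ((g +ᵥ X) + B) := Finset.union_add
  have c1 := Finset.card_union_add_card_inter X (g +ᵥ X)
  have c2 := Finset.card_union_add_card_inter (X + B) ((g +ᵥ X) + B)
  have c3 := Finset.card_le_card hIsub
  rw [← hUeq] at c2
  have hUlt : ((X ∪ (g +ᵥ X)) + B).card < (X ∪ (g +ᵥ X)).card + κ := by omega
  have hUfull : ∀ w ∈ AddSubgroup.closure (B : Set F), w ∈ (X ∪ (g +ᵥ X)) + B := by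
    by_contra! hcon
    have hUP : OlsonP B (X ∪ (g +ᵥ X)) := by
      refine ⟨⟨x, Finset.mem_union_left _ hx⟩, fun w hw => ?_, hcon⟩
      rcases Finset.mem_union.1 hw with h | h
      · exact hXG w h
      · exact hYG w h
    have := h1 _ hUP
    omega
  set V := (X ∪ (g +ᵥ X)) + B with hV
  have hVG : ∀ w ∈ V, w ∈ AddSubgroup.closure (B : Set F) := by
    intro w hw
    obtain ⟨u, hu, b, hb, rfl⟩ := Finset.mem_add.1 hw
    refine AddSubgroup.add_mem _ ?_ (hBG b hb)
    rcases Finset.mem_union.1 hu with h | h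
    · exact hXG u h
    · exact hYG u h
  have hXV : X + B ⊆ V := Finset.add_subset_add_right Finset.subset_union_left
  have hZ : (V \ (X + B)).card + (X + B).card = V.card :=
    Finset.card_sdiff_add_card_eq_card hXV
  have hdisj : ∀ v ∈ X, -v ∉ -(V \ (X + B)) + B := by
    intro v hv hmem
    obtain ⟨w, hw, b, hb, hwb⟩ := Finset.mem_add.1 hmem
    have hw' := Finset.mem_neg'.1 hw
    apply (Finset.mem_sdiff.1 hw').2
    have : -w = v + b := by
      have : v = -(w + b) := by rw [hwb, neg_neg]
      rw [this]; abel
    rw [this]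
    exact Finset.add_mem_add hv hb
  have hWG : ∀ w ∈ -(V \ (X + B)), w ∈ AddSubgroup.closure (B : Set F) := by
    intro w hw
    have hw' := Finset.mem_neg'.1 hw
    have := hVG _ (Finset.mem_sdiff.1 hw').1
    simpa using this
  have hWP : OlsonP B (-(V \ (X + B))) := by
    refine ⟨⟨-z, Finset.neg_mem_neg (Finset.mem_sdiff.2 ⟨hUfull z hzG, hz⟩)⟩, hWG,
      -x, AddSubgroup.neg_mem _ (hXG x hx), hdisj x hx⟩
  have hWcard : (-(V \ (X + B))).card = (V \ (X + B)).card := Finset.card_neg _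
  have hdis : Disjoint (-(V \ (X + B)) + B) (-X) := by
    rw [Finset.disjoint_right]
    intro a ha
    have := hdisj _ (Finset.mem_neg'.1 ha)
    simpa using this
  have hsub : (-(V \ (X + B)) + B) ∪ (-X) ⊆ -V := by
    intro a ha
    rw [Finset.mem_neg']
    apply hUfull
    apply AddSubgroup.neg_mem
    rcases Finset.mem_union.1 ha with h | h
    · obtain ⟨w, hw, b, hb, rfl⟩ := Finset.mem_add.1 h
      exact AddSubgroup.add_mem _ (hWG w hw) (hBG b hb)
    · have := hXG _ (Finset.mem_neg'.1 h)
      simpa using this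
  have c4 := Finset.card_le_card hsub
  rw [Finset.card_union_of_disjoint hdis, Finset.card_neg, Finset.card_neg] at c4
  have c5 := h2 _ hWP (by omega)
  omega

theorem olson_core {F : Type*} [AddCommGroup F] [DecidableEq F] (B X₀ : Finset F)
    (h0 : (0 : F) ∈ B) (hX₀ : OlsonP B X₀) :
    2 * X₀.card + B.card ≤ 2 * (X₀ + B).card := by
  classical
  have hle : ∀ Y : Finset F, Y.card ≤ (Y + B).card := fun Y =>
    Finset.card_le_card (Finset.subset_add_left Y h0)
  have ex1 : ∃ k, ∃ X, OlsonP B X ∧ (X + B).card = X.card + k :=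
    ⟨(X₀ + B).card - X₀.card, X₀, hX₀, by have := hle X₀; omega⟩
  obtain ⟨κ, ⟨X₁, hX₁, hc₁⟩, hκ⟩ : ∃ κ, (∃ X, OlsonP B X ∧ (X + B).card = X.card + κ) ∧
      ∀ Y, OlsonP B Y → Y.card + κ ≤ (Y + B).card := by
    refine ⟨Nat.find ex1, Nat.find_spec ex1, fun Y hY => ?_⟩
    have := hle Y
    have := Nat.find_min' ex1 (m := (Y + B).card - Y.card) ⟨Y, hY, by omega⟩
    omega
  have ex2 : ∃ n, ∃ X, (OlsonP B X ∧ (X + B).card = X.card + κ) ∧ X.card = n :=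
    ⟨_, X₁, ⟨hX₁, hc₁⟩, rfl⟩
  obtain ⟨X, ⟨hX, hc⟩, hn⟩ := Nat.find_spec ex2
  have h2 : ∀ Y, OlsonP B Y → (Y + B).card ≤ Y.card + κ → X.card ≤ Y.card := by
    intro Y hY hYc
    rw [hn]
    exact Nat.find_min' ex2 ⟨Y, ⟨hY, le_antisymm hYc (hκ Y hY)⟩, rfl⟩
  have atom := olson_atom B X κ hX hc hκ h2
  obtain ⟨⟨x, hx⟩, hXG, z, hzG, hz⟩ := hX
  have hb : ∃ b ∈ B, b +ᵥ X ≠ X := by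
    by_contra! hcon
    have hst : AddSubgroup.closure (B : Set F) ≤ AddAction.stabilizer F X := by
      rw [AddSubgroup.closure_le]
      intro b hb
      exact AddAction.mem_stabilizer_iff.2 (hcon b (by simpa using hb))
    have h3 : (z - x) +ᵥ X = X :=
      AddAction.mem_stabilizer_iff.1 (hst (AddSubgroup.sub_mem _ hzG (hXG x hx)))
    apply hz
    apply Finset.subset_add_left X h0
    rw [← h3]
    exact Finset.mem_vadd_finset.2 ⟨x, hx, by simp⟩
  obtain ⟨b, hbB, hbne⟩ := hb
  have hdis : Disjoint X (b +ᵥ X) := by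
    rw [Finset.disjoint_right]
    intro a ha haX
    obtain ⟨v, hv, hva⟩ := Finset.mem_vadd_finset.1 ha
    exact hbne (atom v a b hv haX hva)
  have hsub : X ∪ (b +ᵥ X) ⊆ X + B := by
    apply Finset.union_subset (Finset.subset_add_left X h0)
    intro a ha
    obtain ⟨v, hv, rfl⟩ := Finset.mem_vadd_finset.1 ha
    rw [vadd_eq_add, add_comm b v]
    exact Finset.add_mem_add hv hbB
  have c1 := Finset.card_le_card hsub
  rw [Finset.card_union_of_disjoint hdis, Finset.card_vadd_finset] at c1
  have c2 : B.card ≤ (X + B).card := Finset.card_le_card_add_left ⟨x, hx⟩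
  have c3 := hκ X₀ hX₀
  omega

theorem olson_finset {F : Type*} [AddCommGroup F] [DecidableEq F] (M N : Finset F)
    (h0 : (0 : F) ∈ N) (h : M + (N + N) ≠ M + N) :
    2 * M.card + N.card ≤ 2 * (M + N).card := by
  classical
  have hsub : M + N ⊆ M + (N + N) :=
    Finset.add_subset_add_left (Finset.subset_add_left N h0)
  obtain ⟨t, ht, htn⟩ : ∃ t ∈ M + (N + N), t ∉ M + N := by
    by_contra! hcon
    exact h (Finset.Subset.antisymm hcon hsub)
  have hBG : ∀ b ∈ N, b ∈ AddSubgroup.closure (N : Set F) := fun b hb =>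
    AddSubgroup.subset_closure (by simpa using hb)
  set M₁ := M.filter (fun m => m - t ∈ AddSubgroup.closure (N : Set F)) with hM₁
  have hM₁M : M₁ ⊆ M := Finset.filter_subset _ _
  have hP : OlsonP N (-t +ᵥ M₁) := by
    refine ⟨?_, ?_, 0, AddSubgroup.zero_mem _, ?_⟩
    · obtain ⟨m, hm, s, hs, rfl⟩ := Finset.mem_add.1 ht
      obtain ⟨a, ha, b, hb, rfl⟩ := Finset.mem_add.1 hs
      have : m ∈ M₁ := by
        refine Finset.mem_filter.2 ⟨hm, ?_⟩
        have : m - (m + (a + b)) = -(a + b) := by abel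
        rw [this]
        exact AddSubgroup.neg_mem _ (AddSubgroup.add_mem _ (hBG a ha) (hBG b hb))
      exact Finset.Nonempty.vadd_finset ⟨m, this⟩
    · intro x hx
      obtain ⟨m, hm, rfl⟩ := Finset.mem_vadd_finset.1 hx
      have := (Finset.mem_filter.1 hm).2
      rwa [vadd_eq_add, neg_add_eq_sub]
    · intro hmem
      obtain ⟨x, hx, b, hb, hxb⟩ := Finset.mem_add.1 hmem
      obtain ⟨m, hm, rfl⟩ := Finset.mem_vadd_finset.1 hx
      apply htn
      have : t = m + b := by
        rw [vadd_eq_add] at hxb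
        have h4 : t + (-t + m + b) = t := by rw [hxb, add_zero]
        rw [← h4]; abel
      rw [this]
      exact Finset.add_mem_add (hM₁M hm) hb
  have hcore := olson_core N _ h0 hP
  rw [vadd_add_assoc, Finset.card_vadd_finset, Finset.card_vadd_finset] at hcore
  have hdis : Disjoint (M₁ + N) (M \ M₁) := by
    rw [Finset.disjoint_left]
    intro a ha ha'
    obtain ⟨m, hm, b, hb, rfl⟩ := Finset.mem_add.1 ha
    obtain ⟨h5, h6⟩ := Finset.mem_sdiff.1 ha'
    apply h6
    refine Finset.mem_filter.2 ⟨h5, ?_⟩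
    have : m + b - t = (m - t) + b := by abel
    rw [this]
    exact AddSubgroup.add_mem _ (Finset.mem_filter.1 hm).2 (hBG b hb)
  have hsub2 : (M₁ + N) ∪ (M \ M₁) ⊆ M + N :=
    Finset.union_subset (Finset.add_subset_add_right hM₁M)
      (Finset.sdiff_subset.trans (Finset.subset_add_left M h0))
  have c1 := Finset.card_le_card hsub2
  rw [Finset.card_union_of_disjoint hdis] at c1
  have c2 := Finset.card_sdiff_add_card_eq_card hM₁M
  omega

/-- Olson's theorem: for finite nonempty subsets `M, N` of an abelian group with `0 ∈ N`,
either `M + 2N = M + N` or `|M + N| ≥ |M| + |N|/2`. -/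
theorem stmt4 {F : Type*} [AddCommGroup F] (M N : Set F)
    (hMfin : M.Finite) (hNfin : N.Finite) (hMne : M.Nonempty) (hNne : N.Nonempty)
    (h0 : (0 : F) ∈ N) :
    M + (N + N) = M + N ∨
      ((M + N).ncard : ℝ) ≥ (M.ncard : ℝ) + (N.ncard : ℝ) / 2 := by
  classical
  lift M to Finset F using hMfin
  lift N to Finset F using hNfin
  by_cases h : M + (N + N) = M + N
  · left
    exact_mod_cast h
  · right
    have := olson_finset M N (by simpa using h0) h
    rw [← Finset.coe_add, Set.ncard_coe_finset, Set.ncard_coe_finset, Set.ncard_coe_finset]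
    have h' : (2 * M.card + N.card : ℝ) ≤ 2 * ((M + N).card : ℝ) := by exact_mod_cast this
    linarith
end

section
/- Let F be an abelian group and let M, N ⊆ F be finite nonempty subsets. Then either |M + 2N| = |M + N|, or |M + N| ≥ |M| + |N|/2. -/
open Pointwise

/-- Existence of an atom. -/
lemma exists_atom {F : Type*} [AddCommGroup F] [DecidableEq F] (S : Finset F → Prop) (N : Finset F)
    (h0 : (0 : F) ∈ N) (M : Finset F) (hM : S M) :
    ∃ A, S A ∧ ∀ X, S X → (A + N).card + X.card ≤ (X + N).card + A.card ∧
      ((X + N).card + A.card ≤ (A + N).card + X.card → A.card ≤ X.card) := by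
  classical
  have hle : ∀ X : Finset F, X.card ≤ (X + N).card := fun X =>
    Finset.card_le_card (fun x hx => Finset.mem_add.2 ⟨x, hx, 0, h0, add_zero x⟩)
  have e1 : ∃ k, ∃ X, S X ∧ (X + N).card = X.card + k :=
    ⟨(M + N).card - M.card, M, hM, by have := hle M; omega⟩
  have e2 : ∃ k, ∃ X, S X ∧ (X + N).card = X.card + Nat.find e1 ∧ X.card = k := by
    obtain ⟨X, hX, h⟩ := Nat.find_spec e1
    exact ⟨_, X, hX, h, rfl⟩
  obtain ⟨A, hA, hA1, hA2⟩ := Nat.find_spec e2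
  refine ⟨A, hA, fun X hX => ?_⟩
  have hX1 : Nat.find e1 ≤ (X + N).card - X.card :=
    Nat.find_min' e1 ⟨X, hX, by have := hle X; omega⟩
  have hX0 := hle X
  refine ⟨by omega, fun h => ?_⟩
  rw [hA2]
  exact Nat.find_min' e2 ⟨X, hX, by omega, rfl⟩

/-- Olson's inequality inside the subgroup generated by `N`. -/
lemma olson_core_s5 {F : Type*} [AddCommGroup F] [DecidableEq F] (N : Finset F) (h0 : (0 : F) ∈ N)
    (H : AddSubgroup F) (hH : H = AddSubgroup.closure (N : Set F))
    (M : Finset F) (hM : M.Nonempty) (hMH : ∀ x ∈ M, x ∈ H) (hz : ∃ z ∈ H, z ∉ M + N) :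
    2 * M.card + N.card ≤ 2 * (M + N).card := by
  classical
  have hNH : ∀ x ∈ N, x ∈ H := fun x hx => hH ▸ AddSubgroup.subset_closure hx
  let S : Finset F → Prop := fun X => X.Nonempty ∧ (∀ x ∈ X, x ∈ H) ∧ ∃ z ∈ H, z ∉ X + N
  -- translates
  have htr : ∀ (c : F) (X : Finset F), ((c +ᵥ X) + N).card = (X + N).card := fun c X => by
    rw [vadd_add_assoc, Finset.card_vadd_finset]
  have hStr : ∀ (c : F) (X : Finset F), c ∈ H → S X → S (c +ᵥ X) := by
    rintro c X hc ⟨h1, h2, z, hz, hz'⟩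
    refine ⟨h1.vadd_finset, ?_, c + z, H.add_mem hc hz, ?_⟩
    · intro x hx
      obtain ⟨y, hy, rfl⟩ := Finset.mem_vadd_finset.1 hx
      exact H.add_mem hc (h2 y hy)
    · rw [vadd_add_assoc]
      intro h
      obtain ⟨y, hy, hy'⟩ := Finset.mem_vadd_finset.1 h
      rw [vadd_eq_add] at hy'
      exact hz' (add_left_cancel hy' ▸ hy)
  obtain ⟨A, hA, hmin, h0A⟩ : ∃ A, S A ∧ (∀ X, S X → (A + N).card + X.card ≤ (X + N).card + A.card ∧
      ((X + N).card + A.card ≤ (A + N).card + X.card → A.card ≤ X.card)) ∧ (0 : F) ∈ A := by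
    obtain ⟨A, hA, hmin⟩ := exists_atom S N h0 M ⟨hM, hMH, hz⟩
    obtain ⟨a, ha⟩ := hA.1
    refine ⟨-a +ᵥ A, hStr _ _ (H.neg_mem (hA.2.1 a ha)) hA, ?_, ?_⟩
    · intro X hX
      rw [htr, Finset.card_vadd_finset]
      exact hmin X hX
    · exact Finset.mem_vadd_finset.2 ⟨a, ha, by simp⟩
  obtain ⟨hAne, hAH, zA, hzA, hzA'⟩ := id hA
  have hAA : ∀ a ∈ A, a +ᵥ A = A := by
    intro a ha
    set Y := a +ᵥ A with hY
    have hSY : S Y := hStr a A (hAH a ha) hA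
    have hYc : Y.card = A.card := Finset.card_vadd_finset _ _
    have hYN : (Y + N).card = (A + N).card := htr a A
    have haY : a ∈ Y := Finset.mem_vadd_finset.2 ⟨0, h0A, by simp⟩
    have hSI : S (A ∩ Y) := by
      refine ⟨⟨a, Finset.mem_inter.2 ⟨ha, haY⟩⟩, fun x hx => hAH x (Finset.mem_inter.1 hx).1,
        zA, hzA, fun h => hzA' (Finset.add_subset_add_right Finset.inter_subset_left h)⟩
    have hI := hmin _ hSI
    have c1 := Finset.card_union_add_card_inter A Y
    have c2 := Finset.card_union_add_card_inter (A + N) (Y + N)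
    have c3 : ((A ∩ Y) + N).card ≤ ((A + N) ∩ (Y + N)).card :=
      Finset.card_le_card Finset.inter_add_subset
    have c4 : (A ∪ Y) + N = (A + N) ∪ (Y + N) := Finset.union_add
    rw [← c4] at c2
    by_cases hU : ∃ z ∈ H, z ∉ (A ∪ Y) + N
    · have hSU : S (A ∪ Y) := by
        refine ⟨hAne.mono Finset.subset_union_left, ?_, hU⟩
        intro x hx
        rcases Finset.mem_union.1 hx with h | h
        · exact hAH x h
        · exact hSY.2.1 x h
      have hU' := (hmin _ hSU).1
      have := hI.2 (by omega)
      have e : A ∩ Y = A := Finset.eq_of_subset_of_card_le Finset.inter_subset_left this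
      exact (Finset.eq_of_subset_of_card_le (Finset.inter_eq_left.1 e) hYc.le).symm
    · exfalso
      push Not at hU
      set G := (A ∪ Y) + N with hG
      have hGH : ∀ x ∈ G, x ∈ H := by
        intro x hx
        obtain ⟨y, hy, n, hn, rfl⟩ := Finset.mem_add.1 hx
        refine H.add_mem ?_ (hNH n hn)
        rcases Finset.mem_union.1 hy with h | h
        · exact hAH y h
        · exact hSY.2.1 y h
      have hsub : A + N ⊆ G := Finset.add_subset_add_right Finset.subset_union_left
      have hsubA : A ⊆ G := fun x hx => hU x (hAH x hx)
      let Z := -(G \ (A + N))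
      have hZc : Z.card = G.card - (A + N).card := by
        rw [Finset.card_neg, Finset.card_sdiff_of_subset hsub]
      have hAG : (A + N).card ≤ G.card := Finset.card_le_card hsub
      have hAG' : A.card ≤ G.card := Finset.card_le_card hsubA
      have hdis : ∀ x ∈ Z + N, -x ∈ G \ A := by
        intro x hx
        obtain ⟨y, hy, n, hn, rfl⟩ := Finset.mem_add.1 hx
        have hy := Finset.mem_sdiff.1 (Finset.mem_neg'.1 hy)
        rw [Finset.mem_sdiff]
        constructor
        · apply hU
          rw [neg_add]
          exact H.add_mem (hGH _ hy.1) (H.neg_mem (hNH n hn))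
        · intro h
          exact hy.2 (Finset.mem_add.2 ⟨_, h, n, hn, by abel⟩)
      have hZN : (Z + N).card ≤ G.card - A.card := by
        rw [← Finset.card_sdiff_of_subset hsubA, ← Finset.card_neg (Z + N)]
        apply Finset.card_le_card
        intro x hx
        have := hdis _ (Finset.mem_neg'.1 hx)
        simpa using this
      have hSZ : S Z := by
        refine ⟨?_, ?_, 0, H.zero_mem, ?_⟩
        · refine ⟨-zA, Finset.mem_neg'.2 ?_⟩
          rw [neg_neg]
          exact Finset.mem_sdiff.2 ⟨hU _ hzA, hzA'⟩
        · intro x hx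
          have := hGH _ (Finset.mem_sdiff.1 (Finset.mem_neg'.1 hx)).1
          simpa using this
        · intro h
          have := (Finset.mem_sdiff.1 (hdis _ h)).2
          rw [neg_zero] at this
          exact this h0A
      have hZ := hmin Z hSZ
      have hZ2 := hZ.2 (by omega)
      have hpos : 0 < (A ∩ Y).card := Finset.card_pos.2 hSI.1
      have := hI.1
      omega
  have hadd : ∀ a ∈ A, ∀ b ∈ A, a + b ∈ A := fun a ha b hb => by
    rw [← hAA a ha]; exact Finset.mem_vadd_finset.2 ⟨b, hb, rfl⟩
  have hneg : ∀ a ∈ A, -a ∈ A := fun a ha => by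
    have h := h0A
    rw [← hAA a ha] at h
    obtain ⟨b, hb, hb'⟩ := Finset.mem_vadd_finset.1 h
    rw [vadd_eq_add] at hb'
    rwa [neg_eq_of_add_eq_zero_right hb']
  let K : AddSubgroup F :=
    { carrier := A, add_mem' := fun {a b} ha hb => hadd a ha b hb, zero_mem' := h0A,
      neg_mem' := fun {a} ha => hneg a ha }
  obtain ⟨n, hn, hnA⟩ : ∃ n ∈ N, n ∉ A := by
    by_contra! hcon
    have : H ≤ K := by
      rw [hH, AddSubgroup.closure_le]
      exact fun x hx => hcon x hx
    exact hzA' (Finset.mem_add.2 ⟨zA, this hzA, 0, h0, add_zero _⟩)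
  have d1 : Disjoint A (n +ᵥ A) := by
    rw [Finset.disjoint_left]
    intro x hx hx'
    obtain ⟨b, hb, rfl⟩ := Finset.mem_vadd_finset.1 hx'
    apply hnA
    have := hadd _ hx _ (hneg b hb)
    simpa using this
  have d2 : A ∪ (n +ᵥ A) ⊆ A + N := by
    intro x hx
    rcases Finset.mem_union.1 hx with h | h
    · exact Finset.mem_add.2 ⟨x, h, 0, h0, add_zero _⟩
    · obtain ⟨b, hb, rfl⟩ := Finset.mem_vadd_finset.1 h
      exact Finset.mem_add.2 ⟨b, hb, n, hn, add_comm _ _⟩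
  have d3 := Finset.card_le_card d2
  rw [Finset.card_union_of_disjoint d1, Finset.card_vadd_finset] at d3
  have d4 : N.card ≤ (A + N).card :=
    Finset.card_le_card (fun x hx => Finset.mem_add.2 ⟨0, h0A, x, hx, zero_add _⟩)
  have d5 := (hmin M ⟨hM, hMH, hz⟩).1
  omega

/-- Olson's inequality when `0` lies in both sets. -/
lemma olson_zero {F : Type*} [AddCommGroup F] [DecidableEq F] (M N : Finset F) (h0 : (0 : F) ∈ N)
    (h0M : (0 : F) ∈ M) (n n' : F) (hn : n ∈ N) (hn' : n' ∈ N) (h : n + n' ∉ M + N) :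
    2 * M.card + N.card ≤ 2 * (M + N).card := by
  classical
  set H := AddSubgroup.closure (N : Set F) with hH
  have hNH : ∀ x ∈ N, x ∈ H := fun x hx => hH ▸ AddSubgroup.subset_closure hx
  have key := olson_core_s5 N h0 H hH (M.filter (· ∈ H)) ⟨0, Finset.mem_filter.2 ⟨h0M, H.zero_mem⟩⟩
    (fun x hx => (Finset.mem_filter.1 hx).2)
    ⟨n + n', H.add_mem (hNH n hn) (hNH n' hn'),
      fun h' => h (Finset.add_subset_add_right (Finset.filter_subset _ _) h')⟩
  have c := Finset.card_filter_add_card_filter_not (s := M) (· ∈ H)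
  have d : Disjoint (M.filter (· ∈ H) + N) (M.filter (¬ · ∈ H)) := by
    rw [Finset.disjoint_left]
    intro x hx hx'
    obtain ⟨y, hy, n, hn, rfl⟩ := Finset.mem_add.1 hx
    exact (Finset.mem_filter.1 hx').2 (H.add_mem (Finset.mem_filter.1 hy).2 (hNH n hn))
  have s : (M.filter (· ∈ H) + N) ∪ (M.filter (¬ · ∈ H)) ⊆ M + N := by
    apply Finset.union_subset
    · exact Finset.add_subset_add_right (Finset.filter_subset _ _)
    · intro x hx
      exact Finset.mem_add.2 ⟨x, (Finset.mem_filter.1 hx).1, 0, h0, add_zero _⟩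
  have s' := Finset.card_le_card s
  rw [Finset.card_union_of_disjoint d] at s'
  omega

/-- A Cauchy–Davenport type consequence of Olson's theorem: for finite nonempty subsets
`M, N` of an abelian group, either `|M + 2N| = |M + N|` or `|M + N| ≥ |M| + |N|/2`. -/
theorem stmt5 {F : Type*} [AddCommGroup F] (M N : Set F)
    (hMfin : M.Finite) (hNfin : N.Finite) (hMne : M.Nonempty) (hNne : N.Nonempty) :
    (M + (N + N)).ncard = (M + N).ncard ∨
      ((M + N).ncard : ℝ) ≥ (M.ncard : ℝ) + (N.ncard : ℝ) / 2 := by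
  classical
  lift M to Finset F using hMfin
  lift N to Finset F using hNfin
  simp only [← Finset.coe_add, Set.ncard_coe_finset]
  obtain ⟨c, hc⟩ := hNne
  have hc : c ∈ N := hc
  by_cases hall : ∀ m ∈ M, ∀ n ∈ N, ∀ n' ∈ N, m + (n + n') ∈ c +ᵥ (M + N)
  · left
    rw [← Finset.card_vadd_finset c (M + N)]
    congr 1
    apply Finset.Subset.antisymm
    · intro x hx
      obtain ⟨m, hm, y, hy, rfl⟩ := Finset.mem_add.1 hx
      obtain ⟨n, hn, n', hn', rfl⟩ := Finset.mem_add.1 hy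
      exact hall m hm n hn n' hn'
    · intro x hx
      obtain ⟨y, hy, rfl⟩ := Finset.mem_vadd_finset.1 hx
      obtain ⟨m, hm, n, hn, rfl⟩ := Finset.mem_add.1 hy
      refine Finset.mem_add.2 ⟨m, hm, c + n, Finset.add_mem_add hc hn, ?_⟩
      rw [vadd_eq_add]; abel
  · right
    push Not at hall
    obtain ⟨m, hm, n, hn, n', hn', h⟩ := hall
    have key := olson_zero (-m +ᵥ M) (-c +ᵥ N)
      (Finset.mem_vadd_finset.2 ⟨c, hc, by simp⟩) (Finset.mem_vadd_finset.2 ⟨m, hm, by simp⟩)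
      (-c + n) (-c + n') (Finset.mem_vadd_finset.2 ⟨n, hn, rfl⟩)
      (Finset.mem_vadd_finset.2 ⟨n', hn', rfl⟩) (by
        intro h'
        apply h
        obtain ⟨x, hx, y, hy, hxy⟩ := Finset.mem_add.1 h'
        obtain ⟨x, hx1, rfl⟩ := Finset.mem_vadd_finset.1 hx
        obtain ⟨y, hy1, rfl⟩ := Finset.mem_vadd_finset.1 hy
        refine Finset.mem_vadd_finset.2 ⟨x + y, Finset.add_mem_add hx1 hy1, ?_⟩
        simp only [vadd_eq_add] at hxy ⊢
        have e : c + (x + y) = (-m + x + (-c + y)) + (c + c + m) := by abel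
        rw [e, hxy]; abel)
    rw [vadd_add_assoc, add_vadd_comm, Finset.card_vadd_finset, Finset.card_vadd_finset,
      Finset.card_vadd_finset, Finset.card_vadd_finset] at key
    have : (2 * M.card + N.card : ℝ) ≤ 2 * (M + N).card := by exact_mod_cast key
    linarith
end

section
/- (General Plünnecke–Ruzsa inequality) Let F be an abelian group, let M, D, N ⊆ F be finite subsets with |M| = m ≥ 1, let 1 ≤ j < h be positive integers, set γ = h/j (a real number), let s = |(M + jD) \ (N + (j−1)D)|, and let ℓ be a positive integer with ℓ < m. Then there exists a subset M' ⊆ M with |M'| > ℓ such that |(M' + hD) \ (N + (h−1)D)| ≤ (s^γ / γ) · ( 1/(m−ℓ)^{γ−1} − 1/m^{γ−1} ) + (s/(m−ℓ))^γ · (|M'| − ℓ), where all powers are real powers. -/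
open Pointwise Real

namespace PlR

open Classical in
lemma levels {P Q : Type*} (U : Finset P) (S : Finset Q) (R : P → Q → Prop)
    (f : P → ℕ) (g : Q → ℕ) (hfg : ∀ u ∈ U, ∀ v ∈ S, R u v → g v ≤ f u) (c : ℝ)
    (hc : ∀ T ⊆ S, c * (T.card : ℝ) ≤ ((U.filter fun u => ∃ v ∈ T, R u v).card : ℝ)) :
    c * ∑ v ∈ S, (g v : ℝ) + ((U.filter fun u => 1 ≤ f u).card : ℝ)
      ≤ ∑ u ∈ U, (f u : ℝ) + c * ((S.filter fun v => 1 ≤ g v).card : ℝ) := by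
  obtain ⟨K, hKf, hKg⟩ : ∃ K, (∀ u ∈ U, f u ≤ K + 1) ∧ (∀ v ∈ S, g v ≤ K + 1) := by
    refine ⟨U.sup f + S.sup g, fun u hu => ?_, fun v hv => ?_⟩
    · have := Finset.le_sup (f := f) hu; omega
    · have := Finset.le_sup (f := g) hv; omega
  have key : ∀ {X : Type _} (A : Finset X) (φ : X → ℕ), (∀ x ∈ A, φ x ≤ K + 1) →
      ∑ x ∈ A, (φ x : ℝ) = ∑ k ∈ Finset.range (K+1), ((A.filter fun x => k + 1 ≤ φ x).card : ℝ) := by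
    intro X A φ hφ
    have : ∀ x ∈ A, (φ x : ℝ) = ∑ k ∈ Finset.range (K+1), if k + 1 ≤ φ x then (1:ℝ) else 0 := by
      intro x hx
      rw [← Finset.sum_filter]
      have : (Finset.range (K+1)).filter (fun k => k + 1 ≤ φ x) = Finset.range (φ x) := by
        ext k; have := hφ x hx; simp; omega
      rw [this]; simp
    rw [Finset.sum_congr rfl this, Finset.sum_comm]
    refine Finset.sum_congr rfl fun k _ => ?_
    rw [← Finset.sum_filter]; simp
  have key2 : ∀ {X : Type _} (A : Finset X) (φ : X → ℕ), (∀ x ∈ A, φ x ≤ K + 1) →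
      ∑ x ∈ A, (φ x : ℝ) = ∑ k ∈ Finset.range (K+1), ((A.filter fun x => k + 1 ≤ φ x).card : ℝ) := by
    intro X A φ hφ
    have : ∀ x ∈ A, (φ x : ℝ) = ∑ k ∈ Finset.range (K+1), if k + 1 ≤ φ x then (1:ℝ) else 0 := by
      intro x hx
      rw [← Finset.sum_filter]
      have : (Finset.range (K+1)).filter (fun k => k + 1 ≤ φ x) = Finset.range (φ x) := by
        ext k; have := hφ x hx; simp; omega
      rw [this]; simp
    rw [Finset.sum_congr rfl this, Finset.sum_comm]
    refine Finset.sum_congr rfl fun k _ => ?_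
    rw [← Finset.sum_filter]; simp
  rw [key U f hKf, key2 S g hKg, Finset.sum_range_succ', Finset.sum_range_succ', mul_add, Finset.mul_sum]
  have : ∀ k ∈ Finset.range K, c * ((S.filter fun v => k + 1 + 1 ≤ g v).card : ℝ)
      ≤ ((U.filter fun u => k + 1 + 1 ≤ f u).card : ℝ) := by
    intro k _
    refine (hc _ (Finset.filter_subset _ _)).trans ?_
    norm_cast
    refine Finset.card_le_card fun u hu => ?_
    simp only [Finset.mem_filter] at hu ⊢
    obtain ⟨hu, v, ⟨hv, hk⟩, hR⟩ := hu
    exact ⟨hu, hk.trans (hfg u hu v hv hR)⟩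
  have := Finset.sum_le_sum this
  simp only [zero_add] at *
  linarith

variable {F : Type*} [AddCommGroup F]

open Classical in
/-- out-neighbourhood of `B` (inside level `i`) in level `i+1`. -/
noncomputable def nb (D : Set F) (V : ℕ → Finset F) (i : ℕ) (B : Finset F) : Finset F :=
  (V (i+1)).filter fun x => ∃ u ∈ B, u ∈ V i ∧ x - u ∈ D

noncomputable def AA (D : Set F) (V : ℕ → Finset F) (B : ℕ → Finset F) : ℕ → Finset F
  | 0 => V 0
  | i+1 => nb D V i (B i)

noncomputable def RR (D : Set F) (V : ℕ → Finset F) (Y : Finset F) : ℕ → Finset F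
  | 0 => Y
  | i+1 => nb D V i (RR D V Y i)

open Classical in
noncomputable def term (D : Set F) (V : ℕ → Finset F) (q : ℝ) (B : ℕ → Finset F) (i : ℕ) : ℝ :=
  q ^ i * ((AA D V B i \ B i).card : ℝ)

noncomputable def wt (D : Set F) (V : ℕ → Finset F) (q : ℝ) (h : ℕ) (B : ℕ → Finset F) : ℝ :=
  ∑ i ∈ Finset.range (h+1), term D V q B i

def IsMinCut (D : Set F) (V : ℕ → Finset F) (q : ℝ) (h : ℕ) (B : ℕ → Finset F) : Prop :=
  B h = ∅ ∧ ∀ B', B' h = ∅ → wt D V q h B ≤ wt D V q h B'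

lemma nb_sub (D : Set F) (V : ℕ → Finset F) (i : ℕ) (B : Finset F) : nb D V i B ⊆ V (i+1) := by
  intro x hx
  simp only [nb, Finset.mem_filter] at hx
  exact hx.1

lemma nb_mono (D : Set F) (V : ℕ → Finset F) (i : ℕ) {B B' : Finset F} (h : B ⊆ B') :
    nb D V i B ⊆ nb D V i B' := by
  intro x hx
  simp only [nb, Finset.mem_filter] at *
  obtain ⟨hx, u, hu, r⟩ := hx
  exact ⟨hx, u, h hu, r⟩

lemma AA_sub (D : Set F) (V B : ℕ → Finset F) (i : ℕ) : AA D V B i ⊆ V i := by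
  cases i with
  | zero => exact subset_rfl
  | succ i => exact nb_sub ..

lemma exists_min (D : Set F) (V : ℕ → Finset F) (q : ℝ) (h : ℕ) :
    ∃ B, IsMinCut D V q h B := by
  classical
  have hfin : (wt D V q h '' {B | B h = ∅}).Finite := by
    refine ((Finset.finite_toSet ((Finset.range (h+1)).pi fun i => Finset.range ((V i).card + 1))).image
      (fun n => ∑ i ∈ (Finset.range (h+1)).attach, q ^ (i:ℕ) * ((n i.1 i.2 : ℕ) : ℝ))).subset ?_
    rintro _ ⟨B, hB, rfl⟩
    refine ⟨fun i _ => (AA D V B i \ B i).card, ?_, ?_⟩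
    · simp only [Finset.mem_coe, Finset.mem_pi]
      intro i hi
      have := Finset.card_le_card (Finset.sdiff_subset.trans (AA_sub D V B i) : AA D V B i \ B i ⊆ V i)
      simp; omega
    · simp only [wt, term]
      exact Finset.sum_attach (Finset.range (h+1)) (fun i => q ^ i * ((AA D V B i \ B i).card : ℝ))
  obtain ⟨x, ⟨B, hB, rfl⟩, hx⟩ := hfin.exists_minimal ⟨_, ⟨fun _ => ∅, rfl, rfl⟩⟩
  refine ⟨B, hB, fun B' hB' => ?_⟩
  rcases le_total (wt D V q h B) (wt D V q h B') with h1 | h1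
  · exact h1
  · exact hx ⟨B', hB', rfl⟩ h1

open Classical in
lemma wt_update (D : Set F) (V : ℕ → Finset F) (q : ℝ) (h : ℕ) (B : ℕ → Finset F) (k : ℕ)
    (hk : k < h) (X : Finset F) :
    wt D V q h (Function.update B k X) - wt D V q h B =
      q ^ k * ((AA D V B k \ X).card : ℝ) - q ^ k * ((AA D V B k \ B k).card : ℝ)
      + (q ^ (k+1) * ((nb D V k X \ B (k+1)).card : ℝ)
          - q ^ (k+1) * ((nb D V k (B k) \ B (k+1)).card : ℝ)) := by
  unfold wt
  rw [← Finset.sum_sub_distrib]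
  have hsub : ({k, k+1} : Finset ℕ) ⊆ Finset.range (h+1) := by
    intro i hi; simp at hi ⊢; omega
  rw [← Finset.sum_subset hsub, Finset.sum_pair (by omega)]
  · have e : AA D V (Function.update B k X) k = AA D V B k := by
      cases k with
      | zero => rfl
      | succ k => simp [AA]
    simp [term, e]
    simp [AA]
  · intro i _ hi
    simp only [Finset.mem_insert, Finset.mem_singleton, not_or] at hi
    have e : AA D V (Function.update B k X) i = AA D V B i := by
      cases i with
      | zero => rfl
      | succ i =>
        have : i ≠ k := by omega
        simp [AA, this]
    simp [term, e, hi.1]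

open Classical in
lemma push (D : Set F) (V : ℕ → Finset F)
    (comm : ∀ i u d d', u ∈ V i → d ∈ D → d' ∈ D → u + d ∈ V (i+1) → u + d + d' ∈ V (i+2) →
      u + d' ∈ V (i+1))
    (q : ℝ) (hq : 0 < q) (h : ℕ) (B : ℕ → Finset F) (hB : IsMinCut D V q h B) (i : ℕ)
    (hi : i + 1 < h) :
    IsMinCut D V q h (Function.update B (i+1) (B (i+1) ∪ AA D V B (i+1))) := by
  obtain ⟨hBh, hmin⟩ := hB
  set S := AA D V B (i+1) \ B (i+1) with hS
  set U := (V i).filter (fun u => u ∈ B i) with hU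
  set W := V (i+2) \ (nb D V (i+1) (B (i+1)) ∪ B (i+2)) with hW
  -- membership facts
  have hSV : ∀ v ∈ S, v ∈ V (i+1) := fun v hv => AA_sub D V B _ (Finset.mem_sdiff.1 hv).1
  have hmemS : ∀ u ∈ U, ∀ v w, v - u ∈ D → v ∈ V (i+1) → w ∈ W → w - v ∈ D → v ∈ S := by
    intro u hu v w huv hv hw hvw
    simp only [hU, Finset.mem_filter] at hu
    simp only [hW, Finset.mem_sdiff, Finset.mem_union, not_or] at hw
    rw [hS, Finset.mem_sdiff]
    refine ⟨?_, fun hvB => hw.2.1 ?_⟩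
    · simp only [AA, nb, Finset.mem_filter]
      exact ⟨hv, u, hu.2, hu.1, huv⟩
    · simp only [nb, Finset.mem_filter]
      exact ⟨hw.1, v, hvB, hv, hvw⟩
  -- the swapping
  have swap : ∀ u ∈ U, ∀ v ∈ S, ∀ w ∈ W, v - u ∈ D → w - v ∈ D → u + (w - v) ∈ S := by
    intro u hu v hv w hw huv hvw
    have huV := (Finset.mem_filter.1 hu).1
    have hwV := (Finset.mem_sdiff.1 hw).1
    refine hmemS u hu _ w (by simpa using hvw) ?_ hw ?_
    · exact comm i u (v - u) (w - v) huV huv hvw (by simpa using hSV v hv)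
        (by simpa using hwV)
    · have : w - (u + (w - v)) = v - u := by abel
      rwa [this]
  -- up
  have up : ∀ T ⊆ S, q⁻¹ * (T.card : ℝ) ≤ ((W.filter fun w => ∃ v ∈ T, w - v ∈ D).card : ℝ) := by
    intro T hT
    have h1 := hmin (Function.update B (i+1) (B (i+1) ∪ T)) (by
      rw [Function.update_of_ne (by omega)]; exact hBh)
    have h2 := wt_update D V q h B (i+1) hi (B (i+1) ∪ T)
    have e1 : ((AA D V B (i+1) \ (B (i+1) ∪ T)).card : ℝ) = (S.card : ℝ) - T.card := by
      have : AA D V B (i+1) \ (B (i+1) ∪ T) = S \ T := by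
        ext x; simp [hS, and_assoc]
      rw [this, Finset.card_sdiff_of_subset hT, Nat.cast_sub (Finset.card_le_card hT)]
    have e2 : ((nb D V (i+1) (B (i+1) ∪ T) \ B (i+1+1)).card : ℝ) ≤
        ((nb D V (i+1) (B (i+1)) \ B (i+1+1)).card : ℝ) +
          ((W.filter fun w => ∃ v ∈ T, w - v ∈ D).card : ℝ) := by
      norm_cast
      refine (Finset.card_le_card ?_).trans (Finset.card_union_le _ _)
      intro x hx
      simp only [nb, hW, Finset.mem_sdiff, Finset.mem_filter, Finset.mem_union] at hx ⊢
      obtain ⟨⟨hxV, u, hu, huV, hd⟩, hxB⟩ := hx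
      by_cases hc : ∃ u, u ∈ B (i+1) ∧ u ∈ V (i+1) ∧ x - u ∈ D
      · exact Or.inl ⟨⟨hxV, hc⟩, hxB⟩
      · refine Or.inr ⟨⟨hxV, ?_⟩, u, ?_, hd⟩
        · rintro (h3 | h3)
          · exact hc h3.2
          · exact hxB h3
        · exact hu.resolve_left fun h3 => hc ⟨u, h3, huV, hd⟩
    rw [e1] at h2
    have e3 := mul_le_mul_of_nonneg_left e2 (pow_pos hq (i+1+1)).le
    have e4 : q ^ (i+1) * (T.card : ℝ) ≤
        q ^ (i+1) * (q * ((W.filter fun w => ∃ v ∈ T, w - v ∈ D).card : ℝ)) := by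
      rw [← hS] at h2
      rw [← mul_assoc, ← pow_succ]
      linarith
    have e5 := le_of_mul_le_mul_left e4 (pow_pos hq (i+1))
    rw [inv_mul_le_iff₀ hq]; exact e5
  -- down
  have down : ∀ T ⊆ S, q * (T.card : ℝ) ≤ ((U.filter fun u => ∃ v ∈ T, v - u ∈ D).card : ℝ) := by
    intro T hT
    set P := U.filter fun u => ∃ v ∈ T, v - u ∈ D with hP
    have h1 := hmin (Function.update B i (B i \ P)) (by
      rw [Function.update_of_ne (by omega)]; exact hBh)
    have h2 := wt_update D V q h B i (by omega) (B i \ P)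
    have e1 : ((AA D V B i \ (B i \ P)).card : ℝ) ≤ ((AA D V B i \ B i).card : ℝ) + P.card := by
      norm_cast
      refine (Finset.card_le_card ?_).trans (Finset.card_union_le _ _)
      intro x hx
      simp only [Finset.mem_sdiff, Finset.mem_union] at hx ⊢
      tauto
    have e2 : ((nb D V i (B i \ P) \ B (i+1)).card : ℝ) ≤ (S.card : ℝ) - T.card := by
      rw [← Nat.cast_sub (Finset.card_le_card hT), ← Finset.card_sdiff_of_subset hT]
      norm_cast
      refine Finset.card_le_card ?_
      intro x hx
      simp only [nb, Finset.mem_sdiff, Finset.mem_filter, hS, AA] at hx ⊢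
      obtain ⟨⟨hxV, u, ⟨hu, huP⟩, huV, hd⟩, hxB⟩ := hx
      refine ⟨⟨⟨hxV, u, hu, huV, hd⟩, hxB⟩, fun hxT => huP ?_⟩
      simp only [hP, hU, Finset.mem_filter]
      exact ⟨⟨huV, hu⟩, x, hxT, hd⟩
    have e3 : ((nb D V i (B i) \ B (i+1)).card : ℝ) = S.card := rfl
    rw [e3] at h2
    have e4 := mul_le_mul_of_nonneg_left e1 (pow_pos hq i).le
    have e5 := mul_le_mul_of_nonneg_left e2 (pow_pos hq (i+1)).le
    have e6 : q ^ i * (q * (T.card : ℝ)) ≤ q ^ i * (P.card : ℝ) := by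
      rw [← mul_assoc, ← pow_succ]
      linarith
    exact le_of_mul_le_mul_left e6 (pow_pos hq i)
  -- degrees
  let dpu : F → ℕ := fun u => (S.filter fun v => v - u ∈ D).card
  let dpv : F → ℕ := fun v => (W.filter fun w => w - v ∈ D).card
  let dmv : F → ℕ := fun v => (U.filter fun u => v - u ∈ D).card
  let dmw : F → ℕ := fun w => (S.filter fun v => w - v ∈ D).card
  have L1 := levels U S (fun u v => v - u ∈ D) dpu dpv (by
    intro u hu v hv huv
    refine Finset.card_le_card_of_injOn (fun w => u + (w - v)) ?_ ?_
    · intro w hw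
      simp only [Finset.coe_filter, Set.mem_ofPred_eq] at hw ⊢
      exact ⟨swap u hu v hv w hw.1 huv hw.2, by simpa using hw.2⟩
    · intro a _ b _ hab
      simpa using hab) q down
  have L2 := levels W S (fun w v => w - v ∈ D) dmw dmv (by
    intro w hw v hv hvw
    refine Finset.card_le_card_of_injOn (fun u => u + (w - v)) ?_ ?_
    · intro u hu
      simp only [Finset.coe_filter, Set.mem_ofPred_eq] at hu ⊢
      refine ⟨swap u hu.1 v hv w hw hu.2 hvw, ?_⟩
      have : w - (u + (w - v)) = v - u := by abel
      rw [this]; exact hu.2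
    · intro a _ b _ hab
      simpa using hab) q⁻¹ up
  have dc1 : ∑ u ∈ U, (dpu u : ℝ) = ∑ v ∈ S, (dmv v : ℝ) := by
    norm_cast
    exact Finset.sum_card_bipartiteAbove_eq_sum_card_bipartiteBelow (fun u v => v - u ∈ D)
  have dc2 : ∑ w ∈ W, (dmw w : ℝ) = ∑ v ∈ S, (dpv v : ℝ) := by
    norm_cast
    exact Finset.sum_card_bipartiteAbove_eq_sum_card_bipartiteBelow (fun w v => w - v ∈ D)
  -- weak form of the first inequality
  have L1' : q * ∑ v ∈ S, (dpv v : ℝ) ≤ ∑ u ∈ U, (dpu u : ℝ) := by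
    have a1 : q * ((S.filter fun v => 1 ≤ dpv v).card : ℝ) ≤
        ((U.filter fun u => 1 ≤ dpu u).card : ℝ) := by
      refine (down _ (Finset.filter_subset _ _)).trans ?_
      norm_cast
      refine Finset.card_le_card fun u hu => ?_
      simp only [Finset.mem_filter] at hu ⊢
      obtain ⟨hu, v, ⟨hv, _⟩, hR⟩ := hu
      exact ⟨hu, Finset.card_pos.2 ⟨v, Finset.mem_filter.2 ⟨hv, hR⟩⟩⟩
    linarith
  have hfull : ((S.filter fun v => 1 ≤ dmv v).card : ℝ) ≤ S.card := by
    norm_cast; exact Finset.card_le_card (Finset.filter_subset _ _)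
  have hqi : 0 < q⁻¹ := inv_pos.2 hq
  have main : ((W.filter fun w => 1 ≤ dmw w).card : ℝ) ≤ q⁻¹ * S.card := by
    rw [dc2, ← dc1] at L2
    have b1 : ∑ v ∈ S, (dpv v : ℝ) ≤ q⁻¹ * ∑ u ∈ U, (dpu u : ℝ) := by
      rw [← div_eq_inv_mul, le_div_iff₀ hq]; linarith
    have b2 := mul_le_mul_of_nonneg_left hfull hqi.le
    linarith
  refine ⟨by rw [Function.update_of_ne (by omega)]; exact hBh, fun B' hB' => ?_⟩
  refine le_trans ?_ (hmin B' hB')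
  have h2 := wt_update D V q h B (i+1) hi (B (i+1) ∪ AA D V B (i+1))
  have e1 : AA D V B (i+1) \ (B (i+1) ∪ AA D V B (i+1)) = ∅ := by
    ext x; simp; tauto
  have e2 : ((nb D V (i+1) (B (i+1) ∪ AA D V B (i+1)) \ B (i+1+1)).card : ℝ) ≤
      ((nb D V (i+1) (B (i+1)) \ B (i+1+1)).card : ℝ) +
        ((W.filter fun w => 1 ≤ dmw w).card : ℝ) := by
    norm_cast
    refine (Finset.card_le_card ?_).trans (Finset.card_union_le _ _)
    intro x hx
    rw [Finset.mem_sdiff, nb, Finset.mem_filter] at hx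
    obtain ⟨⟨hxV, u, hu, huV, hd⟩, hxB⟩ := hx
    by_cases hc : x ∈ nb D V (i+1) (B (i+1))
    · exact Finset.mem_union_left _ (Finset.mem_sdiff.2 ⟨hc, hxB⟩)
    · refine Finset.mem_union_right _ (Finset.mem_filter.2 ⟨?_, ?_⟩)
      · rw [hW, Finset.mem_sdiff, Finset.mem_union]
        exact ⟨hxV, fun h3 => h3.elim hc hxB⟩
      · refine Finset.card_pos.2 ⟨u, Finset.mem_filter.2 ⟨?_, hd⟩⟩
        have huB : u ∉ B (i+1) := fun h3 => hc (by
          rw [nb, Finset.mem_filter]; exact ⟨hxV, u, h3, huV, hd⟩)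
        rw [hS, Finset.mem_sdiff]
        exact ⟨(Finset.mem_union.1 hu).resolve_left huB, huB⟩
  rw [e1, ← hS] at h2
  have e3 := mul_le_mul_of_nonneg_left (e2.trans (add_le_add_right main _)) (pow_pos hq (i+1+1)).le
  have e4 : q ^ (i+1+1) * (q⁻¹ * (S.card : ℝ)) = q ^ (i+1) * S.card := by
    field_simp
    ring
  rw [mul_add, e4] at e3
  simp only [Finset.card_empty, Nat.cast_zero, mul_zero] at h2
  linarith

lemma push_all (D : Set F) (V : ℕ → Finset F)
    (comm : ∀ i u d d', u ∈ V i → d ∈ D → d' ∈ D → u + d ∈ V (i+1) → u + d + d' ∈ V (i+2) →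
      u + d' ∈ V (i+1))
    (q : ℝ) (hq : 0 < q) (h : ℕ) (B : ℕ → Finset F) (hB : IsMinCut D V q h B) (n : ℕ)
    (hn : n < h) :
    ∃ B', IsMinCut D V q h B' ∧ B' 0 = B 0 ∧ ∀ k, 1 ≤ k → k ≤ n → AA D V B' k ⊆ B' k := by
  classical
  induction n with
  | zero => exact ⟨B, hB, rfl, fun k h1 h2 => by omega⟩
  | succ n ih =>
    obtain ⟨B', hm, h0, hk⟩ := ih (by omega)
    refine ⟨_, push D V comm q hq h B' hm n hn, ?_, ?_⟩
    · rw [Function.update_of_ne (by omega), h0]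
    · intro k h1 h2
      obtain ⟨k, rfl⟩ : ∃ k', k = k' + 1 := ⟨k - 1, by omega⟩
      have e : AA D V (Function.update B' (n+1) (B' (n+1) ∪ AA D V B' (n+1))) (k+1)
          = AA D V B' (k+1) := by
        simp only [AA]; rw [Function.update_of_ne (by omega)]
      rw [e]
      by_cases hkn : k = n
      · subst hkn
        simp
      · rw [Function.update_of_ne (by omega)]
        exact hk _ h1 (by omega)

open Classical in
lemma cut_lower (D : Set F) (V : ℕ → Finset F)
    (comm : ∀ i u d d', u ∈ V i → d ∈ D → d' ∈ D → u + d ∈ V (i+1) → u + d + d' ∈ V (i+2) →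
      u + d' ∈ V (i+1))
    (q : ℝ) (hq : 0 < q) (h : ℕ) (hh : 1 ≤ h) (B : ℕ → Finset F) (hB : IsMinCut D V q h B) :
    ((V 0 \ B 0).card : ℝ) + q ^ h * ((RR D V (V 0 ∩ B 0) h).card : ℝ) ≤ wt D V q h B := by
  obtain ⟨B', hm, h0, hk⟩ := push_all D V comm q hq h B hB (h-1) (by omega)
  refine le_trans ?_ (hm.2 B hB.1)
  have hR : ∀ k, k ≤ h - 1 → RR D V (V 0 ∩ B 0) k ⊆ B' k := by
    intro k
    induction k with
    | zero => intro _; rw [h0]; exact Finset.inter_subset_right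
    | succ k ih =>
      intro hkh
      exact (nb_mono D V k (ih (by omega))).trans (hk (k+1) (by omega) hkh)
  have hRh : RR D V (V 0 ∩ B 0) h ⊆ AA D V B' h \ B' h := by
    rw [hm.1, Finset.sdiff_empty]
    obtain ⟨k, rfl⟩ : ∃ k', h = k' + 1 := ⟨h - 1, by omega⟩
    exact nb_mono D V k (hR k (by omega))
  have hsub : ({0, h} : Finset ℕ) ⊆ Finset.range (h+1) := by
    intro i hi; simp at hi ⊢; omega
  have h1 : ∑ i ∈ ({0, h} : Finset ℕ), term D V q B' i ≤ wt D V q h B' :=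
    Finset.sum_le_sum_of_subset_of_nonneg hsub fun i _ _ => by unfold term; positivity
  rw [Finset.sum_pair (by omega)] at h1
  refine le_trans ?_ h1
  have h2 := mul_le_mul_of_nonneg_left
    (Nat.cast_le (α := ℝ).2 (Finset.card_le_card hRh)) (pow_pos hq h).le
  have h3 : term D V q B' 0 = ((V 0 \ B 0).card : ℝ) := by
    simp [term, AA, h0]
  rw [h3]
  unfold term
  linarith

open Classical in
theorem core (D : Set F) (V : ℕ → Finset F)
    (comm : ∀ i u d d', u ∈ V i → d ∈ D → d' ∈ D → u + d ∈ V (i+1) → u + d + d' ∈ V (i+2) →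
      u + d' ∈ V (i+1))
    (q : ℝ) (hq : 0 < q) (j h : ℕ) (hj : 1 ≤ j) (hjh : j < h)
    (hmin : ∀ Y ⊆ V 0, q ^ j * ((V j).card : ℝ) ≤
      ((V 0 \ Y).card : ℝ) + q ^ j * ((RR D V Y j).card : ℝ))
    (hfull : V h ⊆ RR D V (V 0) h) :
    q ^ h * ((V h).card : ℝ) ≤ q ^ j * ((V j).card : ℝ) := by
  -- step (i)
  have s1 : ∀ B, B j = ∅ → q ^ j * ((V j).card : ℝ) ≤ wt D V q j B := by
    intro B hB
    obtain ⟨B0, hB0⟩ := exists_min D V q j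
    refine le_trans ?_ (hB0.2 B hB)
    refine le_trans ?_ (cut_lower D V comm q hq j hj B0 hB0)
    have := hmin (V 0 ∩ B0 0) Finset.inter_subset_left
    rwa [Finset.sdiff_inter_self_left] at this
  obtain ⟨B, hBh, hB⟩ := exists_min D V q h
  let B1 : ℕ → Finset F := fun i => if i < j then V i else B i
  have split : ∀ X : ℕ → Finset F, wt D V q h X = ∑ i ∈ Finset.range j, term D V q X i
      + term D V q X j + ∑ i ∈ Finset.Ico (j+1) (h+1), term D V q X i := by
    intro X
    unfold wt
    rw [← Finset.sum_range_succ, Finset.sum_range_add_sum_Ico _ (by omega)]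
  have hzero : ∀ X : ℕ → Finset F, (∀ i < j, X i = V i) →
      ∑ i ∈ Finset.range j, term D V q X i = 0 := by
    intro X hX
    refine Finset.sum_eq_zero fun i hi => ?_
    have : AA D V X i \ X i = ∅ := by
      rw [hX i (Finset.mem_range.1 hi)]
      exact Finset.sdiff_eq_empty_iff_subset.2 (AA_sub D V X i)
    simp [term, this]
  have hB1 : IsMinCut D V q h B1 := by
    refine ⟨by simp only [B1]; rw [if_neg (by omega)]; exact hBh, fun B' hB' => ?_⟩
    refine le_trans ?_ (hB B' hB')
    rw [split B1, split B, hzero B1 (fun i hi => by simp [B1, hi])]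
    have t1 : ∑ i ∈ Finset.Ico (j+1) (h+1), term D V q B1 i
        = ∑ i ∈ Finset.Ico (j+1) (h+1), term D V q B i := by
      refine Finset.sum_congr rfl fun i hi => ?_
      rw [Finset.mem_Ico] at hi
      obtain ⟨k, rfl⟩ : ∃ k', i = k' + 1 := ⟨i - 1, by omega⟩
      have a1 : B1 k = B k := by simp only [B1]; rw [if_neg (by omega)]
      have a2 : B1 (k+1) = B (k+1) := by simp only [B1]; rw [if_neg (by omega)]
      simp only [term, AA, a1, a2]
    have t2 := s1 (Function.update B j ∅) (by simp)
    have t3 : wt D V q j (Function.update B j ∅) = ∑ i ∈ Finset.range j, term D V q B i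
        + q ^ j * ((AA D V B j).card : ℝ) := by
      unfold wt
      rw [Finset.sum_range_succ]
      have a : ∀ i ≤ j, AA D V (Function.update B j ∅) i = AA D V B i := by
        intro i hi
        cases i with
        | zero => rfl
        | succ i => simp only [AA]; rw [Function.update_of_ne (by omega)]
      congr 1
      · refine Finset.sum_congr rfl fun i hi => ?_
        have := Finset.mem_range.1 hi
        simp only [term]
        rw [a i (by omega), Function.update_of_ne (by omega)]
      · simp [term, a j le_rfl]
    have t4 : ((AA D V B1 j \ B1 j).card : ℝ) ≤ (V j).card - (AA D V B j).card
        + ((AA D V B j \ B j).card : ℝ) := by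
      have a2 : B1 j = B j := by simp [B1]
      rw [a2]
      have c1 : (AA D V B1 j \ B j).card ≤ (V j \ B j).card :=
        Finset.card_le_card (Finset.sdiff_subset_sdiff (AA_sub D V B1 j) subset_rfl)
      have c2 := Finset.card_inter_add_card_sdiff (V j) (B j)
      have c3 := Finset.card_inter_add_card_sdiff (AA D V B j) (B j)
      have c4 : (AA D V B j ∩ B j).card ≤ (V j ∩ B j).card :=
        Finset.card_le_card (Finset.inter_subset_inter (AA_sub D V B j) subset_rfl)
      rify at c1 c2 c3 c4
      linarith
    have t5 := mul_le_mul_of_nonneg_left t4 (pow_pos hq j).le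
    rw [t1]
    rw [t3] at t2
    simp only [term] at *
    linarith
  have f1 := cut_lower D V comm q hq h (by omega) B1 hB1
  have f2 : B1 0 = V 0 := by simp only [B1]; rw [if_pos (by omega)]
  rw [f2] at f1
  simp only [sdiff_self, Finset.inter_self] at f1
  let B2 : ℕ → Finset F := fun i => if i < j then V i else ∅
  have f3 := hB1.2 B2 (by simp only [B2]; rw [if_neg (by omega)])
  have f4 : wt D V q h B2 ≤ q ^ j * ((V j).card : ℝ) := by
    rw [split B2, hzero B2 (fun i hi => by simp [B2, hi])]
    have t1 : ∑ i ∈ Finset.Ico (j+1) (h+1), term D V q B2 i = 0 := by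
      refine Finset.sum_eq_zero fun i hi => ?_
      rw [Finset.mem_Ico] at hi
      obtain ⟨k, rfl⟩ : ∃ k', i = k' + 1 := ⟨i - 1, by omega⟩
      have a1 : B2 k = ∅ := by simp only [B2]; rw [if_neg (by omega)]
      simp [term, AA, a1, nb]
    rw [t1, zero_add, add_zero]
    unfold term
    refine mul_le_mul_of_nonneg_left ?_ (pow_pos hq j).le
    norm_cast
    exact Finset.card_le_card (Finset.sdiff_subset.trans (AA_sub D V B2 j))
  have f5 := mul_le_mul_of_nonneg_left
    (Nat.cast_le (α := ℝ).2 (Finset.card_le_card hfull)) (pow_pos hq h).le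
  simp only [Finset.bot_eq_empty, Finset.card_empty, Nat.cast_zero, zero_add] at f1
  linarith

end PlR

namespace PlR

variable {F : Type*} [AddCommGroup F]

def Bad (N D : Set F) : ℕ → Set F
  | 0 => ∅
  | i+1 => N + iterSumset D i

lemma bad_step (N D : Set F) (i : ℕ) {x d : F} (hx : x ∈ Bad N D i) (hd : d ∈ D) :
    x + d ∈ Bad N D (i+1) := by
  cases i with
  | zero => exact absurd hx (Set.notMem_empty _)
  | succ i =>
    simp only [Bad, iterSumset] at *
    rw [← add_assoc]
    exact Set.add_mem_add hx hd

def LV (N D Z : Set F) (i : ℕ) : Set F := (Z + iterSumset D i) \ Bad N D i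

lemma iter_finite {D : Set F} (hD : D.Finite) (i : ℕ) : (iterSumset D i).Finite := by
  induction i with
  | zero => exact Set.finite_singleton _
  | succ i ih => exact ih.add hD

lemma LV_finite {N D Z : Set F} (hD : D.Finite) (hZ : Z.Finite) (i : ℕ) : (LV N D Z i).Finite :=
  (hZ.add (iter_finite hD i)).sdiff

lemma LV_zero (N D Z : Set F) : LV N D Z 0 = Z := by
  simp [LV, Bad, iterSumset]

lemma LV_step (N D Z : Set F) (i : ℕ) {x : F} (hx : x ∈ LV N D Z (i+1)) :
    ∃ u ∈ LV N D Z i, x - u ∈ D := by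
  obtain ⟨hx, hb⟩ := hx
  simp only [iterSumset] at hx
  rw [← add_assoc] at hx
  obtain ⟨u, hu, d, hd, rfl⟩ := hx
  exact ⟨u, ⟨hu, fun h => hb (bad_step N D i h hd)⟩, by simpa using hd⟩

lemma LV_mono (N D : Set F) {Y Z : Set F} (h : Y ⊆ Z) (i : ℕ) : LV N D Y i ⊆ LV N D Z i :=
  Set.sdiff_subset_sdiff_left (Set.add_subset_add_right h)

lemma LV_empty_up (N D Z : Set F) {i k : ℕ} (hik : i ≤ k) (h : LV N D Z i = ∅) :
    LV N D Z k = ∅ := by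
  induction k, hik using Nat.le_induction with
  | base => exact h
  | succ k _ ih =>
    rw [Set.eq_empty_iff_forall_notMem] at ih ⊢
    intro x hx
    obtain ⟨u, hu, _⟩ := LV_step N D Z k hx
    exact ih u hu

theorem growth {N D Z : Set F} (hD : D.Finite) (hZ : Z.Finite) (q : ℝ) (hq : 0 < q) (j h : ℕ)
    (hj : 1 ≤ j) (hjh : j < h)
    (hmin : ∀ Y ⊆ Z, q ^ j * ((LV N D Z j).ncard : ℝ) - Z.ncard ≤
      q ^ j * ((LV N D Y j).ncard : ℝ) - Y.ncard) :
    q ^ h * ((LV N D Z h).ncard : ℝ) ≤ q ^ j * ((LV N D Z j).ncard : ℝ) := by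
  classical
  let V : ℕ → Finset F := fun i => (LV_finite (N := N) hD hZ i).toFinset
  have hV : ∀ i x, x ∈ V i ↔ x ∈ LV N D Z i := fun i x => by simp [V]
  have hVc : ∀ i, (LV N D Z i).ncard = (V i).card := fun i =>
    Set.ncard_eq_toFinset_card _ (LV_finite hD hZ i)
  have hR : ∀ (Y : Finset F), Y ⊆ V 0 → ∀ i x, x ∈ LV N D (Y : Set F) i → x ∈ RR D V Y i := by
    intro Y hY i
    have hYZ : (Y : Set F) ⊆ Z := by
      intro y hy
      have := (hV 0 y).1 (hY hy)
      rwa [LV_zero] at this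
    induction i with
    | zero => intro x hx; rw [LV_zero] at hx; exact hx
    | succ i ih =>
      intro x hx
      obtain ⟨u, hu, hd⟩ := LV_step N D _ i hx
      simp only [RR, nb, Finset.mem_filter]
      exact ⟨(hV _ _).2 (LV_mono N D hYZ _ hx), u, ih u hu, (hV _ _).2 (LV_mono N D hYZ _ hu), hd⟩
  have hV0 : (V 0 : Set F) = Z := by
    ext x; rw [Finset.mem_coe, hV, LV_zero]
  rw [hVc, hVc]
  refine core D V ?_ q hq j h hj hjh ?_ ?_
  · intro i u d d' hu hd hd' _ hw
    rw [hV] at *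
    refine ⟨?_, fun hb => hw.2 ?_⟩
    · simp only [iterSumset]
      rw [← add_assoc]
      exact Set.add_mem_add hu.1 hd'
    · rw [add_right_comm]
      exact bad_step N D (i+1) hb hd
  · intro Y hY
    have h1 := hmin (Y : Set F) (by rw [← hV0]; exact_mod_cast hY)
    rw [← hV0, Set.ncard_coe_finset, Set.ncard_coe_finset, hV0, hVc] at h1
    have h2 : (LV N D (Y : Set F) j).ncard ≤ (RR D V Y j).card := by
      rw [← Set.ncard_coe_finset]
      exact Set.ncard_le_ncard (fun x hx => hR Y hY j x hx) (Finset.finite_toSet _)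
    have h3 := mul_le_mul_of_nonneg_left (Nat.cast_le (α := ℝ).2 h2) (pow_pos hq j).le
    rw [Finset.card_sdiff_of_subset hY, Nat.cast_sub (Finset.card_le_card hY)]
    linarith
  · intro x hx
    refine hR (V 0) subset_rfl h x ?_
    rw [hV0]; exact (hV _ _).1 hx

end PlR

/-- General Plünnecke–Ruzsa inequality. -/
theorem stmt6 {F : Type*} [AddCommGroup F] (M D N : Set F)
    (hMfin : M.Finite) (hDfin : D.Finite) (hNfin : N.Finite)
    (m : ℕ) (hm : M.ncard = m) (hm1 : 1 ≤ m)
    (j h : ℕ) (hj : 1 ≤ j) (hjh : j < h)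
    (γ : ℝ) (hγ : γ = (h : ℝ) / (j : ℝ))
    (s : ℕ) (hs : ((M + iterSumset D j) \ (N + iterSumset D (j - 1))).ncard = s)
    (ℓ : ℕ) (hℓ1 : 1 ≤ ℓ) (hℓm : ℓ < m) :
    ∃ M' : Set F, M' ⊆ M ∧ ℓ < M'.ncard ∧
      (((M' + iterSumset D h) \ (N + iterSumset D (h - 1))).ncard : ℝ) ≤
        (s : ℝ) ^ γ / γ * (1 / ((m : ℝ) - (ℓ : ℝ)) ^ (γ - 1) - 1 / (m : ℝ) ^ (γ - 1)) +
          ((s : ℝ) / ((m : ℝ) - (ℓ : ℝ))) ^ γ * ((M'.ncard : ℝ) - (ℓ : ℝ)) := by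
  have hLV : ∀ (Z : Set F) (k : ℕ), 1 ≤ k →
      (Z + iterSumset D k) \ (N + iterSumset D (k - 1)) = PlR.LV N D Z k := by
    intro Z k hk
    obtain ⟨k, rfl⟩ : ∃ k', k = k' + 1 := ⟨k - 1, by omega⟩
    rfl
  rw [hLV M j hj] at hs
  have hj0 : (0:ℝ) < j := by exact_mod_cast hj
  have hjh' : (j:ℝ) < h := by exact_mod_cast hjh
  have hγ1 : 1 < γ := by rw [hγ, one_lt_div hj0]; exact hjh'
  have hγ0 : 0 < γ := by linarith
  have hml : (0:ℝ) < (m:ℝ) - ℓ := by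
    have : (ℓ:ℝ) < m := by exact_mod_cast hℓm
    linarith
  have hℓ0 : (0:ℝ) ≤ ℓ := Nat.cast_nonneg _
  -- the first term is nonnegative
  have hfirst : 0 ≤ (s : ℝ) ^ γ / γ *
      (1 / ((m : ℝ) - (ℓ : ℝ)) ^ (γ - 1) - 1 / (m : ℝ) ^ (γ - 1)) := by
    refine mul_nonneg (by positivity) (sub_nonneg.2 ?_)
    refine one_div_le_one_div_of_le (Real.rpow_pos_of_pos hml _) ?_
    exact Real.rpow_le_rpow hml.le (by linarith) (by linarith)
  suffices hsuff : ∃ M' : Set F, M' ⊆ M ∧ ℓ < M'.ncard ∧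
      ((PlR.LV N D M' h).ncard : ℝ) ≤
        ((s : ℝ) / ((m : ℝ) - (ℓ : ℝ))) ^ γ * ((M'.ncard : ℝ) - (ℓ : ℝ)) by
    obtain ⟨M', h1, h2, h3⟩ := hsuff
    refine ⟨M', h1, h2, ?_⟩
    rw [hLV M' h (by omega)]
    linarith
  rcases Nat.eq_zero_or_pos s with hs0 | hspos
  · refine ⟨M, subset_rfl, by omega, ?_⟩
    rw [hs0, Set.ncard_eq_zero (PlR.LV_finite hDfin hMfin j)] at hs
    rw [PlR.LV_empty_up N D M hjh.le hs, hs0]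
    simp [Real.zero_rpow hγ0.ne']
  · set r : ℝ := (s : ℝ) / ((m : ℝ) - (ℓ : ℝ)) with hr
    have hs' : (0:ℝ) < s := by exact_mod_cast hspos
    have hr0 : 0 < r := div_pos hs' hml
    let g : Set F → ℝ := fun Z => ((PlR.LV N D Z j).ncard : ℝ) - r * Z.ncard
    have hgM : g M = - (r * ℓ) := by
      simp only [g]
      rw [hs, hm]
      have : r * ((m:ℝ) - ℓ) = s := by rw [hr]; field_simp
      linarith
    obtain ⟨Z, hZM, hZℓ, hZg, hZmin⟩ : ∃ Z, Z ⊆ M ∧ ℓ < Z.ncard ∧ g Z ≤ -(r * ℓ) ∧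
        ∀ Y ⊆ M, g Z ≤ g Y := by
      obtain ⟨Z, hZ, hmin⟩ := Set.exists_min_image {b | b ⊆ M} g hMfin.finite_subsets
        ⟨M, subset_refl M⟩
      have hZM := hmin M (subset_refl M)
      rcases hZM.lt_or_eq with hlt | heq
      · refine ⟨Z, hZ, ?_, by linarith, fun Y hY => hmin Y hY⟩
        have h1 : r * ℓ < r * Z.ncard := by
          have : (0:ℝ) ≤ ((PlR.LV N D Z j).ncard : ℝ) := Nat.cast_nonneg _
          rw [hgM] at hlt
          simp only [g] at hlt
          linarith
        exact_mod_cast lt_of_mul_lt_mul_left h1 hr0.le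
      · exact ⟨M, subset_rfl, by omega, hgM.le, fun Y hY => heq ▸ hmin Y hY⟩
    refine ⟨Z, hZM, hZℓ, ?_⟩
    set q : ℝ := r ^ (-(1 / (j:ℝ))) with hq
    have hq0 : 0 < q := Real.rpow_pos_of_pos hr0 _
    have hqj : q ^ j = r⁻¹ := by
      rw [hq, ← Real.rpow_natCast, ← Real.rpow_mul hr0.le, ← Real.rpow_neg_one]
      congr 1; field_simp
    have hqh : q ^ h = (r ^ γ)⁻¹ := by
      rw [hq, ← Real.rpow_natCast, ← Real.rpow_mul hr0.le, ← Real.rpow_neg hr0.le, hγ]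
      congr 1; field_simp
    have hG := PlR.growth (N := N) hDfin (hMfin.subset hZM) q hq0 j h hj hjh (by
      intro Y hY
      have h1 := hZmin Y (hY.trans hZM)
      simp only [g] at h1
      rw [hqj]
      have h2 := mul_le_mul_of_nonneg_left h1 (inv_pos.2 hr0).le
      have h3 : ∀ a b : ℝ, r⁻¹ * (a - r * b) = r⁻¹ * a - b := by
        intro a b; field_simp
      rw [h3, h3] at h2
      exact h2)
    rw [hqj, hqh] at hG
    have hrγ : 0 < r ^ γ := Real.rpow_pos_of_pos hr0 _
    rw [inv_mul_le_iff₀ hrγ] at hG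
    refine hG.trans (mul_le_mul_of_nonneg_left ?_ hrγ.le)
    rw [inv_mul_le_iff₀ hr0]
    simp only [g] at hZg
    linarith
end

section
/- (Lovász, Stein) Let G be a finite bipartite graph with parts A and B, let a ≥ 1 and b ≥ 1 be such that every vertex of A has degree at least a and every vertex of B has degree at most b. Then there exists a subset B' ⊆ B of size at most (|B|/a)(1 + ln b) such that every vertex of A has a neighbor in B', i.e., A ⊆ N(B'). -/
open Classical in
theorem cover_aux {A B : Type*} [Fintype A] [Fintype B] (R : A → B → Prop)
    (a : ℕ) (ha : 1 ≤ a)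
    (hA : ∀ x : A, a ≤ (Finset.univ.filter (fun y => R x y)).card) (i : ℕ) :
    ∀ (n : ℕ) (U : Finset A), U.card = n →
      (∀ y : B, (U.filter (fun x => R x y)).card ≤ i + 1) →
      ∃ S : Finset B, ((S.card : ℝ) ≤ (U.card : ℝ) / (i + 1) +
        (Fintype.card B : ℝ) / a * ((harmonic (i + 1) : ℚ) - 1)) ∧
        ∀ x ∈ U, ∃ y ∈ S, R x y := by
  have hdc : ∀ (U : Finset A) (k : ℕ), (∀ y : B, (U.filter (fun x => R x y)).card ≤ k) →
      U.card * a ≤ Fintype.card B * k := by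
    intro U k h
    exact Finset.card_mul_le_card_mul (s := U) (t := Finset.univ) R
      (fun x _ => hA x) (fun y _ => h y)
  have ha' : (0 : ℝ) < a := by exact_mod_cast ha
  induction i with
  | zero =>
    intro n
    induction n using Nat.strong_induction_on with
    | _ n ih =>
    intro U hU hd
    by_cases h : ∃ y, (U.filter (fun x => R x y)).card = 0 + 1
    · obtain ⟨y, hy⟩ := h
      have hc := Finset.card_filter_add_card_filter_not (s := U) (fun x => R x y)
      obtain ⟨S, hS, hc'⟩ := ih _ (by omega) (U.filter (fun x => ¬ R x y)) rfl
        (fun z => (Finset.card_le_card (Finset.filter_subset_filter _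
          (Finset.filter_subset _ _))).trans (hd z))
      refine ⟨insert y S, ?_, ?_⟩
      · have h1 : ((insert y S).card : ℝ) ≤ S.card + 1 := by
          exact_mod_cast Finset.card_insert_le y S
        have h2 : (U.card : ℝ) = 0 + 1 + ((U.filter (fun x => ¬ R x y)).card : ℝ) := by
          rw [← hc, hy]; push_cast; ring
        rw [h2]
        simp at hS ⊢
        have hS' : (S.card : ℝ) ≤ ((U.filter (fun x => ¬ R x y)).card : ℝ) := by
          exact_mod_cast hS
        linarith
      · intro x hx
        by_cases hr : R x y
        · exact ⟨y, by simp, hr⟩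
        · obtain ⟨z, hz, hz'⟩ := hc' x (by simp [hx, hr])
          exact ⟨z, by simp [hz], hz'⟩
    · push Not at h
      have := hdc U 0 (fun y => by have := hd y; have := h y; omega)
      have hU0 : U = ∅ := by
        rw [← Finset.card_eq_zero]
        by_contra hne
        have := Nat.mul_pos (Nat.pos_of_ne_zero hne) ha
        omega
      exact ⟨∅, by simp [hU0], by simp [hU0]⟩
  | succ i ihi =>
    intro n
    induction n using Nat.strong_induction_on with
    | _ n ih =>
    intro U hU hd
    by_cases h : ∃ y, (U.filter (fun x => R x y)).card = i + 1 + 1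
    · obtain ⟨y, hy⟩ := h
      have hc := Finset.card_filter_add_card_filter_not (s := U) (fun x => R x y)
      obtain ⟨S, hS, hc'⟩ := ih _ (by omega) (U.filter (fun x => ¬ R x y)) rfl
        (fun z => (Finset.card_le_card (Finset.filter_subset_filter _
          (Finset.filter_subset _ _))).trans (hd z))
      refine ⟨insert y S, ?_, ?_⟩
      · have h1 : ((insert y S).card : ℝ) ≤ S.card + 1 := by
          exact_mod_cast Finset.card_insert_le y S
        have h2 : (U.card : ℝ) = ((i + 1 : ℕ) + 1) +
            ((U.filter (fun x => ¬ R x y)).card : ℝ) := by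
          rw [← hc, hy]; push_cast; ring
        rw [h2, add_div, div_self (by positivity)]
        linarith
      · intro x hx
        by_cases hr : R x y
        · exact ⟨y, by simp, hr⟩
        · obtain ⟨z, hz, hz'⟩ := hc' x (by simp [hx, hr])
          exact ⟨z, by simp [hz], hz'⟩
    · push Not at h
      have hd' : ∀ y, (U.filter (fun x => R x y)).card ≤ i + 1 :=
        fun y => by have := hd y; have := h y; omega
      have h3 := hdc U (i + 1) hd'
      obtain ⟨S, hS, hc'⟩ := ihi _ U rfl hd'
      refine ⟨S, hS.trans ?_, hc'⟩
      have h4 : (U.card : ℝ) * a ≤ Fintype.card B * (i + 1) := by exact_mod_cast h3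
      have h5 : (U.card : ℝ) / (i + 1) ≤ Fintype.card B / a := by
        rw [div_le_div_iff₀ (by positivity) ha']; exact h4
      rw [harmonic_succ (i + 1)]
      push_cast
      have h6 : (U.card : ℝ) / (i + 1) - U.card / (i + 1 + 1) =
          U.card / (i + 1) * ((i : ℝ) + 1 + 1)⁻¹ := by
        field_simp; ring
      have h7 := mul_le_mul_of_nonneg_right h5 (show (0 : ℝ) ≤ ((i : ℝ) + 1 + 1)⁻¹ by positivity)
      linarith

/-- Lovász–Stein covering lemma. A finite bipartite graph with parts `A` and `B` is modelled
by its adjacency relation `R : A → B → Prop`. If every vertex of `A` has degree at least `a`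
and every vertex of `B` has degree at most `b`, then some `B' ⊆ B` with
`|B'| ≤ (|B|/a)(1 + ln b)` covers `A`, i.e. every vertex of `A` has a neighbor in `B'`. -/
theorem stmt8 {A B : Type*} [Fintype A] [Fintype B] (R : A → B → Prop)
    (a b : ℕ) (ha : 1 ≤ a) (hb : 1 ≤ b)
    (hdegA : ∀ x : A, a ≤ Nat.card {y : B // R x y})
    (hdegB : ∀ y : B, Nat.card {x : A // R x y} ≤ b) :
    ∃ B' : Set B, ((B'.ncard : ℝ) ≤ (Fintype.card B : ℝ) / (a : ℝ) * (1 + Real.log b)) ∧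
      ∀ x : A, ∃ y ∈ B', R x y := by
  classical
  have hA : ∀ x : A, a ≤ (Finset.univ.filter (fun y => R x y)).card := by
    intro x
    have := hdegA x
    rwa [Nat.card_eq_fintype_card, Fintype.card_subtype] at this
  have hB : ∀ y : B, (Finset.univ.filter (fun x => R x y)).card ≤ b := by
    intro y
    have := hdegB y
    rwa [Nat.card_eq_fintype_card, Fintype.card_subtype] at this
  obtain ⟨i, rfl⟩ : ∃ i, b = i + 1 := ⟨b - 1, by omega⟩
  obtain ⟨S, hS, hc⟩ := cover_aux R a ha (by convert hA) i _ Finset.univ rfl (by convert hB)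
  refine ⟨S, ?_, fun x => by simpa using hc x (Finset.mem_univ x)⟩
  rw [Set.ncard_coe_finset]
  have ha' : (0 : ℝ) < a := by exact_mod_cast ha
  have h3 : (Finset.univ : Finset A).card * a ≤ (Finset.univ : Finset B).card * (i + 1) :=
    Finset.card_mul_le_card_mul R
      (fun x _ => hA x) (fun y _ => hB y)
  have h5 : ((Finset.univ : Finset A).card : ℝ) / (i + 1) ≤ Fintype.card B / a := by
    rw [div_le_div_iff₀ (by positivity) ha']; exact_mod_cast h3
  have h6 := harmonic_le_one_add_log (i + 1)
  have h7 := mul_le_mul_of_nonneg_left h6 (show (0 : ℝ) ≤ (Fintype.card B : ℝ) / a by positivity)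
  linarith
end

section
/- For every real k > 0 there exists n₀ such that for all n ≥ n₀ the following holds. Let F be a finite abelian group of order 2n, let D ⊆ F be a generating set of F with D = −D and |D| ≥ 10 · (log n) · (log log n)^k, and let α be a real number with 0 < α ≤ (log log n)^k such that |D + D| ≤ α|D|. Then there exists D' ⊆ D such that: (1) D' = −D'; (2) D' generates F; (3) |D|/(20α) ≤ |D'| ≤ 2|D|/(5α); and (4) |D' + D'| ≥ α|D'|. -/
open Pointwise Real

open Classical in
lemma gen_aux {F : Type} [AddCommGroup F] [Fintype F] (D : Finset F)
    (hD : AddSubgroup.closure (D : Set F) = ⊤) :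
    ∃ G ⊆ D, AddSubgroup.closure (G : Set F) = ⊤ ∧ 2 ^ G.card ≤ Fintype.card F := by
  let S := D.powerset.filter
    (fun G : Finset F => 2 ^ G.card ≤ Nat.card (AddSubgroup.closure (G : Set F)))
  have hS : S.Nonempty := ⟨∅, by simp [S]⟩
  obtain ⟨G, hG, hmax⟩ := S.exists_max_image Finset.card hS
  simp only [S, Finset.mem_filter, Finset.mem_powerset] at hG hmax
  have htop : AddSubgroup.closure (G : Set F) = ⊤ := by
    by_contra hne
    have : ∃ d ∈ D, d ∉ AddSubgroup.closure (G : Set F) := by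
      by_contra! h
      apply hne
      rw [eq_top_iff, ← hD, AddSubgroup.closure_le]
      exact fun x hx => h x (by simpa using hx)
    obtain ⟨d, hd, hdG⟩ := this
    have hdG' : d ∉ G := fun h => hdG (AddSubgroup.subset_closure (by simpa using h))
    have hle : AddSubgroup.closure (G : Set F) ≤ AddSubgroup.closure (insert d G : Finset F) :=
      AddSubgroup.closure_mono (by simp)
    have hdin : d ∈ AddSubgroup.closure ((insert d G : Finset F) : Set F) :=
      AddSubgroup.subset_closure (by simp)
    have hdvd := AddSubgroup.card_dvd_of_le hle
    have hneq : Nat.card (AddSubgroup.closure (G : Set F)) ≠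
        Nat.card (AddSubgroup.closure ((insert d G : Finset F) : Set F)) := by
      intro h
      have := AddSubgroup.eq_of_le_of_card_ge hle h.ge
      exact hdG (this ▸ hdin)
    have hpos : 0 < Nat.card (AddSubgroup.closure ((insert d G : Finset F) : Set F)) :=
      Nat.card_pos
    obtain ⟨c, hc⟩ := hdvd
    have hc2 : 2 ≤ c := by
      rcases c with _ | _ | c
      · omega
      · rw [zero_add, mul_one] at hc; exact absurd hc.symm hneq
      · omega
    have := hmax (insert d G) ⟨Finset.insert_subset hd hG.1, by
      rw [Finset.card_insert_of_notMem hdG', pow_succ, hc]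
      exact Nat.mul_le_mul hG.2 hc2⟩
    rw [Finset.card_insert_of_notMem hdG'] at this
    omega
  refine ⟨G, hG.1, htop, ?_⟩
  have := hG.2
  rw [htop] at this
  simpa using this

open Classical in
lemma greedy_step {F : Type} [AddCommGroup F] (D A C : Finset F) (hD : D.Nonempty)
    (hC : (C.card : ℝ) ≤ 2 * D.card / 5) :
    ∃ d ∈ D, (C.card : ℝ) + A.card / 2 ≤ (C ∪ (A + {d})).card := by
  by_contra! h
  have h1 : ∑ d ∈ D, ((A + {d}) ∩ C).card ≤ A.card * C.card := by
    have : ∀ d ∈ D, ((A + {d}) ∩ C).card = ∑ a ∈ A, if a + d ∈ C then 1 else 0 := by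
      intro d _
      rw [← Finset.card_filter]
      symm
      apply Finset.card_bij (fun a _ => a + d)
      · intro a ha
        simp only [Finset.mem_filter] at ha
        simp only [Finset.mem_inter]
        exact ⟨Finset.add_mem_add ha.1 (by simp), ha.2⟩
      · intro a _ b _ hab
        exact add_right_cancel hab
      · intro b hb
        simp only [Finset.mem_inter, Finset.mem_add, Finset.mem_singleton] at hb
        obtain ⟨⟨a, ha, e, rfl, rfl⟩, hb⟩ := hb
        exact ⟨a, by simp [ha, hb], rfl⟩
    rw [Finset.sum_congr rfl this, Finset.sum_comm]
    calc _ ≤ ∑ a ∈ A, C.card := by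
          apply Finset.sum_le_sum
          intro a _
          rw [← Finset.card_filter]
          apply Finset.card_le_card_of_injOn (fun d => a + d)
          · intro d hd
            simpa using (Finset.mem_filter.1 hd).2
          · intro x _ y _ hxy
            exact add_left_cancel hxy
      _ = _ := by simp
  have h2 : ∀ d ∈ D, (A.card : ℝ) / 2 < ((A + {d}) ∩ C).card := by
    intro d hd
    have := h d hd
    have h3 : ((C ∪ (A + {d})).card : ℝ) + ((A + {d}) ∩ C).card = C.card + A.card := by
      have h4 := Finset.card_union_add_card_inter C (A + {d})
      rw [Finset.inter_comm] at h4
      have h5 : (A + {d}).card = A.card := by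
        rw [Finset.add_singleton]
        exact Finset.card_image_of_injective _ (add_left_injective d)
      rw [h5] at h4
      exact_mod_cast h4
    linarith
  have h3 := Finset.sum_lt_sum_of_nonempty hD h2
  have h1' : ∑ d ∈ D, (((A + {d}) ∩ C).card : ℝ) ≤ A.card * C.card := by exact_mod_cast h1
  simp only [Finset.sum_const, nsmul_eq_mul] at h3
  have : (A.card : ℝ) * C.card ≤ A.card * (2 * D.card / 5) := by gcongr
  have : (0 : ℝ) ≤ A.card * D.card := by positivity
  nlinarith

open Classical in
lemma greedy {F : Type} [AddCommGroup F] (D A : Finset F) (hD : D.Nonempty) (s : ℕ) :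
    ∃ B ⊆ D, B.card ≤ s ∧ (2 * (D.card : ℝ) / 5 ≤ (A + B).card ∨
      (s : ℝ) * (A.card / 2) ≤ (A + B).card) := by
  induction s with
  | zero => exact ⟨∅, by simp, by simp, Or.inr (by simp)⟩
  | succ s ih =>
    obtain ⟨B, hB, hs, h⟩ := ih
    by_cases h1 : 2 * (D.card : ℝ) / 5 ≤ (A + B).card
    · exact ⟨B, hB, by omega, Or.inl h1⟩
    have h2 := h.resolve_left h1
    obtain ⟨d, hd, h3⟩ := greedy_step D A (A + B) hD (le_of_not_ge h1)
    refine ⟨B ∪ {d}, Finset.union_subset hB (by simpa using hd), ?_, Or.inr ?_⟩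
    · have := Finset.card_union_le B {d}
      simp only [Finset.card_singleton] at this
      omega
    · rw [Finset.add_union]
      push_cast
      linarith

open Classical in
lemma core {F : Type} [AddCommGroup F] [Fintype F] (n : ℕ) (hn : 0 < n)
    (hF : Fintype.card F = 2 * n) (D : Finset F) (hsym : ∀ x ∈ D, -x ∈ D)
    (hD : AddSubgroup.closure (D : Set F) = ⊤) (α : ℝ) (hα : 0 < α)
    (hL : 32 * α + 6 ≤ logb 2 n) (hN : 10 * logb 2 n * α ≤ D.card)
    (hDD : ((D + D).card : ℝ) ≤ α * D.card) :
    ∃ D' ⊆ D, (∀ x ∈ D', -x ∈ D') ∧ AddSubgroup.closure (D' : Set F) = ⊤ ∧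
      (D.card : ℝ) / (20 * α) ≤ D'.card ∧ (D'.card : ℝ) ≤ 2 * D.card / (5 * α) ∧
      α * D'.card ≤ (D' + D').card := by
  set L := logb 2 n with hLdef
  have hNpos : (0 : ℝ) < D.card := lt_of_lt_of_le (by nlinarith) hN
  have hne : D.Nonempty := Finset.card_pos.1 (by exact_mod_cast hNpos)
  have hα1 : 1 ≤ α := by
    have h1 : (D.card : ℝ) ≤ (D + D).card := by
      exact_mod_cast Finset.card_le_card_add_right hne
    by_contra! h
    nlinarith
  obtain ⟨M, hM⟩ : ∃ M : ℝ, (D.card : ℝ) = α * M := ⟨D.card / α, by field_simp⟩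
  have hML : 10 * L ≤ M := by
    rw [hM] at hN
    nlinarith
  obtain ⟨G, hGD, hGtop, hGcard⟩ := gen_aux D hD
  have hGc : (G.card : ℝ) ≤ 1 + L := by
    have h1 : (2 : ℝ) ^ (G.card : ℝ) ≤ 2 * n := by
      rw [Real.rpow_natCast]
      rw [hF] at hGcard
      exact_mod_cast hGcard
    have hn' : (0 : ℝ) < n := by exact_mod_cast hn
    have h2 := (Real.le_logb_iff_rpow_le (by norm_num : (1 : ℝ) < 2) (by positivity)).2 h1
    rw [Real.logb_mul (by norm_num) hn'.ne', Real.logb_self_eq_one (by norm_num)] at h2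
    exact h2
  have hM0 : 0 < M := by linarith
  obtain ⟨X, hXD, hX⟩ : ∃ X ⊆ D, X.card = ⌈M / 20⌉₊ := by
    apply Finset.exists_subset_card_eq
    apply Nat.ceil_le.2
    rw [hM]
    nlinarith
  have hX1 : M / 20 ≤ X.card := hX ▸ Nat.le_ceil _
  have hX2 : (X.card : ℝ) ≤ M / 20 + 1 := by
    rw [hX]
    exact (Nat.ceil_lt_add_one (by positivity)).le
  have hs1 : 16 * α ≤ (⌈16 * α⌉₊ : ℝ) := Nat.le_ceil _
  have hs2 : (⌈16 * α⌉₊ : ℝ) ≤ 16 * α + 1 := (Nat.ceil_lt_add_one (by positivity)).le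
  obtain ⟨B, hBD, hBc, hB⟩ := greedy D X hne ⌈16 * α⌉₊
  have hBc' : (B.card : ℝ) ≤ 16 * α + 1 := le_trans (by exact_mod_cast hBc) hs2
  have hXB : 2 * (D.card : ℝ) / 5 ≤ (X + B).card := by
    rcases hB with h | h
    · exact h
    · refine le_trans ?_ h
      rw [hM]
      have : 16 * α * (M / 20 / 2) ≤ (⌈16 * α⌉₊ : ℝ) * (X.card / 2) := by gcongr
      linarith
  set H := G ∪ (X ∪ B) with hH
  have hHD : H ⊆ D := Finset.union_subset hGD (Finset.union_subset hXD hBD)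
  have hHc : (H.card : ℝ) ≤ G.card + (X.card + B.card) := by
    have h1 := Finset.card_union_le G (X ∪ B)
    have h2 := Finset.card_union_le X B
    exact_mod_cast h1.trans (by omega)
  have hXH : X ⊆ H ∪ -H := fun x hx => by simp [hH, hx]
  have hBH : B ⊆ H ∪ -H := fun x hx => by simp [hH, hx]
  have hcard : ((H ∪ -H).card : ℝ) ≤ 2 * H.card := by
    have h1 := Finset.card_union_le H (-H)
    rw [Finset.card_neg] at h1
    exact_mod_cast h1.trans (by omega)
  have hup : ((H ∪ -H).card : ℝ) ≤ 2 * M / 5 := by linarith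
  refine ⟨H ∪ -H, ?_, ?_, ?_, ?_, ?_, ?_⟩
  · apply Finset.union_subset hHD
    intro x hx
    have := hsym _ (hHD (Finset.mem_neg'.1 hx))
    simpa using this
  · intro x hx
    simp only [Finset.mem_union, Finset.mem_neg', neg_neg] at hx ⊢
    exact hx.symm
  · rw [eq_top_iff, ← hGtop]
    apply AddSubgroup.closure_mono
    intro x hx
    have : x ∈ G := by simpa using hx
    simp [hH, this]
  · rw [hM, show α * M / (20 * α) = M / 20 by field_simp]
    exact hX1.trans (by exact_mod_cast Finset.card_le_card hXH)
  · rw [hM, show 2 * (α * M) / (5 * α) = 2 * M / 5 by field_simp]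
    exact hup
  · have h1 : ((X + B).card : ℝ) ≤ ((H ∪ -H) + (H ∪ -H)).card := by
      exact_mod_cast Finset.card_le_card (Finset.add_subset_add hXH hBH)
    refine le_trans ?_ (hXB.trans h1)
    rw [hM]
    nlinarith

lemma asym (k : ℝ) : ∃ n₀ : ℕ, ∀ n : ℕ, n₀ ≤ n →
    32 * (logb 2 (logb 2 n)) ^ k + 6 ≤ logb 2 n := by
  have hl2 : (0 : ℝ) < Real.log 2 := Real.log_pos (by norm_num)
  have h1 := (isLittleO_log_rpow_rpow_atTop k (zero_lt_one' ℝ)).bound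
    (c := (Real.log 2) ^ k / 64) (by positivity)
  have h2 : ∀ᶠ x : ℝ in Filter.atTop, 32 * (logb 2 x) ^ k + 6 ≤ x := by
    filter_upwards [h1, Filter.eventually_ge_atTop (12 : ℝ)] with x hx hx12
    have hlog : 0 ≤ Real.log x := Real.log_nonneg (by linarith)
    rw [Real.rpow_one, Real.norm_of_nonneg (by positivity),
      Real.norm_of_nonneg (by linarith)] at hx
    have : logb 2 x ^ k ≤ x / 64 := by
      rw [Real.logb, Real.div_rpow hlog hl2.le, div_le_iff₀ (by positivity)]
      linarith
    linarith
  have h3 : Filter.Tendsto (fun n : ℕ => logb 2 (n : ℝ)) Filter.atTop Filter.atTop :=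
    (Real.tendsto_logb_atTop (by norm_num)).comp tendsto_natCast_atTop_atTop
  exact Filter.eventually_atTop.1 (h3.eventually h2)

theorem stmt9 (k : ℝ) (hk : 0 < k) :
    ∃ n₀ : ℕ, ∀ n : ℕ, n₀ ≤ n →
      ∀ (F : Type) [AddCommGroup F] [Fintype F],
        Fintype.card F = 2 * n →
        ∀ D : Set F, (∀ x ∈ D, -x ∈ D) → AddSubgroup.closure D = ⊤ →
          10 * logb 2 n * (logb 2 (logb 2 n)) ^ k ≤ (D.ncard : ℝ) →
          ∀ α : ℝ, 0 < α → α ≤ (logb 2 (logb 2 n)) ^ k →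
            ((D + D).ncard : ℝ) ≤ α * (D.ncard : ℝ) →
            ∃ D' : Set F, D' ⊆ D ∧ (∀ x ∈ D', -x ∈ D') ∧
              AddSubgroup.closure D' = ⊤ ∧
              (D.ncard : ℝ) / (20 * α) ≤ (D'.ncard : ℝ) ∧
              (D'.ncard : ℝ) ≤ 2 * (D.ncard : ℝ) / (5 * α) ∧
              α * (D'.ncard : ℝ) ≤ ((D' + D').ncard : ℝ) := by
  classical
  obtain ⟨n₀, h0⟩ := asym k
  refine ⟨n₀ + 1, fun n hn F _ _ hF D hsym hD hN α hα hαP hDD => ?_⟩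
  obtain ⟨E, rfl⟩ : ∃ E : Finset F, (E : Set F) = D := ⟨D.toFinset, by simp⟩
  have hL := h0 n (by omega)
  rw [← Finset.coe_add, Set.ncard_coe_finset, Set.ncard_coe_finset] at hDD
  rw [Set.ncard_coe_finset] at hN
  obtain ⟨D', h1, h2, h3, h4, h5, h6⟩ := core n (by omega) hF E (by simpa using hsym) hD α hα
    (by linarith) (le_trans (by
      have : 0 ≤ logb 2 (n : ℝ) := by linarith
      gcongr) hN) hDD
  refine ⟨(D' : Set F), by simpa using h1, by simpa using h2, h3, ?_⟩
  rw [← Finset.coe_add, Set.ncard_coe_finset, Set.ncard_coe_finset, Set.ncard_coe_finset]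
  exact ⟨h4, h5, h6⟩
end

section
/- Let F be an abelian group, D ⊆ F a finite nonempty subset with |D| = d, and M ⊆ F a finite subset with |M| = m and |M + D| = m + t. Then for every integer i ≥ 2, |M + iD| ≤ m + d^i · t. -/
open Pointwise

theorem aux_iter_card {F : Type*} [AddCommGroup F] (D : Set F) (hD : D.Finite) (i : ℕ) :
    (iterSumset D i).Finite ∧ (iterSumset D i).ncard ≤ D.ncard ^ i := by
  induction i with
  | zero => simp [iterSumset]
  | succ n ih =>
    refine ⟨ih.1.add hD, ?_⟩
    rw [pow_succ]
    exact (Set.natCard_add_le (s := iterSumset D n) (t := D)).trans (Nat.mul_le_mul_right _ ih.2)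

theorem aux_smul_mem {F : Type*} [AddCommGroup F] (D : Set F) (a : F) (ha : a ∈ D) (i : ℕ) :
    i • a ∈ iterSumset D i := by
  induction i with
  | zero => simp [iterSumset]
  | succ n ih => rw [succ_nsmul]; exact Set.add_mem_add ih ha

theorem aux_cover {F : Type*} [AddCommGroup F] (M D : Set F) (a : F) (ha : a ∈ D) (i : ℕ) :
    M + iterSumset D (i + 1) ⊆
      ((fun x => (i + 1) • a + x) '' M) ∪
        (((M + D) \ ((fun x => a + x) '' M)) + iterSumset D i) := by
  induction i with
  | zero =>
    rintro _ ⟨x, hx, _, ⟨z, hz, e, he, rfl⟩, rfl⟩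
    have hz0 : z = 0 := hz
    subst hz0
    by_cases h : x + e ∈ (fun x => a + x) '' M
    · left; simpa using h
    · right
      exact ⟨x + e, ⟨Set.add_mem_add hx he, h⟩, 0, rfl, by simp⟩
  | succ n ih =>
    rintro _ ⟨x, hx, _, ⟨s, hs, e, he, rfl⟩, rfl⟩
    rcases ih (Set.add_mem_add hx hs) with ⟨y, hy, hxy⟩ | ⟨w, hw, r, hr, hxy⟩
    · by_cases h : y + e ∈ (fun x => a + x) '' M
      · left
        obtain ⟨z, hz, hze⟩ := h
        refine ⟨z, hz, ?_⟩
        simp only at hze hxy ⊢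
        rw [← add_assoc x, ← hxy, add_assoc _ y e, ← hze, succ_nsmul _ (n + 1), add_assoc]
      · right
        refine ⟨y + e, ⟨Set.add_mem_add hy he, h⟩, _, aux_smul_mem D a ha (n + 1), ?_⟩
        simp only at hxy ⊢
        rw [← add_assoc, ← hxy]
        abel
    · right
      refine ⟨w, hw, r + e, Set.add_mem_add hr he, ?_⟩
      simp only at hxy ⊢
      rw [← add_assoc, hxy, add_assoc]

/-- If `|M + D| = m + t` then `|M + iD| ≤ m + dⁱ · t` for every `i ≥ 2`. -/
theorem stmt10 {F : Type*} [AddCommGroup F] (M D : Set F)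
    (hMfin : M.Finite) (hDfin : D.Finite) (hDne : D.Nonempty)
    (d m t : ℕ) (hd : D.ncard = d) (hm : M.ncard = m) (ht : (M + D).ncard = m + t)
    (i : ℕ) (hi : 2 ≤ i) :
    (M + iterSumset D i).ncard ≤ m + d ^ i * t := by
  obtain ⟨a, ha⟩ := hDne
  obtain ⟨k, rfl⟩ : ∃ k, i = k + 1 := ⟨i - 1, by omega⟩
  have hsub : (fun x => a + x) '' M ⊆ M + D := by
    rintro _ ⟨x, hx, rfl⟩
    exact ⟨x, hx, a, ha, add_comm _ _⟩
  have hN : ((M + D) \ ((fun x => a + x) '' M)).ncard = t := by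
    rw [Set.ncard_sdiff hsub (hMfin.image _), Set.ncard_image_of_injective _ (add_right_injective a),
      ht, hm]
    omega
  have hNfin : ((M + D) \ ((fun x => a + x) '' M)).Finite := (hMfin.add hDfin).sdiff
  obtain ⟨hf, hc⟩ := aux_iter_card D hDfin k
  have hdpos : 0 < d := hd ▸ (Set.ncard_pos hDfin).2 ⟨a, ha⟩
  calc _ ≤ _ := Set.ncard_le_ncard (aux_cover M D a ha k) ((hMfin.image _).union (hNfin.add hf))
    _ ≤ _ := Set.ncard_union_le _ _
    _ ≤ m + t * d ^ k := by
      refine add_le_add (hm ▸ Set.ncard_image_le hMfin) ?_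
      refine (Set.natCard_add_le (s := (M + D) \ ((fun x => a + x) '' M))
        (t := iterSumset D k)).trans ?_
      exact Nat.mul_le_mul hN.le (hd ▸ hc)
    _ ≤ m + d ^ (k + 1) * t := by
      rw [mul_comm]
      gcongr
      omega
end

section
/- Let F be an abelian group, D ⊆ F a finite nonempty subset, and M ⊆ F a finite subset with |M| = m and |M + D| = m + t, where t ≥ 1. Then for every positive integer k and every real c ≥ 4, there exists a subset M^{(k)} ⊆ M with |M \ M^{(k)}| ≤ k · t/c such that |M^{(k)} + (i+1)D| ≤ m + (2i)^{i+1} · c^i · t for every integer 1 ≤ i ≤ k. -/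
open Pointwise

lemma petridis_aux {F : Type*} [AddCommGroup F] [DecidableEq F] (X D : Finset F) (K : ℝ)
    (hK : 0 ≤ K)
    (hX : ∀ Z ⊆ X, ((X + D).card : ℝ) - K * X.card ≤ (Z + D).card - K * Z.card)
    (C : Finset F) (hC : C.Nonempty) :
    ((X + C + D).card : ℝ) + K * X.card ≤ (X + D).card + K * (X + C).card := by
  induction hC using Finset.Nonempty.cons_induction with
  | singleton a =>
    have h1 : (X + {a} + D).card = (X + D).card := by
      rw [add_right_comm, Finset.card_add_singleton]
    rw [h1, Finset.card_add_singleton]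
  | cons x C hx hC ih =>
    rw [Finset.cons_eq_insert]
    set Z := X.filter (fun z => ∀ d ∈ D, z + x + d ∈ X + C + D) with hZ
    have hZX : Z ⊆ X := Finset.filter_subset _ _
    have hz := hX Z hZX
    -- upper bound
    have h1 : X + insert x C + D ⊆ (X + C + D) ∪ (((X + D) \ (Z + D)) + {x}) := by
      intro y hy
      obtain ⟨u, hu, d, hd, rfl⟩ := Finset.mem_add.1 hy
      obtain ⟨a, ha, b, hb, rfl⟩ := Finset.mem_add.1 hu
      rw [Finset.mem_union]
      by_cases hin : a + b + d ∈ X + C + D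
      · exact Or.inl hin
      · right
        rcases Finset.mem_insert.1 hb with rfl | hb
        · refine Finset.mem_add.2 ⟨a + d, ?_, b, Finset.mem_singleton_self _, by abel⟩
          rw [Finset.mem_sdiff]
          refine ⟨Finset.add_mem_add ha hd, fun h => hin ?_⟩
          obtain ⟨z, hz, e, he, hze⟩ := Finset.mem_add.1 h
          have := (Finset.mem_filter.1 hz).2 e he
          have h2 : a + b + d = z + b + e := by
            rw [add_right_comm, ← hze]; abel
          rwa [h2]
        · exact absurd (Finset.add_mem_add (Finset.add_mem_add ha hb) hd) hin
    have h2 : ((X + insert x C + D).card : ℝ) ≤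
        (X + C + D).card + ((X + D).card - (Z + D).card) := by
      have e1 := (Finset.card_le_card h1).trans (Finset.card_union_le _ _)
      rw [Finset.card_add_singleton] at e1
      have e2 := Finset.card_sdiff_add_card_eq_card (Finset.add_subset_add_right (t := D) hZX)
      have e1' : ((X + insert x C + D).card : ℝ) ≤
        (X + C + D).card + (((X + D) \ (Z + D)).card : ℝ) := by exact_mod_cast e1
      have e2' : (((X + D) \ (Z + D)).card : ℝ) + (Z + D).card = (X + D).card := by
        exact_mod_cast e2
      linarith
    -- lower bound
    have h3 : (X + C) ∪ ((X \ Z) + {x}) ⊆ X + insert x C := by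
      apply Finset.union_subset
      · exact Finset.add_subset_add_left (Finset.subset_insert _ _)
      · apply Finset.add_subset_add Finset.sdiff_subset
        simp
    have hdis : Disjoint (X + C) ((X \ Z) + {x}) := by
      rw [Finset.disjoint_left]
      intro y hy hy2
      obtain ⟨a, ha, b, hb, rfl⟩ := Finset.mem_add.1 hy2
      rw [Finset.mem_singleton] at hb
      subst hb
      rw [Finset.mem_sdiff] at ha
      exact ha.2 (Finset.mem_filter.2 ⟨ha.1, fun d hd => Finset.add_mem_add hy hd⟩)
    have h4 : ((X + C).card : ℝ) + (X.card - Z.card) ≤ (X + insert x C).card := by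
      have e1 := Finset.card_le_card h3
      rw [Finset.card_union_of_disjoint hdis, Finset.card_add_singleton] at e1
      have e2 := Finset.card_sdiff_add_card_eq_card hZX
      have e1' : ((X + C).card : ℝ) + ((X \ Z).card : ℝ) ≤ (X + insert x C).card := by
        exact_mod_cast e1
      have e2' : ((X \ Z).card : ℝ) + Z.card = X.card := by exact_mod_cast e2
      linarith
    have h5 := mul_le_mul_of_nonneg_left h4 hK
    linarith

lemma iterSumset_coe {F : Type*} [AddCommGroup F] [DecidableEq F] (D : Finset F)
    (hD : D.Nonempty) (j : ℕ) :
    ∃ E : Finset F, E.Nonempty ∧ (E : Set F) = iterSumset (D : Set F) j := by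
  induction j with
  | zero => exact ⟨{0}, by simp, by simp [iterSumset]⟩
  | succ n ih =>
    obtain ⟨E, hE, h⟩ := ih
    exact ⟨E + D, hE.add hD, by rw [iterSumset, ← h, Finset.coe_add]⟩

/-- Iterated Plünnecke–Ruzsa selection: if `|M + D| = m + t`, then for every `k ≥ 1` and
`c ≥ 4` there is `M⁽ᵏ⁾ ⊆ M` with `|M \ M⁽ᵏ⁾| ≤ k·t/c` and
`|M⁽ᵏ⁾ + (i+1)D| ≤ m + (2i)^{i+1}·cⁱ·t` for all `1 ≤ i ≤ k`. -/
theorem stmt11 {F : Type*} [AddCommGroup F] (M D : Set F)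
    (hMfin : M.Finite) (hDfin : D.Finite) (hDne : D.Nonempty)
    (m t : ℕ) (hm : M.ncard = m) (ht : (M + D).ncard = m + t) (ht1 : 1 ≤ t)
    (k : ℕ) (hk : 1 ≤ k) (c : ℝ) (hc : 4 ≤ c) :
    ∃ Mk : Set F, Mk ⊆ M ∧
      ((M \ Mk).ncard : ℝ) ≤ (k : ℝ) * (t : ℝ) / c ∧
      ∀ i : ℕ, 1 ≤ i → i ≤ k →
        ((Mk + iterSumset D (i + 1)).ncard : ℝ) ≤
          (m : ℝ) + (2 * (i : ℝ)) ^ (i + 1) * c ^ i * (t : ℝ) := by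

  classical
  lift M to Finset F using hMfin
  lift D to Finset F using hDfin
  have hD : D.Nonempty := by simpa using hDne
  rw [Set.ncard_coe_finset] at hm
  rw [← Finset.coe_add, Set.ncard_coe_finset] at ht
  have hmR : (M.card : ℝ) = m := by exact_mod_cast hm
  have htR : ((M + D).card : ℝ) = m + t := by exact_mod_cast ht
  have ht0 : (0 : ℝ) < t := by exact_mod_cast ht1
  have hc0 : (0 : ℝ) < c := by linarith
  obtain ⟨X, hXM, hmin⟩ := Finset.exists_min_image M.powerset
    (fun Z => ((Z + D).card : ℝ) - (1 + c) * Z.card) ⟨M, by simp⟩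
  rw [Finset.mem_powerset] at hXM
  have hXmin : ∀ Z ⊆ X, ((X + D).card : ℝ) - (1 + c) * X.card ≤
      (Z + D).card - (1 + c) * Z.card :=
    fun Z hZ => hmin Z (Finset.mem_powerset.2 (hZ.trans hXM))
  have hM := hmin M (by simp)
  simp only [hmR, htR] at hM
  have hXD : (X.card : ℝ) ≤ (X + D).card := by
    exact_mod_cast Finset.card_le_card_add_right hD
  have hXm : (X.card : ℝ) ≤ m := by
    rw [← hmR]; exact_mod_cast Finset.card_le_card hXM
  have hA : c * (m - X.card) ≤ t := by nlinarith
  have hB : ((X + D).card : ℝ) - X.card ≤ t := by nlinarith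
  have key : ∀ j : ℕ, c * (((((X : Set F) + iterSumset (D : Set F) j).ncard : ℝ)) - X.card) ≤
      ((1 + c) ^ j - 1) * t := by
    intro j
    induction j with
    | zero => simp [iterSumset]
    | succ n ih =>
      obtain ⟨E, hE, h⟩ := iterSumset_coe D hD n
      rw [iterSumset, ← h, ← add_assoc, ← Finset.coe_add, ← Finset.coe_add,
        Set.ncard_coe_finset]
      rw [← h, ← Finset.coe_add, Set.ncard_coe_finset] at ih
      have hp := petridis_aux X D (1 + c) (by linarith) hXmin E hE
      have h1 : ((X + E + D).card : ℝ) - X.card ≤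
          t + (1 + c) * ((X + E).card - X.card) := by linarith
      have h2 := mul_le_mul_of_nonneg_left h1 hc0.le
      have h3 := mul_le_mul_of_nonneg_left ih (by linarith : 0 ≤ 1 + c)
      rw [pow_succ]
      linarith
  refine ⟨X, by simpa using hXM, ?_, ?_⟩
  · rw [← Finset.coe_sdiff, Set.ncard_coe_finset, le_div_iff₀ hc0]
    have e2 := Finset.card_sdiff_add_card_eq_card hXM
    have e2' : ((M \ X).card : ℝ) + X.card = m := by rw [← hmR]; exact_mod_cast e2
    have hk' : (1 : ℝ) ≤ k := by exact_mod_cast hk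
    have : ((M \ X).card : ℝ) = m - X.card := by linarith
    rw [this]
    nlinarith
  · intro i hi _
    have hk1 := key (i + 1)
    have hi' : (1 : ℝ) ≤ i := by exact_mod_cast hi
    have h1 : (1 + c) ^ (i + 1) ≤ (2 * (i : ℝ) * c) ^ (i + 1) := by
      apply pow_le_pow_left₀ (by linarith)
      nlinarith
    have h2 : (2 * (i : ℝ) * c) ^ (i + 1) = c * ((2 * (i : ℝ)) ^ (i + 1) * c ^ i) := by
      rw [mul_pow, pow_succ c]; ring
    rw [h2] at h1
    have h3 := mul_le_mul_of_nonneg_right h1 ht0.le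
    have h4 : c * (((((X : Set F) + iterSumset (D : Set F) (i + 1)).ncard : ℝ)) - X.card) ≤
        c * ((2 * (i : ℝ)) ^ (i + 1) * c ^ i * t) := by linarith
    have h5 := le_of_mul_le_mul_left h4 hc0
    linarith
end

section
/- Let F be a finite abelian group of order 2n, X a subgroup of F of index 2 with coset Y = F \ X, and D ⊆ Y a generating set of F with D = −D. Let M ⊆ X be a nonempty subset with |M| ≤ |X|/2 and M + 2D ≠ X, and let α = |M + D|/|M| (a real number). Then |2D| ≤ 2(α² − 1)|M|, i.e., |2D| · |M| ≤ 2(|M + D|² − |M|²). -/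
open Pointwise

/-- Atoms: a set of minimal boundary, and of minimal size among those. -/
lemma exists_atom_s12 {F : Type*} [AddCommGroup F] [DecidableEq F] (X B M : Finset F)
    (hMX : M ⊆ X) (hMne : M.Nonempty) (hM : M + B ≠ X) (h0B : (0 : F) ∈ B) :
    ∃ A : Finset F, A ⊆ X ∧ A.Nonempty ∧ A + B ≠ X ∧
      (∀ C : Finset F, C ⊆ X → C.Nonempty → C + B ≠ X → (A + B).card + C.card ≤ (C + B).card + A.card) ∧
      (∀ C : Finset F, C ⊆ X → C.Nonempty → C + B ≠ X →
        (C + B).card + A.card = (A + B).card + C.card → A.card ≤ C.card) := by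
  classical
  let P : Finset (Finset F) := X.powerset.filter (fun C => C.Nonempty ∧ C + B ≠ X)
  have hP : ∀ C, C ∈ P ↔ C ⊆ X ∧ C.Nonempty ∧ C + B ≠ X := by
    intro C; simp [P]
  obtain ⟨A0, hA0, hmin0⟩ := Finset.exists_min_image P
    (fun C => ((C + B).card : ℤ) - C.card) ⟨M, (hP M).2 ⟨hMX, hMne, hM⟩⟩
  let Q := P.filter (fun C => (C + B).card + A0.card = (A0 + B).card + C.card)
  obtain ⟨A, hA, hmin⟩ := Finset.exists_min_image Q (fun C => C.card)
    ⟨A0, by simp [Q, hA0]⟩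
  have hA' := Finset.mem_filter.1 hA
  obtain ⟨h1, h2, h3⟩ := (hP A).1 hA'.1
  refine ⟨A, h1, h2, h3, ?_, ?_⟩
  · intro C a b c
    have := hmin0 C ((hP C).2 ⟨a, b, c⟩)
    have := hA'.2
    omega
  · intro C a b c h
    refine hmin C (Finset.mem_filter.2 ⟨(hP C).2 ⟨a, b, c⟩, ?_⟩)
    have := hA'.2
    omega

lemma olson_aux {F : Type*} [AddCommGroup F] [DecidableEq F] (X B M : Finset F)
    (hadd : ∀ x ∈ X, ∀ y ∈ X, x + y ∈ X) (hneg : ∀ x ∈ X, -x ∈ X)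
    (hBX : B ⊆ X) (h0B : (0 : F) ∈ B) (hsymm : ∀ x ∈ B, -x ∈ B)
    (hgen : ∀ A : Finset F, A ⊆ X → A.Nonempty → A + B ⊆ A → A = X)
    (hMX : M ⊆ X) (hMne : M.Nonempty) (hM : M + B ≠ X) :
    2 * M.card + B.card ≤ 2 * (M + B).card := by
  classical
  obtain ⟨A, hAX, hAne, hAB, hk, hm⟩ := exists_atom_s12 X B M hMX hMne hM h0B
  have hsub : ∀ C : Finset F, C ⊆ X → C + B ⊆ X := by
    intro C hC x hx
    obtain ⟨c, hc, b, hb, rfl⟩ := Finset.mem_add.1 hx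
    exact hadd _ (hC hc) _ (hBX hb)
  have hself : ∀ C : Finset F, C ⊆ C + B := fun C => Finset.subset_add_left C h0B
  -- the complement
  have hcompl : A.card + (A + B).card ≤ X.card := by
    set S := X \ (A + B) with hS
    have hSX : S ⊆ X := Finset.sdiff_subset
    have hSne : S.Nonempty := by
      rw [hS, Finset.sdiff_nonempty]
      intro h
      exact hAB (Finset.Subset.antisymm (hsub A hAX) h)
    have hSB : S + B ⊆ X \ A := by
      intro x hx
      refine Finset.mem_sdiff.2 ⟨hsub S hSX hx, fun hxA => ?_⟩
      obtain ⟨s, hs, b, hb, rfl⟩ := Finset.mem_add.1 hx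
      apply (Finset.mem_sdiff.1 hs).2
      have := Finset.add_mem_add hxA (hsymm b hb)
      simpa using this
    have hSBne : S + B ≠ X := by
      intro h
      obtain ⟨a, ha⟩ := hAne
      have := hSB (h ▸ hAX ha)
      exact (Finset.mem_sdiff.1 this).2 ha
    have c1 := Finset.card_le_card hSB
    have c2 := Finset.card_sdiff_add_card_eq_card hAX
    have c3 := Finset.card_sdiff_add_card_eq_card (hsub A hAX)
    rw [← hS] at c3
    have c4 := hk S hSX hSne hSBne
    have c5 := hm S hSX hSne hSBne (by omega)
    omega
  -- translates of the atom which meet it are equal to it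
  have htrans : ∀ t ∈ X, (A ∩ (A + {t})).Nonempty → A + {t} = A := by
    intro t ht hne
    set A2 := A + {t} with hA2
    have hA2X : A2 ⊆ X := by
      intro x hx
      obtain ⟨c, hc, b, hb, rfl⟩ := Finset.mem_add.1 hx
      rw [Finset.mem_singleton.1 hb]
      exact hadd _ (hAX hc) _ ht
    have hc2 : A2.card = A.card := by simp [hA2]
    have hc2B : (A2 + B).card = (A + B).card := by
      have : A2 + B = (A + B) + {t} := by rw [hA2, add_right_comm]
      rw [this]; simp
    have hI : (A ∩ A2) + B ⊆ (A + B) ∩ (A2 + B) := Finset.inter_add_subset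
    have hU : (A ∪ A2) + B = (A + B) ∪ (A2 + B) := Finset.union_add
    have hIX : A ∩ A2 ⊆ X := Finset.inter_subset_left.trans hAX
    have hIB : (A ∩ A2) + B ≠ X := by
      intro h
      apply hAB
      apply Finset.Subset.antisymm (hsub A hAX)
      rw [← h]
      exact Finset.add_subset_add_right Finset.inter_subset_left
    have hUX : A ∪ A2 ⊆ X := Finset.union_subset hAX hA2X
    have e1 := Finset.card_union_add_card_inter (A + B) (A2 + B)
    have e2 := Finset.card_union_add_card_inter A A2
    have e3 := Finset.card_le_card hI
    have e4 := hk _ hIX hne hIB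
    have e5 := hne.card_pos
    rw [← hU] at e1
    by_cases hUB : (A ∪ A2) + B = X
    · rw [hUB] at e1
      omega
    · have e6 := hk _ hUX (hAne.mono Finset.subset_union_left) hUB
      have e7 := hm _ hIX hne hIB (by omega)
      have e8 : A ∩ A2 = A := Finset.eq_of_subset_of_card_le Finset.inter_subset_left e7
      have e9 : A ⊆ A2 := by rw [← e8]; exact Finset.inter_subset_right
      exact (Finset.eq_of_subset_of_card_le e9 hc2.le).symm
  -- a point of B moving A
  have hmove : ¬ (A + B ⊆ A) := by
    intro h
    have h1 := hgen A hAX hAne h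
    exact hAB (Finset.Subset.antisymm (hsub A hAX) (h1 ▸ hself A))
  have h2A : 2 * A.card ≤ (A + B).card := by
    by_contra hlt
    apply hmove
    intro x hx
    obtain ⟨a, ha, b, hb, rfl⟩ := Finset.mem_add.1 hx
    have hbX := hBX hb
    have hne : (A ∩ (A + {b})).Nonempty := by
      rw [Finset.nonempty_iff_ne_empty]
      intro he
      have e2 := Finset.card_union_add_card_inter A (A + {b})
      have e3 : A ∪ (A + {b}) ⊆ A + B := Finset.union_subset (hself A)
        (Finset.add_subset_add_left (by simpa using hb))
      have e4 := Finset.card_le_card e3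
      have e5 : (A + {b}).card = A.card := by simp
      rw [he] at e2
      simp only [Finset.card_empty] at e2
      omega
    rw [← htrans b hbX hne]
    exact Finset.add_mem_add ha (Finset.mem_singleton_self b)
  have hBA : B.card ≤ (A + B).card := Finset.card_le_card_add_left hAne
  have := hk M hMX hMne hM
  omega

theorem stmt12 (n : ℕ) (F : Type*) [AddCommGroup F] [Fintype F]
    (hcard : Fintype.card F = 2 * n)
    (X : AddSubgroup F) (hX : X.index = 2)
    (D : Set F) (hDY : D ⊆ ((↑X : Set F))ᶜ) (hDsymm : ∀ x ∈ D, -x ∈ D)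
    (hDgen : AddSubgroup.closure D = ⊤)
    (M : Set F) (hMX : M ⊆ (↑X : Set F)) (hMne : M.Nonempty)
    (hMsmall : 2 * M.ncard ≤ Nat.card X)
    (hM2D : M + (D + D) ≠ (↑X : Set F)) :
    ((D + D).ncard : ℝ) * (M.ncard : ℝ) ≤
      2 * (((M + D).ncard : ℝ) ^ 2 - (M.ncard : ℝ) ^ 2) := by
  classical
  obtain ⟨d, rfl⟩ : ∃ d : Finset F, (d : Set F) = D := ⟨D.toFinset, by simp⟩
  obtain ⟨m, rfl⟩ : ∃ m : Finset F, (m : Set F) = M := ⟨M.toFinset, by simp⟩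
  obtain ⟨x, hx⟩ : ∃ x : Finset F, (x : Set F) = X := ⟨(X : Set F).toFinset, by simp⟩
  have hxm : ∀ a, a ∈ x ↔ a ∈ X := fun a => by
    rw [← Finset.mem_coe, hx]; rfl
  rw [← hx] at hMX hM2D hDY
  rw [← Finset.coe_add, ← Finset.coe_add] at *
  simp only [Set.ncard_coe_finset]
  have hmx : m ⊆ x := by exact_mod_cast hMX
  have hmd : m + (d + d) ≠ x := by
    intro h
    exact hM2D (by rw [← h])
  have hdn : ∀ a ∈ d, a ∉ X := fun a ha hX' => hDY ha ((hxm a).2 hX')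
  have hds : ∀ a ∈ d, -a ∈ d := fun a ha => by exact_mod_cast hDsymm a (by exact_mod_cast ha)
  have hmn : m.Nonempty := by exact_mod_cast hMne
  have hdne : d.Nonempty := by
    rw [Finset.nonempty_iff_ne_empty]
    rintro rfl
    rw [Finset.coe_empty, AddSubgroup.closure_empty] at hDgen
    have : X = ⊤ := top_le_iff.1 (hDgen ▸ bot_le)
    simp [this] at hX
  have hddX : d + d ⊆ x := by
    intro z hz
    obtain ⟨a, ha, b, hb, rfl⟩ := Finset.mem_add.1 hz
    rw [hxm, AddSubgroup.add_mem_iff_of_index_two hX]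
    simp [hdn a ha, hdn b hb]
  have h0 : (0 : F) ∈ d + d := by
    obtain ⟨a, ha⟩ := hdne
    simpa using Finset.add_mem_add ha (hds a ha)
  have hsym2 : ∀ z ∈ d + d, -z ∈ d + d := by
    intro z hz
    obtain ⟨a, ha, b, hb, rfl⟩ := Finset.mem_add.1 hz
    rw [neg_add]
    exact Finset.add_mem_add (hds a ha) (hds b hb)
  have hgen : ∀ A : Finset F, A ⊆ x → A.Nonempty → A + (d + d) ⊆ A → A = x := by
    intro A hAx hAne hA
    set T := A ∪ (A + d) with hT
    have hTd : ∀ g ∈ d, ∀ t ∈ T, t + g ∈ T := by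
      intro g hg t ht
      rcases Finset.mem_union.1 ht with h | h
      · exact Finset.mem_union_right _ (Finset.add_mem_add h hg)
      · obtain ⟨a, ha, b, hb, rfl⟩ := Finset.mem_add.1 h
        apply Finset.mem_union_left
        apply hA
        rw [add_assoc]
        exact Finset.add_mem_add ha (Finset.add_mem_add hb hg)
    have hTall : ∀ g ∈ AddSubgroup.closure (d : Set F), ∀ t ∈ T, t + g ∈ T ∧ t + -g ∈ T := by
      intro g hg
      induction hg using AddSubgroup.closure_induction with
      | mem g hg =>
        intro t ht
        have hg' : g ∈ d := by exact_mod_cast hg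
        exact ⟨hTd g hg' t ht, hTd _ (hds g hg') t ht⟩
      | zero => intro t ht; simpa using ht
      | add a b _ _ iha ihb =>
        intro t ht
        refine ⟨?_, ?_⟩
        · rw [← add_assoc]; exact (ihb _ (iha t ht).1).1
        · rw [neg_add, ← add_assoc]; exact (ihb _ (iha t ht).2).2
      | neg a _ ih =>
        intro t ht
        refine ⟨(ih t ht).2, ?_⟩
        rw [neg_neg]; exact (ih t ht).1
    apply Finset.Subset.antisymm hAx
    intro z hz
    obtain ⟨a, ha⟩ := hAne
    have h1 := (hTall (z - a) (by rw [hDgen]; trivial) a (Finset.mem_union_left _ ha)).1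
    rw [add_sub_cancel] at h1
    rcases Finset.mem_union.1 h1 with h | h
    · exact h
    · obtain ⟨a, ha, b, hb, rfl⟩ := Finset.mem_add.1 h
      exfalso
      have h2 := (hxm _).1 hz
      exact hdn b hb ((X.add_mem_cancel_left ((hxm a).1 (hAx ha))).1 h2)
  -- choose the minimiser
  obtain ⟨A, hA, hmin⟩ := Finset.exists_min_image (m.powerset.filter Finset.Nonempty)
    (fun C => ((C + d).card : ℚ) / C.card) ⟨m, by simp [hmn]⟩
  obtain ⟨hAm, hAne⟩ : A ⊆ m ∧ A.Nonempty := by simpa using hA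
  have hmin' : ∀ C ⊆ m, (A + d).card * C.card ≤ (C + d).card * A.card := by
    intro C hC
    obtain rfl | hCne := C.eq_empty_or_nonempty
    · simp
    have := hmin C (by simp [hC, hCne])
    have p1 : (0 : ℚ) < A.card := by exact_mod_cast hAne.card_pos
    have p2 : (0 : ℚ) < C.card := by exact_mod_cast hCne.card_pos
    rw [div_le_div_iff₀ p1 p2] at this
    exact_mod_cast this
  have hpl := Finset.pluennecke_petridis_inequality_add (A := A) (B := d) d
    (fun C hC => hmin' C (hC.trans hAm))
  have hAdd : A + (d + d) ≠ x := by
    intro h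
    apply hmd
    apply Finset.Subset.antisymm
    · intro z hz
      obtain ⟨a, ha, b, hb, rfl⟩ := Finset.mem_add.1 hz
      exact (hxm _).2 (X.add_mem ((hxm _).1 (hmx ha)) ((hxm _).1 (hddX hb)))
    · rw [← h]; exact Finset.add_subset_add_right hAm
  have hol := olson_aux x (d + d) A
    (fun a ha b hb => (hxm _).2 (X.add_mem ((hxm _).1 ha) ((hxm _).1 hb)))
    (fun a ha => (hxm _).2 (X.neg_mem ((hxm _).1 ha))) hddX h0 hsym2 hgen
    (hAm.trans hmx) hAne hAdd
  rw [add_comm d A, add_assoc] at hpl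
  have hmm := hmin' m subset_rfl
  have hAc := Finset.card_le_card hAm
  have hApos := hAne.card_pos
  have hge : A.card ≤ (A + d).card := Finset.card_le_card_add_right hdne
  generalize (A + (d + d)).card = s at *
  generalize (A + d).card = t at *
  generalize (m + d).card = u at *
  generalize (d + d).card = v at *
  generalize A.card = a at *
  generalize m.card = b at *
  rify at *
  -- v ≤ 2 (s - a), s a ≤ t^2, t b ≤ u a, a ≤ b, a ≤ t
  have hb : (0 : ℝ) < b := by linarith
  have k1 : (v : ℝ) * a ≤ 2 * (t ^ 2 - a ^ 2) := by nlinarith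
  have k2 : ((t : ℝ) * b) ^ 2 ≤ (u * a) ^ 2 := by
    gcongr
  have k3 : (v : ℝ) * a * b ≤ 2 * (t ^ 2 - a ^ 2) * b := by gcongr
  have k4 : 0 ≤ (t : ℝ) ^ 2 - a ^ 2 := by nlinarith
  have k5 : 2 * ((t : ℝ) ^ 2 - a ^ 2) * b * a ≤ 2 * (t ^ 2 - a ^ 2) * b * b := by gcongr
  have k6 : (v : ℝ) * b * a ^ 2 ≤ 2 * (u ^ 2 - b ^ 2) * a ^ 2 := by nlinarith
  exact le_of_mul_le_mul_right k6 (by positivity)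
end

section
/- Let F be an abelian group, D ⊆ F a finite subset with |D| = d ≥ 4, and D' ⊆ D a subset with |D \ D'| ≤ √d / log d. Then |D + D'| ≥ |2D| · (1 − 1/(log d)²). -/
open Pointwise Real

theorem stmt13 {F : Type*} [AddCommGroup F] (D D' : Set F) (hDfin : D.Finite)
    (d : ℕ) (hd : D.ncard = d) (hd4 : 4 ≤ d) (hD' : D' ⊆ D)
    (hdiff : ((D \ D').ncard : ℝ) ≤ Real.sqrt d / logb 2 d) :
    ((D + D).ncard : ℝ) * (1 - 1 / (logb 2 d) ^ 2) ≤ ((D + D').ncard : ℝ) := by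
  have hEfin : (D \ D').Finite := hDfin.sdiff
  have hsub : D + D ⊆ (D + D') ∪ ((D \ D') + (D \ D')) := by
    rintro _ ⟨a, ha, b, hb, rfl⟩
    by_cases h1 : b ∈ D'
    · exact Or.inl ⟨a, ha, b, h1, rfl⟩
    by_cases h2 : a ∈ D'
    · exact Or.inl ⟨b, hb, a, h2, add_comm _ _⟩
    exact Or.inr ⟨a, ⟨ha, h2⟩, b, ⟨hb, h1⟩, rfl⟩
  have hfin : ((D + D') ∪ ((D \ D') + (D \ D'))).Finite :=
    (hDfin.add (hDfin.subset hD')).union (hEfin.add hEfin)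
  have h1 : (D + D).ncard ≤ (D + D').ncard + ((D \ D') + (D \ D')).ncard :=
    (Set.ncard_le_ncard hsub hfin).trans (Set.ncard_union_le _ _)
  have h2 : ((D \ D') + (D \ D')).ncard ≤ (D \ D').ncard * (D \ D').ncard := by
    simpa only [Nat.card_coe_set_eq] using Set.natCard_add_le (s := D \ D') (t := D \ D')
  have h3 : d ≤ (D + D).ncard := by
    have hne : D.Nonempty := by
      apply Set.nonempty_of_ncard_ne_zero
      omega
    obtain ⟨x, hx⟩ := hne
    have : ((fun y => x + y) '' D).ncard = D.ncard :=
      Set.ncard_image_of_injective _ (add_right_injective x)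
    rw [← hd, ← this]
    apply Set.ncard_le_ncard _ (hDfin.add hDfin)
    rintro _ ⟨y, hy, rfl⟩
    exact ⟨x, hx, y, hy, rfl⟩
  have hL : 0 < logb 2 (d : ℝ) := by
    apply Real.logb_pos (by norm_num)
    exact_mod_cast (by omega : 1 < d)
  have h4 : ((D \ D').ncard : ℝ) * (D \ D').ncard ≤ d / (logb 2 d) ^ 2 := by
    calc ((D \ D').ncard : ℝ) * (D \ D').ncard
        ≤ (Real.sqrt d / logb 2 d) * (Real.sqrt d / logb 2 d) := by gcongr
      _ = d / (logb 2 d) ^ 2 := by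
        rw [div_mul_div_comm, Real.mul_self_sqrt (Nat.cast_nonneg d), sq]
  have h5 : (d : ℝ) / (logb 2 d) ^ 2 ≤ ((D + D).ncard : ℝ) / (logb 2 d) ^ 2 := by
    gcongr
  have h6 : ((D + D).ncard : ℝ) ≤ (D + D').ncard + ((D \ D').ncard : ℝ) * (D \ D').ncard := by
    exact_mod_cast h1.trans (Nat.add_le_add_left h2 _)
  rw [mul_sub, mul_one, mul_one_div]
  linarith
end
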